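/- arXiv:1710.09493 — 3 statements merged into one kernel-verified Lean document; each statement's English description precedes it below -/
import Mathlib

section
/- Let d ≥ 3 and let F be a finite family of closed balls in ℝ^d such that every d members of F have a common point. If d = 3 or d = 4, then F has a piercing set of at most 4(d+1) points; if d ≥ 6, then F has a piercing set of at most 3(d+1) points. -/
open Finset

/-- Dual maximiser for the minimax of shifted powers. -/
lemma dual_exists {V : Type*} [NormedAddCommGroup V] [InnerProductSpace ℝ V]
    {κ : Type*} [Fintype κ] [Nonempty κ] (c : κ → V) (q : κ → ℝ) :
    ∃ (μ : κ → ℝ) (x : V) (η : ℝ), (∀ j, 0 ≤ μ j) ∧ ∑ j, μ j = 1 ∧ ∑ j, μ j • (c j - x) = 0 ∧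
      (∀ j, ‖c j - x‖ ^ 2 - q j ≤ η) ∧ (∀ j, μ j * (‖c j - x‖ ^ 2 - q j) = μ j * η) := by
  classical
  obtain ⟨μ, hμ, hmax⟩ := (isCompact_stdSimplex ℝ κ).exists_isMaxOn
    (f := fun μ : κ → ℝ => ∑ j, μ j * (‖c j‖ ^ 2 - q j) - ‖∑ j, μ j • c j‖ ^ 2)
    ⟨Pi.single (Classical.arbitrary κ) 1, single_mem_stdSimplex ℝ _⟩
    (by fun_prop)
  obtain ⟨h0, h1⟩ := hμ
  set x := ∑ j, μ j • c j with hx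
  set A := ∑ j, μ j * (‖c j‖ ^ 2 - q j) with hA
  have hle : ∀ j, ‖c j - x‖ ^ 2 - q j ≤ A - ‖x‖ ^ 2 := by
    intro j
    have key : ∀ t : ℝ, 0 < t → t ≤ 1 →
        (‖c j‖ ^ 2 - q j) - A - 2 * inner ℝ x (c j - x) ≤ t * ‖c j - x‖ ^ 2 := by
      intro t ht ht1
      have hm := hmax (show (fun i => (1 - t) * μ i + t * (Pi.single j (1:ℝ) : κ → ℝ) i) ∈ stdSimplex ℝ κ from by
        refine ⟨fun i => ?_, ?_⟩
        · have : 0 ≤ (Pi.single j (1:ℝ) : κ → ℝ) i := by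
            by_cases h : i = j
            · subst h; simp
            · simp [h]
          have := h0 i
          have : 0 ≤ 1 - t := by linarith
          positivity
        · rw [Finset.sum_add_distrib, ← Finset.mul_sum, ← Finset.mul_sum, h1]
          simp)
      simp only [Set.mem_ofPred_eq] at hm
      have e1 : ∑ i, ((1 - t) * μ i + t * (Pi.single j (1:ℝ) : κ → ℝ) i) * (‖c i‖ ^ 2 - q i)
          = (1 - t) * A + t * (‖c j‖ ^ 2 - q j) := by
        simp only [add_mul, Finset.sum_add_distrib, mul_assoc, ← Finset.mul_sum]
        simp [Pi.single_apply, hA]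
      have e2 : ∑ i, ((1 - t) * μ i + t * (Pi.single j (1:ℝ) : κ → ℝ) i) • c i
          = x + t • (c j - x) := by
        simp only [add_smul, Finset.sum_add_distrib, mul_smul, ← Finset.smul_sum]
        simp [Pi.single_apply, ite_smul]
        rw [← hx]
        module
      rw [e1, e2] at hm
      have e3 : ‖x + t • (c j - x)‖ ^ 2 = ‖x‖ ^ 2 + 2 * (t * inner ℝ x (c j - x)) + t ^ 2 * ‖c j - x‖ ^ 2 := by
        rw [norm_add_sq_real, inner_smul_right, norm_smul, mul_pow, Real.norm_eq_abs, sq_abs]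
      rw [e3] at hm
      have : t * ((‖c j‖ ^ 2 - q j) - A - 2 * inner ℝ x (c j - x)) ≤ t * (t * ‖c j - x‖ ^ 2) := by
        nlinarith
      exact le_of_mul_le_mul_left this ht
    have hB : (‖c j‖ ^ 2 - q j) - A - 2 * inner ℝ x (c j - x) ≤ 0 := by
      by_contra! hcon
      set B := (‖c j‖ ^ 2 - q j) - A - 2 * inner ℝ x (c j - x)
      have hC : 0 < ‖c j - x‖ ^ 2 := by
        have := key 1 one_pos le_rfl
        linarith
      set C := ‖c j - x‖ ^ 2
      have h2 := key (min 1 (B / (2 * C))) (lt_min one_pos (by positivity)) (min_le_left _ _)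
      have h3 : min 1 (B / (2 * C)) * C ≤ B / (2 * C) * C :=
        mul_le_mul_of_nonneg_right (min_le_right _ _) hC.le
      have h4 : B / (2 * C) * C = B / 2 := by field_simp
      linarith
    have e : ‖c j‖ ^ 2 = ‖x‖ ^ 2 + 2 * inner ℝ x (c j - x) + ‖c j - x‖ ^ 2 := by
      rw [← norm_add_sq_real]; congr 2; abel
    linarith
  have hz : ∑ j, μ j • (c j - x) = 0 := by
    simp only [smul_sub, Finset.sum_sub_distrib, ← Finset.sum_smul, h1, one_smul]
    rw [← hx, sub_self]
  have hs : ∑ j, μ j * (‖c j - x‖ ^ 2 - q j) = A - ‖x‖ ^ 2 := by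
    have e : ∀ j, μ j * (‖c j - x‖ ^ 2 - q j) =
        μ j * (‖c j‖ ^ 2 - q j) - μ j * ‖x‖ ^ 2 - 2 * inner ℝ x (μ j • (c j - x)) := by
      intro j
      have e : ‖c j‖ ^ 2 = ‖x‖ ^ 2 + 2 * inner ℝ x (c j - x) + ‖c j - x‖ ^ 2 := by
        rw [← norm_add_sq_real]; congr 2; abel
      rw [e, inner_smul_right]; ring
    simp only [e, Finset.sum_sub_distrib, ← Finset.mul_sum, ← Finset.sum_mul, h1, ← inner_sum, hz]
    simp [hA]
  refine ⟨μ, x, A - ‖x‖ ^ 2, h0, h1, hz, hle, ?_⟩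
  have hs2 : ∑ j, μ j * ((A - ‖x‖ ^ 2) - (‖c j - x‖ ^ 2 - q j)) = 0 := by
    simp only [mul_sub _ (A - ‖x‖ ^ 2), Finset.sum_sub_distrib, hs, ← Finset.sum_mul, h1]
    ring
  rw [Finset.sum_eq_zero_iff_of_nonneg (fun j _ => mul_nonneg (h0 j) (by linarith [hle j]))] at hs2
  intro j
  have := hs2 j (Finset.mem_univ _)
  linarith

/-- Adamovic and Hlawka inequality for vectors summing to zero. -/
lemma pair_norm_sum {V : Type*} [NormedAddCommGroup V] [InnerProductSpace ℝ V]
    {κ : Type*} [Fintype κ] (u : κ → V) (hu : ∑ k, u k = 0) :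
    ∑ k, ∑ l, ‖u k + u l‖ ≤ (2 * Fintype.card κ - 2) * ∑ k, ‖u k‖ := by
  classical
  set R := ∑ k, ‖u k‖ with hR
  have hR0 : 0 ≤ R := Finset.sum_nonneg fun _ _ => norm_nonneg _
  have hD : ∀ k l, 2 * (‖u k‖ * ‖u l‖ - inner ℝ (u k) (u l)) ≤
      (‖u k‖ + ‖u l‖ - ‖u k + u l‖) * R := by
    intro k l
    by_cases hkl : k = l
    · subst hkl
      have : ‖u k + u k‖ = ‖u k‖ + ‖u k‖ := by
        rw [← two_smul ℝ, norm_smul]; simp; ring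
      rw [this, real_inner_self_eq_norm_sq]
      nlinarith
    · have h1 : ‖u k + u l‖ + (‖u k‖ + ‖u l‖) ≤ R := by
        have hs : u k + u l = - ∑ j ∈ univ \ {k, l}, u j := by
          rw [eq_neg_iff_add_eq_zero, ← hu, ← Finset.sum_sdiff (Finset.subset_univ {k, l}),
            Finset.sum_pair hkl, add_comm]
        have h2 : R = ∑ j ∈ univ \ {k, l}, ‖u j‖ + (‖u k‖ + ‖u l‖) := by
          rw [hR, ← Finset.sum_sdiff (Finset.subset_univ {k, l}), Finset.sum_pair hkl]
        have h3 : ‖u k + u l‖ ≤ ∑ j ∈ univ \ {k, l}, ‖u j‖ := by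
          rw [hs, norm_neg]; exact norm_sum_le _ _
        linarith
      have h4 : ‖u k + u l‖ ^ 2 = ‖u k‖ ^ 2 + 2 * inner ℝ (u k) (u l) + ‖u l‖ ^ 2 :=
        norm_add_sq_real _ _
      have h5 := norm_add_le (u k) (u l)
      nlinarith
  have hsum : ∑ k, ∑ l, 2 * (‖u k‖ * ‖u l‖ - inner ℝ (u k) (u l)) = 2 * R ^ 2 := by
    simp only [← Finset.mul_sum, Finset.sum_sub_distrib, ← inner_sum, hu, inner_zero_right,
      ← Finset.sum_mul]
    simp [hR]; ring
  have hle := Finset.sum_le_sum fun k (_ : k ∈ univ) =>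
    Finset.sum_le_sum fun l (_ : l ∈ univ) => hD k l
  rw [hsum] at hle
  simp only [← Finset.sum_mul] at hle
  have e : ∑ k, ∑ l, (‖u k‖ + ‖u l‖ - ‖u k + u l‖) =
      2 * Fintype.card κ * R - ∑ k, ∑ l, ‖u k + u l‖ := by
    simp only [Finset.sum_sub_distrib, Finset.sum_add_distrib]
    simp [hR, ← Finset.mul_sum]; ring
  rw [e] at hle
  rcases hR0.eq_or_lt with h | h
  · have hz : ∀ k, u k = 0 := by
      intro k
      have := (Finset.sum_eq_zero_iff_of_nonneg (fun k _ => norm_nonneg (u k))).1 (h.symm.trans rfl |>.trans rfl) k (mem_univ _)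
      simpa using this
    simp [hz, hR]
  · have : 2 * R ≤ 2 * Fintype.card κ * R - ∑ k, ∑ l, ‖u k + u l‖ := by
      apply le_of_mul_le_mul_right _ h
      linarith
    linarith

/-- Dropping the indices of `S` from the weighted sum of powers. -/
lemma drop_ineq {V : Type*} [NormedAddCommGroup V] [InnerProductSpace ℝ V]
    {κ : Type*} [Fintype κ] [DecidableEq κ] (v : κ → V) (r μ : κ → ℝ) (h0 : ∀ j, 0 ≤ μ j)
    (h1 : ∑ j, μ j = 1) (hv : ∑ j, μ j • v j = 0) (S : Finset κ) (z : V)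
    (hz : ∀ j, j ∉ S → ‖z - v j‖ ^ 2 ≤ r j ^ 2) :
    ‖z‖ ^ 2 + ∑ j, μ j * (‖v j‖ ^ 2 - r j ^ 2) ≤
      ∑ j ∈ S, μ j * (‖z‖ ^ 2 - 2 * inner ℝ z (v j) + (‖v j‖ ^ 2 - r j ^ 2)) := by
  have hin : ∑ j, μ j * inner ℝ z (v j) = 0 := by
    have : inner ℝ z (∑ j, μ j • v j) = 0 := by rw [hv]; simp
    simpa [inner_sum, inner_smul_right] using this
  have htot : ∑ j, μ j * (‖z‖ ^ 2 - 2 * inner ℝ z (v j) + (‖v j‖ ^ 2 - r j ^ 2)) =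
      ‖z‖ ^ 2 + ∑ j, μ j * (‖v j‖ ^ 2 - r j ^ 2) := by
    have : ∀ j, μ j * (‖z‖ ^ 2 - 2 * inner ℝ z (v j) + (‖v j‖ ^ 2 - r j ^ 2)) =
        μ j * ‖z‖ ^ 2 - 2 * (μ j * inner ℝ z (v j)) + μ j * (‖v j‖ ^ 2 - r j ^ 2) := by
      intro j; ring
    simp_rw [this, Finset.sum_add_distrib, Finset.sum_sub_distrib, ← Finset.mul_sum,
      ← Finset.sum_mul, h1, hin]
    ring
  rw [← htot, ← Finset.sum_add_sum_compl S]
  have : ∑ j ∈ Sᶜ, μ j * (‖z‖ ^ 2 - 2 * inner ℝ z (v j) + (‖v j‖ ^ 2 - r j ^ 2)) ≤ 0 := by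
    apply Finset.sum_nonpos
    intro j hj
    have h2 := hz j (by simpa using hj)
    rw [norm_sub_sq_real] at h2
    exact mul_nonpos_of_nonneg_of_nonpos (h0 j) (by linarith)
  linarith

lemma single_drop {V : Type*} [NormedAddCommGroup V] [InnerProductSpace ℝ V]
    {κ : Type*} [Fintype κ] [DecidableEq κ] (v : κ → V) (r μ : κ → ℝ) (h0 : ∀ j, 0 ≤ μ j)
    (h1 : ∑ j, μ j = 1) (hv : ∑ j, μ j • v j = 0) (k : κ) (z : V) (hk : μ k ≤ 1)
    (hz : ∀ j, j ≠ k → ‖z - v j‖ ^ 2 ≤ r j ^ 2) :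
    (1 - μ k) * (∑ j, μ j * (‖v j‖ ^ 2 - r j ^ 2)) ≤
      (μ k * r k) ^ 2 + μ k * (‖v k‖ ^ 2 - r k ^ 2) := by
  have h := drop_ineq v r μ h0 h1 hv {k} z (by simpa using hz)
  rw [Finset.sum_singleton] at h
  set T := ∑ j, μ j * (‖v j‖ ^ 2 - r j ^ 2)
  have hc := abs_le.1 (abs_real_inner_le_norm z (v k))
  have hq : 0 ≤ ((1 - μ k) * ‖z‖ - μ k * ‖v k‖) ^ 2 := sq_nonneg _
  have h3 : (1 - μ k) * ‖z‖ ^ 2 - 2 * μ k * (‖z‖ * ‖v k‖) + T -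
      μ k * (‖v k‖ ^ 2 - r k ^ 2) ≤ 0 := by
    nlinarith [mul_le_mul_of_nonneg_left hc.1 (h0 k)]
  have h4 := mul_le_mul_of_nonneg_left h3 (sub_nonneg.2 hk)
  nlinarith

lemma pair_drop {V : Type*} [NormedAddCommGroup V] [InnerProductSpace ℝ V]
    {κ : Type*} [Fintype κ] [DecidableEq κ] (v : κ → V) (r μ : κ → ℝ) (h0 : ∀ j, 0 ≤ μ j)
    (h1 : ∑ j, μ j = 1) (hv : ∑ j, μ j • v j = 0) (k l : κ) (hkl : k ≠ l) (z b : V)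
    (hb : ‖z - b‖ ≤ 1)
    (hz : ∀ j, j ≠ k → j ≠ l → ‖z - v j‖ ^ 2 ≤ r j ^ 2) :
    0 ≤ 2 * ‖μ k • v k + μ l • v l‖ - 2 * inner ℝ b (μ k • v k + μ l • v l)
      - (∑ j, μ j * (‖v j‖ ^ 2 - r j ^ 2)) + μ k * (‖v k‖ ^ 2 - r k ^ 2)
      + μ l * (‖v l‖ ^ 2 - r l ^ 2) := by
  have h := drop_ineq v r μ h0 h1 hv {k, l} z (by simpa using hz)
  rw [Finset.sum_pair hkl] at h
  set T := ∑ j, μ j * (‖v j‖ ^ 2 - r j ^ 2)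
  have hs : μ k + μ l ≤ 1 := by
    rw [← h1, ← Finset.sum_pair hkl]
    exact Finset.sum_le_sum_of_subset_of_nonneg (Finset.subset_univ _) (fun j _ _ => h0 j)
  have hc := abs_le.1 (abs_real_inner_le_norm (z - b) (μ k • v k + μ l • v l))
  have h5 : ‖z - b‖ * ‖μ k • v k + μ l • v l‖ ≤ ‖μ k • v k + μ l • v l‖ := by
    nlinarith [norm_nonneg (μ k • v k + μ l • v l)]
  have h6 := hc.1
  rw [inner_sub_left] at h6
  have h7 : inner ℝ z (μ k • v k + μ l • v l) = μ k * inner ℝ z (v k) + μ l * inner ℝ z (v l) := by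
    simp [inner_add_right, inner_smul_right]
  rw [h7] at h6
  nlinarith [mul_nonneg (sub_nonneg.2 hs) (sq_nonneg ‖z‖)]

lemma pair_total {V : Type*} [NormedAddCommGroup V] [InnerProductSpace ℝ V]
    {κ : Type*} [Fintype κ] [DecidableEq κ] (v : κ → V) (r μ : κ → ℝ) (h0 : ∀ j, 0 ≤ μ j)
    (h1 : ∑ j, μ j = 1) (hv : ∑ j, μ j • v j = 0) (b : V) (hn : 3 ≤ Fintype.card κ)
    (hz : ∀ k l, k ≠ l → ∃ z, ‖z - b‖ ≤ 1 ∧ ∀ j, j ≠ k → j ≠ l → ‖z - v j‖ ^ 2 ≤ r j ^ 2) :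
    ((Fintype.card κ : ℝ) - 1) * (∑ j, μ j * (‖v j‖ ^ 2 - r j ^ 2)) ≤
      4 * ∑ j, μ j * ‖v j‖ := by
  have hp := pair_norm_sum (fun k => μ k • v k) hv
  have hQ : ∑ k, ‖μ k • v k‖ = ∑ j, μ j * ‖v j‖ := by
    apply Finset.sum_congr rfl; intro j _; rw [norm_smul, Real.norm_of_nonneg (h0 j)]
  rw [hQ] at hp
  set T := ∑ j, μ j * (‖v j‖ ^ 2 - r j ^ 2) with hT
  set Q := ∑ j, μ j * ‖v j‖
  have hib : ∑ j, inner ℝ b (μ j • v j) = 0 := by rw [← inner_sum, hv]; simp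
  let g : κ → κ → ℝ := fun k l => 2 * ‖μ k • v k + μ l • v l‖ - 2 * inner ℝ b (μ k • v k + μ l • v l)
      - T + μ k * (‖v k‖ ^ 2 - r k ^ 2) + μ l * (‖v l‖ ^ 2 - r l ^ 2)
  have hg : ∀ k l, k ≠ l → 0 ≤ g k l := by
    intro k l hkl
    obtain ⟨z, hz1, hz2⟩ := hz k l hkl
    exact pair_drop v r μ h0 h1 hv k l hkl z b hz1 hz2
  have hge : ∑ k, g k k ≤ ∑ k, ∑ l, g k l := by
    apply Finset.sum_le_sum
    intro k _
    rw [← Finset.add_sum_erase _ _ (Finset.mem_univ k)]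
    have : 0 ≤ ∑ l ∈ Finset.univ.erase k, g k l :=
      Finset.sum_nonneg fun l hl => hg k l (Finset.ne_of_mem_erase hl).symm
    linarith
  have hdiag : ∑ k, g k k = 4 * Q - Fintype.card κ * T + 2 * T := by
    have : ∀ k, g k k = 4 * (μ k * ‖v k‖) - 4 * inner ℝ b (μ k • v k) - T +
        2 * (μ k * (‖v k‖ ^ 2 - r k ^ 2)) := by
      intro k
      simp only [g]
      rw [← two_smul ℝ (μ k • v k), norm_smul, norm_smul, inner_smul_right,
        Real.norm_of_nonneg (h0 k)]
      norm_num
      ring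
    simp_rw [this, Finset.sum_add_distrib, Finset.sum_sub_distrib, ← Finset.mul_sum, hib]
    simp [← hT, Q]
  have hall : ∑ k, ∑ l, g k l = 2 * ∑ k, ∑ l, ‖μ k • v k + μ l • v l‖
      - (Fintype.card κ : ℝ) ^ 2 * T + 2 * Fintype.card κ * T := by
    have : ∀ k l, g k l = 2 * ‖μ k • v k + μ l • v l‖ - T
        + (μ k * (‖v k‖ ^ 2 - r k ^ 2) - 2 * inner ℝ b (μ k • v k))
        + (μ l * (‖v l‖ ^ 2 - r l ^ 2) - 2 * inner ℝ b (μ l • v l)) := by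
      intro k l; simp only [g, inner_add_right]; ring
    simp_rw [this]
    simp only [Finset.sum_add_distrib, ← Finset.mul_sum, Finset.sum_const, Finset.card_univ,
      nsmul_eq_mul, Finset.sum_sub_distrib, hib, ← hT]
    ring
  rw [hdiag, hall] at hge
  have hn' : (3 : ℝ) ≤ Fintype.card κ := by exact_mod_cast hn
  set n : ℝ := (Fintype.card κ : ℝ)
  have hfin : (n - 2) * ((n - 1) * T) ≤ (n - 2) * (4 * Q) := by nlinarith
  exact le_of_mul_le_mul_left hfin (by linarith)

lemma core {V : Type*} [NormedAddCommGroup V] [InnerProductSpace ℝ V]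
    {κ : Type*} [Fintype κ] [DecidableEq κ] (d : ℕ) (hd : 3 ≤ d) (hcard : Fintype.card κ = d + 1)
    (p s : ℝ) (hp : 0 ≤ p) (hs : 0 ≤ s)
    (hnum : ∀ R μ ρ : ℝ, 1 ≤ R → (2 * p - 4) * R ≤ s + 4 * p / d → 0 ≤ μ → μ ≤ 1 / 2 → μ ≤ ρ →
      ρ - μ ≤ R - 1 →
      (ρ * (d + 1) ≤ R ∨ (ρ * d ≤ R - 1 / 2 ∧ ((d : ℝ) + 1) / 2 ≤ R)) →
      d * ρ ^ 2 + 2 * p * ρ - s * μ < (1 - μ) * (2 * p * R - s))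
    (c : κ → V) (r : κ → ℝ) (hr : ∀ j, 1 ≤ r j) (b : V)
    (hsing : ∀ k, ∃ y, ∀ j, j ≠ k → ‖y - c j‖ ≤ r j)
    (hpair : ∀ k l, k ≠ l → ∃ y, ‖y - b‖ ≤ 1 ∧ ∀ j, j ≠ k → j ≠ l → ‖y - c j‖ ≤ r j) :
    ∃ x, ∀ j, ‖x - c j‖ ^ 2 ≤ r j ^ 2 + (2 * p * r j - s) / d := by
  have hne : Nonempty κ := Fintype.card_pos_iff.1 (by omega)
  have hd' : (3 : ℝ) ≤ d := by exact_mod_cast hd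
  obtain ⟨μ, x, η, h0, h1, hv, hle, heq⟩ :=
    dual_exists c (fun j => r j ^ 2 + (2 * p * r j - s) / d)
  rcases le_or_gt η 0 with hη | hη
  · refine ⟨x, fun j => ?_⟩
    have := hle j
    rw [norm_sub_rev]; linarith
  exfalso
  have hmk : ∀ j, μ j * (‖c j - x‖ ^ 2 - r j ^ 2) = μ j * ((2 * p * r j - s) / d + η) := by
    intro j; have := heq j; linear_combination this
  set R := ∑ j, μ j * r j with hR
  have hT : ∑ j, μ j * (‖c j - x‖ ^ 2 - r j ^ 2) = (2 * p * R - s) / d + η := by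
    simp_rw [hmk]
    have : ∀ j, μ j * ((2 * p * r j - s) / d + η) =
      (2 * p / d) * (μ j * r j) + μ j * (η - s / d) := by intro j; ring
    simp_rw [this, Finset.sum_add_distrib, ← Finset.mul_sum, ← Finset.sum_mul, h1, ← hR]
    ring
  have hR1 : 1 ≤ R := by
    rw [← h1, hR]
    exact Finset.sum_le_sum fun j _ => by nlinarith [h0 j, hr j]
  have hQ : ∑ j, μ j * ‖c j - x‖ ≤ R + p / d + η / 2 := by
    have : ∀ j, μ j * ‖c j - x‖ ≤ μ j * r j + μ j * (p / d + η / 2) := by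
      intro j
      have hrj := hr j
      have hpd : 0 ≤ p / d := by positivity
      have hsd : 0 ≤ s / d := by positivity
      have e1 : 2 * r j * (μ j * ‖c j - x‖) ≤ 2 * μ j * r j ^ 2 +
          μ j * ((2 * p * r j - s) / d + η) := by
        rw [← hmk]
        nlinarith [mul_nonneg (h0 j) (sq_nonneg (‖c j - x‖ - r j))]
      have e2 : (2 * p * r j - s) / d + η ≤ 2 * r j * (p / d + η / 2) := by
        have : (2 * p * r j - s) / d = 2 * r j * (p / d) - s / d := by ring
        rw [this]; nlinarith
      have e3 := mul_le_mul_of_nonneg_left e2 (h0 j)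
      have e4 : 2 * r j * (μ j * ‖c j - x‖) ≤ 2 * r j * (μ j * r j + μ j * (p / d + η / 2)) := by
        linarith
      exact le_of_mul_le_mul_left e4 (by linarith)
    calc _ ≤ ∑ j, (μ j * r j + μ j * (p / d + η / 2)) := Finset.sum_le_sum fun j _ => this j
      _ = _ := by rw [Finset.sum_add_distrib, ← Finset.sum_mul, h1]; ring
  have hpt := pair_total (fun j => c j - x) r μ h0 h1 hv (b - x) (by omega) (by
    intro k l hkl
    obtain ⟨y, hy1, hy2⟩ := hpair k l hkl
    refine ⟨y - x, by simpa using hy1, fun j hj hj' => ?_⟩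
    have := hy2 j hj hj'
    simp only [sub_sub_sub_cancel_right]
    exact pow_le_pow_left₀ (norm_nonneg _) this 2)
  rw [hT, hcard] at hpt
  push_cast at hpt
  have hdT : (d : ℝ) * ((2 * p * R - s) / d + η) = 2 * p * R - s + d * η := by
    field_simp
  have hRb : (2 * p - 4) * R ≤ s + 4 * p / d := by
    have : 4 * p / d = 4 * (p / (d : ℝ)) := by ring
    rw [this]
    nlinarith
  have hmu1 : ∀ k, μ k ≤ 1 := fun k => by
    rw [← h1]; exact Finset.single_le_sum (fun j _ => h0 j) (Finset.mem_univ k)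
  have hmr : ∀ k, μ k ≤ μ k * r k := fun k => by nlinarith [h0 k, hr k]
  have hdiff : ∀ k, μ k * r k - μ k ≤ R - 1 := by
    intro k
    have : R - 1 = ∑ j, (μ j * r j - μ j) := by rw [Finset.sum_sub_distrib, h1]
    rw [this]
    exact Finset.single_le_sum (f := fun j => μ j * r j - μ j)
      (fun j _ => by have := hmr j; linarith) (Finset.mem_univ k)
  -- the final contradiction for a suitable index
  have hfin : ∀ k, μ k ≤ 1 / 2 → ((μ k * r k) * (d + 1) ≤ R ∨
      ((μ k * r k) * d ≤ R - 1 / 2 ∧ ((d : ℝ) + 1) / 2 ≤ R)) → False := by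
    intro k hk hor
    obtain ⟨y, hy⟩ := hsing k
    have hsd := single_drop (fun j => c j - x) r μ h0 h1 hv k (y - x) (hmu1 k) (by
      intro j hj
      simp only [sub_sub_sub_cancel_right]
      exact pow_le_pow_left₀ (norm_nonneg _) (hy j hj) 2)
    rw [hT, hmk] at hsd
    have h6 := hnum R (μ k) (μ k * r k) hR1 hRb (h0 k) hk (hmr k) (hdiff k) hor
    have h7 := mul_le_mul_of_nonneg_left hsd (by linarith : (0 : ℝ) ≤ d)
    have h8 : (d : ℝ) * ((1 - μ k) * ((2 * p * R - s) / d + η)) =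
        (1 - μ k) * (2 * p * R - s + d * η) := by rw [← hdT]; ring
    have h9 : (d : ℝ) * ((μ k * r k) ^ 2 + μ k * ((2 * p * r k - s) / d + η)) =
        d * (μ k * r k) ^ 2 + 2 * p * (μ k * r k) - s * μ k + d * μ k * η := by
      field_simp
      ring
    rw [h8, h9] at h7
    have h10 : 0 ≤ (1 - 2 * μ k) * (d * η) := mul_nonneg (by linarith) (by positivity)
    nlinarith
  obtain ⟨k0, -, hk0⟩ := Finset.exists_min_image Finset.univ (fun j => μ j * r j)
    Finset.univ_nonempty
  rcases le_or_gt (μ k0) (1 / 2) with hh | hh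
  · refine hfin k0 hh (Or.inl ?_)
    have := Finset.card_nsmul_le_sum Finset.univ (fun j => μ j * r j) (μ k0 * r k0) hk0
    rw [Finset.card_univ, hcard, nsmul_eq_mul] at this
    push_cast at this
    linarith
  · have hcE : (Finset.univ.erase k0).card = d := by
      rw [Finset.card_erase_of_mem (Finset.mem_univ _), Finset.card_univ, hcard]; rfl
    obtain ⟨k1, hk1, hmin⟩ := Finset.exists_min_image (Finset.univ.erase k0) (fun j => μ j * r j)
      (Finset.card_pos.1 (by omega))
    have hne1 : k1 ≠ k0 := Finset.ne_of_mem_erase hk1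
    have hμ1 : μ k1 ≤ 1 / 2 := by
      have : μ k0 + μ k1 ≤ 1 := by
        rw [← h1, ← Finset.sum_pair hne1.symm]
        exact Finset.sum_le_sum_of_subset_of_nonneg (Finset.subset_univ _) (fun j _ _ => h0 j)
      linarith
    refine hfin k1 hμ1 (Or.inr ⟨?_, ?_⟩)
    · have := Finset.card_nsmul_le_sum _ (fun j => μ j * r j) (μ k1 * r k1) hmin
      rw [hcE, nsmul_eq_mul] at this
      have h2 := Finset.add_sum_erase Finset.univ (fun j => μ j * r j) (Finset.mem_univ k0)
      have h3 := hmr k0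
      linarith
    · have := Finset.card_nsmul_le_sum Finset.univ (fun j => μ j * r j) (μ k0 * r k0) hk0
      rw [Finset.card_univ, hcard, nsmul_eq_mul] at this
      push_cast at this
      have h3 := hmr k0
      nlinarith

lemma hnum_ge_four (d : ℝ) (hd : 4 ≤ d) (R μ ρ : ℝ) (hR : 1 ≤ R)
    (hRb : (2 * (13/5) - 4) * R ≤ 483/100 + 4 * (13/5) / d) (h0 : 0 ≤ μ) (hμ : μ ≤ 1 / 2)
    (hμρ : μ ≤ ρ) (hdiff : ρ - μ ≤ R - 1)
    (hor : ρ * (d + 1) ≤ R ∨ (ρ * d ≤ R - 1 / 2 ∧ (d + 1) / 2 ≤ R)) :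
    d * ρ ^ 2 + 2 * (13/5) * ρ - (483/100) * μ < (1 - μ) * (2 * (13/5) * R - 483/100) := by
  have hρ : 0 ≤ ρ := le_trans h0 hμρ
  have hR6 : R ≤ 6.2 := by
    have : 4 * (13/5) / d ≤ 4 * (13/5) / 4 := by gcongr
    norm_num at this ⊢
    linarith
  rcases hor with h | ⟨h, h'⟩
  · have h5 : ρ * 5 ≤ R := by nlinarith
    have e : d * ρ ^ 2 ≤ ρ * R - ρ ^ 2 := by nlinarith
    have key : ρ * R - ρ ^ 2 + 2 * (13/5) * ρ - (483/100) * μ <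
        (1 - μ) * (2 * (13/5) * R - 483/100) := by
      rcases le_or_gt R (9.66 / 5.2) with hs | hs
      · rcases le_or_gt ρ (R - 1) with hc | hc
        · have a : 0 ≤ μ * (9.66 - 5.2 * R) := mul_nonneg h0 (by norm_num at hs ⊢; linarith)
          rcases le_or_gt R (5/4) with hR' | hR'
          · have b : 0 ≤ (R - 1 - ρ) * (5.2 + R - ρ - (R - 1)) :=
              mul_nonneg (by linarith) (by norm_num; linarith)
            norm_num at *
            nlinarith
          · have b : 0 ≤ (R / 5 - ρ) * (5.2 + R - ρ - R / 5) :=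
              mul_nonneg (by linarith) (by norm_num; linarith)
            norm_num at *
            nlinarith
        · have a : 0 ≤ (μ - (ρ - R + 1)) * (9.66 - 5.2 * R) :=
            mul_nonneg (by linarith) (by norm_num at hs ⊢; linarith)
          have b : 0 ≤ (R / 5 - ρ) * (6.2 * R - 4.46 - ρ - R / 5) :=
              mul_nonneg (by linarith) (by norm_num; linarith)
          have c : 0 < 4 * R ^ 2 - 8.768 * R + 4.83 := by
            norm_num; nlinarith [sq_nonneg (R - 1.096)]
          norm_num at *
          nlinarith
      · rcases le_or_gt ρ (1/2) with hc | hc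
        · have a : 0 ≤ (ρ - μ) * (5.2 * R - 9.66) :=
            mul_nonneg (by linarith) (by norm_num at hs ⊢; linarith)
          rcases le_or_gt R (5/2) with hR' | hR'
          · have b : 0 ≤ (R / 5 - ρ) * (6.2 * R - 4.46 - ρ - R / 5) :=
              mul_nonneg (by linarith) (by norm_num; linarith)
            have c : 0 ≤ (5 / 2 - R) * (R - 9.66 / 5.2) :=
              mul_nonneg (by linarith) (by linarith)
            norm_num at *
            nlinarith
          · have b : 0 ≤ (1 / 2 - ρ) * (6.2 * R - 4.46 - ρ - 1 / 2) :=
              mul_nonneg (by linarith) (by norm_num; linarith)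
            norm_num at *
            nlinarith
        · have a : 0 ≤ (1 / 2 - μ) * (5.2 * R - 9.66) :=
            mul_nonneg (by linarith) (by norm_num at hs ⊢; linarith)
          have b : 0 ≤ (R / 5 - ρ) * (5.2 + R - ρ - R / 5) :=
              mul_nonneg (by linarith) (by norm_num; linarith)
          norm_num at *
          nlinarith
    linarith
  · have h4 : ρ * 4 ≤ R - 1 / 2 := by nlinarith
    have e : d * ρ ^ 2 ≤ ρ * (R - 1 / 2) := by nlinarith
    have hR2 : 5 / 2 ≤ R := by linarith
    have key : ρ * (R - 1 / 2) + 2 * (13/5) * ρ - (483/100) * μ <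
        (1 - μ) * (2 * (13/5) * R - 483/100) := by
      have a : 0 ≤ (1 / 2 - μ) * (5.2 * R - 9.66) :=
        mul_nonneg (by linarith) (by norm_num; linarith)
      have b : 0 ≤ ((R - 1 / 2) / 4 - ρ) * (R + 4.7) :=
        mul_nonneg (by linarith) (by norm_num; linarith)
      norm_num at *
      nlinarith
    linarith

lemma hnum_three (R μ ρ : ℝ) (hR : 1 ≤ R)
    (hRb : (2 * (16/5) - 4) * R ≤ 21/4 + 4 * (16/5) / 3) (h0 : 0 ≤ μ) (hμ : μ ≤ 1 / 2)
    (hμρ : μ ≤ ρ) (hdiff : ρ - μ ≤ R - 1)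
    (hor : ρ * (3 + 1) ≤ R ∨ (ρ * 3 ≤ R - 1 / 2 ∧ ((3:ℝ) + 1) / 2 ≤ R)) :
    3 * ρ ^ 2 + 2 * (16/5) * ρ - (21/4) * μ < (1 - μ) * (2 * (16/5) * R - 21/4) := by
  have hρ : 0 ≤ ρ := le_trans h0 hμρ
  have hR4 : R ≤ 3.97 := by norm_num at hRb ⊢; linarith
  rcases hor with h | ⟨h, h'⟩
  · rcases le_or_gt R (10.5 / 6.4) with hs | hs
    · rcases le_or_gt ρ (R - 1) with hc | hc
      · have a : 0 ≤ μ * (10.5 - 6.4 * R) := mul_nonneg h0 (by norm_num at hs ⊢; linarith)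
        rcases le_or_gt R (4/3) with hR' | hR'
        · have b : 0 ≤ (R - 1 - ρ) * (6.4 + 3 * (ρ + (R - 1))) :=
            mul_nonneg (by linarith) (by norm_num; linarith)
          norm_num at *
          nlinarith
        · have b : 0 ≤ (R / 4 - ρ) * (6.4 + 3 * (ρ + R / 4)) :=
            mul_nonneg (by linarith) (by norm_num; linarith)
          norm_num at *
          nlinarith
      · have a : 0 ≤ (μ - (ρ - R + 1)) * (10.5 - 6.4 * R) :=
          mul_nonneg (by linarith) (by norm_num at hs ⊢; linarith)
        have b : 0 ≤ (R / 4 - ρ) * (6.4 * R - 4.1 + 3 * (ρ + R / 4)) :=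
            mul_nonneg (by linarith) (by norm_num; linarith)
        have c : 0 < 4.6125 * R ^ 2 - 9.475 * R + 5.25 := by
          norm_num; nlinarith [sq_nonneg (R - 1.027)]
        norm_num at *
        nlinarith
    · rcases le_or_gt ρ (1/2) with hc | hc
      · have a : 0 ≤ (ρ - μ) * (6.4 * R - 10.5) :=
          mul_nonneg (by linarith) (by norm_num at hs ⊢; linarith)
        rcases le_or_gt R 2 with hR' | hR'
        · have b : 0 ≤ (R / 4 - ρ) * (6.4 * R - 4.1 + 3 * (ρ + R / 4)) :=
            mul_nonneg (by linarith) (by norm_num; linarith)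
          have c : 0 ≤ (2 - R) * (R - 10.5 / 6.4) :=
            mul_nonneg (by linarith) (by linarith)
          norm_num at *
          nlinarith
        · have b : 0 ≤ (1 / 2 - ρ) * (6.4 * R - 4.1 + 3 * (ρ + 1 / 2)) :=
            mul_nonneg (by linarith) (by norm_num; linarith)
          norm_num at *
          nlinarith
      · have a : 0 ≤ (1 / 2 - μ) * (6.4 * R - 10.5) :=
          mul_nonneg (by linarith) (by norm_num at hs ⊢; linarith)
        have b : 0 ≤ (R / 4 - ρ) * (6.4 + 3 * (ρ + R / 4)) :=
            mul_nonneg (by linarith) (by norm_num; linarith)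
        norm_num at *
        nlinarith
  · have a : 0 ≤ (1 / 2 - μ) * (6.4 * R - 10.5) :=
      mul_nonneg (by linarith) (by norm_num; linarith)
    have b : 0 ≤ ((R - 1 / 2) / 3 - ρ) * (6.4 + 3 * (ρ + (R - 1 / 2) / 3)) :=
      mul_nonneg (by linarith) (by norm_num; linarith)
    norm_num at *
    nlinarith

lemma pierce_norm {d : ℕ} (hd : 3 ≤ d) (p s : ℝ) (hp : 0 ≤ p) (hs : 0 ≤ s) (hps : s ≤ 2 * p)
    (hnum : ∀ R μ ρ : ℝ, 1 ≤ R → (2 * p - 4) * R ≤ s + 4 * p / d → 0 ≤ μ → μ ≤ 1 / 2 → μ ≤ ρ →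
      ρ - μ ≤ R - 1 →
      (ρ * (d + 1) ≤ R ∨ (ρ * d ≤ R - 1 / 2 ∧ ((d : ℝ) + 1) / 2 ≤ R)) →
      d * ρ ^ 2 + 2 * p * ρ - s * μ < (1 - μ) * (2 * p * R - s))
    (A : Finset (EuclideanSpace ℝ (Fin d))) (hA0 : 0 ∈ A)
    (hcov : ∀ v : EuclideanSpace ℝ (Fin d), ∃ a ∈ A,
      ‖a‖ ^ 2 - 2 * inner ℝ v a ≤ -((2 * p * ‖v‖ - s) / d))
    {ι : Type*} [Fintype ι] (c : ι → EuclideanSpace ℝ (Fin d)) (r : ι → ℝ) (hr : ∀ i, 1 ≤ r i)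
    (i0 : ι) (hi0 : r i0 = 1) (hcard : d + 1 ≤ Fintype.card ι)
    (hsub : ∀ P : Finset ι, P.card ≤ d → ∃ y, ∀ i ∈ P, ‖y - c i‖ ≤ r i) :
    ∃ x, ∀ i, ∃ a ∈ A, ‖x + a - c i‖ ≤ r i := by
  classical
  have hd0 : (0 : ℝ) < d := by exact_mod_cast (by omega : 0 < d)
  have hq : ∀ i, 0 ≤ r i ^ 2 + (2 * p * r i - s) / d := by
    intro i
    have : 0 ≤ (2 * p * r i - s) / d := div_nonneg (by nlinarith [hr i]) hd0.le
    positivity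
  have hH : (⋂ i ∈ (Finset.univ : Finset ι),
      Metric.closedBall (c i) (Real.sqrt (r i ^ 2 + (2 * p * r i - s) / d))).Nonempty := by
    apply Convex.helly_theorem (𝕜 := ℝ)
    · simpa using hcard
    · intro i _; exact convex_closedBall _ _
    · intro J _ hJ
      rw [finrank_euclideanSpace, Fintype.card_fin] at hJ
      obtain ⟨x, hx⟩ := core (κ := J) d hd (by simpa using hJ) p s hp hs hnum
        (fun j => c j) (fun j => r j) (fun j => hr j) (c i0)
        (by
          intro k
          obtain ⟨y, hy⟩ := hsub (J.erase k) (by rw [Finset.card_erase_of_mem k.2]; omega)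
          refine ⟨y, fun j hj => hy j ?_⟩
          rw [Finset.mem_erase]
          exact ⟨fun h => hj (Subtype.ext h), j.2⟩)
        (by
          intro k l hkl
          obtain ⟨y, hy⟩ := hsub (insert i0 ((J.erase k).erase l)) (by
            have h1 := Finset.card_insert_le i0 ((J.erase (k : ι)).erase l)
            rw [Finset.card_erase_of_mem, Finset.card_erase_of_mem k.2] at h1
            · omega
            · rw [Finset.mem_erase]
              exact ⟨fun h => hkl (Subtype.ext h.symm), l.2⟩)
          refine ⟨y, ?_, fun j hj hj' => hy j ?_⟩
          · rw [← hi0]; exact hy i0 (Finset.mem_insert_self _ _)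
          · rw [Finset.mem_insert, Finset.mem_erase, Finset.mem_erase]
            exact Or.inr ⟨fun h => hj' (Subtype.ext h), fun h => hj (Subtype.ext h), j.2⟩)
      refine ⟨x, ?_⟩
      simp only [Set.mem_iInter, mem_closedBall_iff_norm]
      intro i hi
      exact Real.le_sqrt_of_sq_le (hx ⟨i, hi⟩)
  obtain ⟨x, hx⟩ := hH
  simp only [Set.mem_iInter, mem_closedBall_iff_norm] at hx
  refine ⟨x, fun i => ?_⟩
  have hxi : ‖x - c i‖ ^ 2 ≤ r i ^ 2 + (2 * p * r i - s) / d := by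
    have := pow_le_pow_left₀ (norm_nonneg _) (hx i (Finset.mem_univ i)) 2
    rwa [Real.sq_sqrt (hq i)] at this
  have hri : 0 ≤ r i := by linarith [hr i]
  rcases le_or_gt ‖x - c i‖ (r i) with h | h
  · exact ⟨0, hA0, by simpa using h⟩
  · obtain ⟨a, haA, ha⟩ := hcov (c i - x)
    refine ⟨a, haA, ?_⟩
    have e : x + a - c i = a - (c i - x) := by abel
    rw [e]
    refine (pow_le_pow_iff_left₀ (norm_nonneg _) hri two_ne_zero).1 ?_
    rw [norm_sub_sq_real, real_inner_comm]
    rw [norm_sub_rev] at hxi h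
    have hmono : (2 * p * r i - s) / d ≤ (2 * p * ‖c i - x‖ - s) / d := by gcongr
    linarith

lemma pierce {d : ℕ} (hd : 3 ≤ d) (p s : ℝ) (hp : 0 ≤ p) (hs : 0 ≤ s) (hps : s ≤ 2 * p)
    (hnum : ∀ R μ ρ : ℝ, 1 ≤ R → (2 * p - 4) * R ≤ s + 4 * p / d → 0 ≤ μ → μ ≤ 1 / 2 → μ ≤ ρ →
      ρ - μ ≤ R - 1 →
      (ρ * (d + 1) ≤ R ∨ (ρ * d ≤ R - 1 / 2 ∧ ((d : ℝ) + 1) / 2 ≤ R)) →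
      d * ρ ^ 2 + 2 * p * ρ - s * μ < (1 - μ) * (2 * p * R - s))
    (A : Finset (EuclideanSpace ℝ (Fin d))) (hA0 : 0 ∈ A)
    (hcov : ∀ v : EuclideanSpace ℝ (Fin d), ∃ a ∈ A,
      ‖a‖ ^ 2 - 2 * inner ℝ v a ≤ -((2 * p * ‖v‖ - s) / d))
    (N : ℕ) (hN : d ≤ N) (hAN : A.card ≤ N)
    {ι : Type*} [Fintype ι] (F : ι → Set (EuclideanSpace ℝ (Fin d)))
    (hball : ∀ i, ∃ (c : EuclideanSpace ℝ (Fin d)) (r : ℝ), 0 ≤ r ∧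
      F i = Metric.closedBall c r)
    (hagree : ∀ P : Finset ι, P.card = d → (⋂ i ∈ P, F i).Nonempty) :
    ∃ C : Finset (EuclideanSpace ℝ (Fin d)), C.card ≤ N ∧ ∀ i, ∃ x ∈ C, x ∈ F i := by
  classical
  choose c r hr hF using hball
  have hmem : ∀ i y, y ∈ F i ↔ ‖y - c i‖ ≤ r i := by
    intro i y; rw [hF, mem_closedBall_iff_norm]
  rcases le_or_gt (Fintype.card ι) d with hc | hc
  · refine ⟨Finset.univ.image c, ?_, fun i => ⟨c i, by simp, ?_⟩⟩
    · exact Finset.card_image_le.trans (by simpa using hc.trans hN)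
    · rw [hmem]; simpa using hr i
  have hsub : ∀ P : Finset ι, P.card ≤ d → ∃ y, ∀ i ∈ P, ‖y - c i‖ ≤ r i := by
    intro P hP
    obtain ⟨P', hPP', hP'⟩ := Finset.exists_superset_card_eq hP hc.le
    obtain ⟨y, hy⟩ := hagree P' hP'
    simp only [Set.mem_iInter] at hy
    exact ⟨y, fun i hi => (hmem i y).1 (hy i (hPP' hi))⟩
  have : Nonempty ι := Fintype.card_pos_iff.1 (by omega)
  obtain ⟨i0, -, hmin⟩ := Finset.exists_min_image Finset.univ r Finset.univ_nonempty
  rcases (hr i0).eq_or_lt with h0 | h0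
  · refine ⟨{c i0}, ?_, fun i => ⟨c i0, by simp, ?_⟩⟩
    · simp; omega
    · obtain ⟨y, hy⟩ := hsub {i0, i} (Finset.card_le_two.trans (by omega))
      have h1 := hy i0 (by simp)
      rw [← h0] at h1
      have : y = c i0 := by rwa [norm_le_zero_iff, sub_eq_zero] at h1
      rw [hmem, ← this]
      exact hy i (by simp)
  set t := r i0
  have hsc : ∀ y z : EuclideanSpace ℝ (Fin d), ‖t⁻¹ • y - t⁻¹ • z‖ = ‖y - z‖ / t := by
    intro y z
    rw [← smul_sub, norm_smul, norm_inv, Real.norm_of_nonneg h0.le]; field_simp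
  obtain ⟨x, hx⟩ := pierce_norm hd p s hp hs hps hnum A hA0 hcov (fun i => t⁻¹ • c i)
    (fun i => r i / t) (fun i => by rw [le_div_iff₀ h0, one_mul]; exact hmin i (Finset.mem_univ i))
    i0 (div_self h0.ne') hc (by
      intro P hP
      obtain ⟨y, hy⟩ := hsub P hP
      refine ⟨t⁻¹ • y, fun i hi => ?_⟩
      rw [hsc]
      exact div_le_div_of_nonneg_right (hy i hi) h0.le)
  refine ⟨A.image (fun a => t • (x + a)), Finset.card_image_le.trans hAN, fun i => ?_⟩
  obtain ⟨a, ha, hxa⟩ := hx i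
  refine ⟨t • (x + a), Finset.mem_image_of_mem _ ha, ?_⟩
  rw [hmem]
  have := hsc (t • (x + a)) (c i)
  rw [smul_smul, inv_mul_cancel₀ h0.ne', one_smul] at this
  rw [this] at hxa
  exact (div_le_div_iff_of_pos_right h0).1 hxa

lemma three_num (L a b c : ℝ) (ha : |a| ≤ 0.8066 * L) (hb : |b| ≤ 0.8066 * L)
    (hc : |c| ≤ 0.8066 * L) (hs : |a| + |b| + |c| ≤ 1.3971 * L) :
    a ^ 2 + b ^ 2 + c ^ 2 ≤ 0.9995 * L ^ 2 := by
  have hL : 0 ≤ L := by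
    have := (abs_nonneg a).trans ha
    norm_num at this; linarith
  rw [← sq_abs a, ← sq_abs b, ← sq_abs c]
  have key : ∀ a b c : ℝ, 0 ≤ a → 0 ≤ b → 0 ≤ c → b ≤ a → c ≤ a → a ≤ 0.8066 * L →
      a + b + c ≤ 1.3971 * L → a ^ 2 + b ^ 2 + c ^ 2 ≤ 0.9995 * L ^ 2 := by
    intro a b c ha hb hc hba hca haL hs
    norm_num at haL hs ⊢
    rcases le_or_gt a (0.69855 * L) with h | h
    · norm_num at h
      have h1 : a ^ 2 + b ^ 2 + c ^ 2 ≤ a * (a + b + c) := by nlinarith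
      have h2 : a * (a + b + c) ≤ (0.69855 * L) * (1.3971 * L) := by
        norm_num
        apply mul_le_mul h hs (by positivity) (by positivity)
      norm_num at h2
      nlinarith [sq_nonneg L]
    · norm_num at h
      have h1 : b ^ 2 + c ^ 2 ≤ (1.3971 * L - a) ^ 2 := by
        have : (b + c) ^ 2 ≤ (1.3971 * L - a) ^ 2 :=
          pow_le_pow_left₀ (by positivity) (by norm_num; linarith) 2
        nlinarith [mul_nonneg hb hc]
      norm_num at h1
      nlinarith [mul_nonneg (sub_nonneg.2 haL) (sub_nonneg.2 h.le), sq_nonneg L]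
  rcases le_total |a| |b| with h1 | h1 <;> rcases le_total |b| |c| with h2 | h2 <;>
    rcases le_total |a| |c| with h3 | h3
  all_goals first
    | linarith [key |a| |b| |c| (abs_nonneg _) (abs_nonneg _) (abs_nonneg _) (by assumption)
        (by assumption) ha hs]
    | linarith [key |b| |a| |c| (abs_nonneg _) (abs_nonneg _) (abs_nonneg _) (by assumption)
        (by assumption) hb (by linarith)]
    | linarith [key |c| |a| |b| (abs_nonneg _) (abs_nonneg _) (abs_nonneg _) (by assumption)
        (by assumption) hc (by linarith)]
    | linarith [key |c| |a| |b| (abs_nonneg _) (abs_nonneg _) (abs_nonneg _) (by linarith)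
        (by linarith) hc (by linarith)]

lemma cover_three : ∃ A : Finset (EuclideanSpace ℝ (Fin 3)), 0 ∈ A ∧ A.card ≤ 16 ∧
    ∀ v : EuclideanSpace ℝ (Fin 3), ∃ a ∈ A,
      ‖a‖ ^ 2 - 2 * inner ℝ v a ≤ -((2 * (16/5) * ‖v‖ - 21/4) / (3 : ℕ)) := by
  classical
  let x : ℝ := 1.3225
  let y : ℝ := 0.7635
  let S : Finset ℝ := {1, -1}
  let A1 : Finset (EuclideanSpace ℝ (Fin 3)) := S.image (fun e => !₂[e * x, 0, 0])
  let A2 : Finset (EuclideanSpace ℝ (Fin 3)) := S.image (fun e => !₂[0, e * x, 0])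
  let A3 : Finset (EuclideanSpace ℝ (Fin 3)) := S.image (fun e => !₂[0, 0, e * x])
  let B : Finset (EuclideanSpace ℝ (Fin 3)) :=
    (S ×ˢ S ×ˢ S).image (fun e => !₂[e.1 * y, e.2.1 * y, e.2.2 * y])
  have hS : S.card ≤ 2 := Finset.card_le_two
  have hSm : ∀ t : ℝ, ∃ e ∈ S, e * t = |t| ∧ e ^ 2 = 1 := by
    intro t
    rcases abs_cases t with ⟨h, -⟩ | ⟨h, -⟩
    · exact ⟨1, by simp [S], by rw [h]; ring, by norm_num⟩
    · exact ⟨-1, by simp [S], by rw [h]; ring, by norm_num⟩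
  refine ⟨{0} ∪ (A1 ∪ A2 ∪ A3 ∪ B), by simp, ?_, ?_⟩
  · have h1 : A1.card ≤ 2 := Finset.card_image_le.trans hS
    have h2 : A2.card ≤ 2 := Finset.card_image_le.trans hS
    have h3 : A3.card ≤ 2 := Finset.card_image_le.trans hS
    have h4 : B.card ≤ 8 := by
      refine Finset.card_image_le.trans ?_
      rw [Finset.card_product, Finset.card_product]
      nlinarith [Nat.mul_le_mul hS hS, Nat.mul_le_mul hS (Nat.mul_le_mul hS hS)]
    have := Finset.card_union_le ({0} : Finset (EuclideanSpace ℝ (Fin 3))) (A1 ∪ A2 ∪ A3 ∪ B)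
    have := Finset.card_union_le (A1 ∪ A2 ∪ A3) B
    have := Finset.card_union_le (A1 ∪ A2) A3
    have := Finset.card_union_le A1 A2
    have := Finset.card_singleton (0 : EuclideanSpace ℝ (Fin 3))
    omega
  · intro v
    by_contra! hcon
    have h0 := hcon 0 (by simp)
    have hn : ‖v‖ ^ 2 = v 0 ^ 2 + v 1 ^ 2 + v 2 ^ 2 := by
      rw [EuclideanSpace.norm_sq_eq, Fin.sum_univ_three]; simp
    have b0 : |v 0| ≤ 0.8066 * ‖v‖ := by
      obtain ⟨e, he, h1, h2⟩ := hSm (v 0)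
      have := hcon !₂[e * x, 0, 0] (by
        simp only [Finset.mem_union]
        exact Or.inr (Or.inl (Or.inl (Or.inl (Finset.mem_image_of_mem _ he)))))
      rw [EuclideanSpace.norm_sq_eq] at this
      simp [PiLp.inner_apply, Fin.sum_univ_three, mul_pow, h2] at this
      have h5 : e * x * v 0 = x * |v 0| := by rw [← h1]; ring
      rw [h5] at this
      norm_num [x] at this ⊢
      nlinarith [norm_nonneg v]
    have b1 : |v 1| ≤ 0.8066 * ‖v‖ := by
      obtain ⟨e, he, h1, h2⟩ := hSm (v 1)
      have := hcon !₂[0, e * x, 0] (by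
        simp only [Finset.mem_union]
        exact Or.inr (Or.inl (Or.inl (Or.inr (Finset.mem_image_of_mem _ he)))))
      rw [EuclideanSpace.norm_sq_eq] at this
      simp [PiLp.inner_apply, Fin.sum_univ_three, mul_pow, h2] at this
      have h5 : e * x * v 1 = x * |v 1| := by rw [← h1]; ring
      rw [h5] at this
      norm_num [x] at this ⊢
      nlinarith [norm_nonneg v]
    have b2 : |v 2| ≤ 0.8066 * ‖v‖ := by
      obtain ⟨e, he, h1, h2⟩ := hSm (v 2)
      have := hcon !₂[0, 0, e * x] (by
        simp only [Finset.mem_union]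
        exact Or.inr (Or.inl (Or.inr (Finset.mem_image_of_mem _ he))))
      rw [EuclideanSpace.norm_sq_eq] at this
      simp [PiLp.inner_apply, Fin.sum_univ_three, mul_pow, h2] at this
      have h5 : e * x * v 2 = x * |v 2| := by rw [← h1]; ring
      rw [h5] at this
      norm_num [x] at this ⊢
      nlinarith [norm_nonneg v]
    have b3 : |v 0| + |v 1| + |v 2| ≤ 1.3971 * ‖v‖ := by
      obtain ⟨e, he, h1, h2⟩ := hSm (v 0)
      obtain ⟨e', he', h1', h2'⟩ := hSm (v 1)
      obtain ⟨f, hf, h3, h4⟩ := hSm (v 2)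
      have := hcon !₂[e * y, e' * y, f * y] (by
        simp only [Finset.mem_union]
        exact Or.inr (Or.inr (Finset.mem_image.2 ⟨(e, e', f), by simp [he, he', hf], rfl⟩)))
      rw [EuclideanSpace.norm_sq_eq] at this
      simp [PiLp.inner_apply, Fin.sum_univ_three, mul_pow, h2, h2', h4] at this
      have h5 : e * y * v 0 = y * |v 0| := by rw [← h1]; ring
      have h6 : e' * y * v 1 = y * |v 1| := by rw [← h1']; ring
      have h7 : f * y * v 2 = y * |v 2| := by rw [← h3]; ring
      rw [h5, h6, h7] at this
      norm_num [y] at this ⊢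
      nlinarith [norm_nonneg v]
    have hfin := three_num ‖v‖ (v 0) (v 1) (v 2) b0 b1 b2 b3
    rw [← hn] at hfin
    have hv : ‖v‖ = 0 := by
      norm_num at hfin
      have : ‖v‖ ^ 2 ≤ 0 := by nlinarith
      exact pow_eq_zero_iff (two_ne_zero) |>.1 (le_antisymm this (sq_nonneg _))
    rw [hv] at h0
    norm_num at h0

lemma sum_range_two_mul (f : ℕ → ℝ) (m : ℕ) :
    ∑ n ∈ Finset.range (2 * m), f n = ∑ i ∈ Finset.range m, (f (2 * i) + f (2 * i + 1)) := by
  induction m with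
  | zero => simp
  | succ k ih =>
    rw [show 2 * (k + 1) = 2 * k + 1 + 1 by ring, Finset.sum_range_succ, Finset.sum_range_succ, ih,
      Finset.sum_range_succ]
    ring

lemma hexagon (a b t q : ℝ) (hq : q ^ 2 = 3) (ht : 0 ≤ t) (h1 : |a| ≤ t)
    (h2 : |a| / 2 + q / 2 * |b| ≤ t) (hq0 : 0 ≤ q) : a ^ 2 + b ^ 2 ≤ 4 / 3 * t ^ 2 := by
  rw [← sq_abs a, ← sq_abs b]
  have ha := abs_nonneg a
  have hb := abs_nonneg b
  have h3 : (q * |b|) ^ 2 ≤ (2 * t - |a|) ^ 2 :=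
    pow_le_pow_left₀ (by positivity) (by linarith) 2
  rw [mul_pow, hq] at h3
  nlinarith [mul_nonneg ha (sub_nonneg.2 h1)]

lemma cover_general (d : ℕ) (hd : 4 ≤ d) (hd5 : d ≠ 5) :
    ∃ A : Finset (EuclideanSpace ℝ (Fin d)), 0 ∈ A ∧ A.card ≤ 3 * (d + 1) ∧
    ∀ v : EuclideanSpace ℝ (Fin d), ∃ a ∈ A,
      ‖a‖ ^ 2 - 2 * inner ℝ v a ≤ -((2 * (13/5) * ‖v‖ - 483/100) / d) := by
  classical
  have hd0 : (0 : ℝ) < d := by exact_mod_cast (by omega : 0 < d)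
  obtain ⟨x, hx0, hx⟩ : ∃ x : ℝ, 0 < x ∧ x ^ 2 = 4.83 / d :=
    ⟨Real.sqrt (4.83 / d), Real.sqrt_pos.2 (by positivity), Real.sq_sqrt (by positivity)⟩
  obtain ⟨q, hq0, hq⟩ : ∃ q : ℝ, 0 ≤ q ∧ q ^ 2 = 3 :=
    ⟨Real.sqrt 3, Real.sqrt_nonneg _, Real.sq_sqrt (by norm_num)⟩
  let E : ℕ → EuclideanSpace ℝ (Fin d) := fun n =>
    if h : n < d then EuclideanSpace.single ⟨n, h⟩ 1 else 0
  let S : Finset ℝ := {1, -1}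
  let A1 : Finset (EuclideanSpace ℝ (Fin d)) :=
    (S ×ˢ Finset.range (d / 2)).image (fun e => (e.1 * x) • E (2 * e.2))
  let A2 : Finset (EuclideanSpace ℝ (Fin d)) :=
    ((S ×ˢ S) ×ˢ Finset.range (d / 2)).image
      (fun e => (e.1.1 * x / 2) • E (2 * e.2) + (e.1.2 * x * q / 2) • E (2 * e.2 + 1))
  let A3 : Finset (EuclideanSpace ℝ (Fin d)) := S.image (fun e => (e * x) • E (d - 1))
  have hS : S.card ≤ 2 := Finset.card_le_two
  have hSm : ∀ t : ℝ, ∃ e ∈ S, e * t = |t| ∧ e ^ 2 = 1 := by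
    intro t
    rcases abs_cases t with ⟨h, -⟩ | ⟨h, -⟩
    · exact ⟨1, by simp [S], by rw [h]; ring, by norm_num⟩
    · exact ⟨-1, by simp [S], by rw [h]; ring, by norm_num⟩
  have hEn : ∀ n, n < d → ‖E n‖ = 1 := by
    intro n hn; simp [E, hn]
  have hEo : ∀ n m, n ≠ m → inner ℝ (E n) (E m) = 0 := by
    intro n m hnm
    simp only [E]
    split_ifs with h1 h2 <;> simp [EuclideanSpace.inner_single_left, Fin.ext_iff, hnm, hnm.symm]
  refine ⟨{0} ∪ (A1 ∪ A2 ∪ A3), by simp, ?_, ?_⟩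
  · have h1 : A1.card ≤ 2 * (d / 2) := by
      refine Finset.card_image_le.trans ?_
      rw [Finset.card_product, Finset.card_range]
      exact Nat.mul_le_mul_right _ hS
    have h2 : A2.card ≤ (2 * 2) * (d / 2) := by
      refine Finset.card_image_le.trans ?_
      rw [Finset.card_product, Finset.card_range, Finset.card_product]
      exact Nat.mul_le_mul_right _ (Nat.mul_le_mul hS hS)
    have h3 : A3.card ≤ 2 := Finset.card_image_le.trans hS
    have := Finset.card_union_le ({0} : Finset (EuclideanSpace ℝ (Fin d))) (A1 ∪ A2 ∪ A3)
    have := Finset.card_union_le (A1 ∪ A2) A3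
    have := Finset.card_union_le A1 A2
    have := Finset.card_singleton (0 : EuclideanSpace ℝ (Fin d))
    omega
  · intro v
    by_contra! hcon
    have h0 := hcon 0 (by simp)
    let w : ℕ → ℝ := fun n => inner ℝ v (E n)
    have hn : ‖v‖ ^ 2 = ∑ n ∈ Finset.range d, w n ^ 2 := by
      rw [EuclideanSpace.norm_sq_eq, ← Fin.sum_univ_eq_sum_range (fun n => w n ^ 2)]
      apply Finset.sum_congr rfl
      intro i _
      simp [w, E, EuclideanSpace.inner_single_right]
    -- failure in a direction
    have hfail : ∀ u : EuclideanSpace ℝ (Fin d), ‖u‖ ^ 2 = x ^ 2 →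
        u ∈ ({0} : Finset (EuclideanSpace ℝ (Fin d))) ∪ (A1 ∪ A2 ∪ A3) →
        inner ℝ v u ≤ 2.6 * ‖v‖ / d := by
      intro u hu hm
      have := hcon u hm
      rw [hu, hx] at this
      have e : -((2 * (13/5) * ‖v‖ - 483/100) / (d : ℝ)) = 4.83 / d - 2 * (2.6 * ‖v‖ / d) := by
        ring
      rw [e] at this
      linarith
    set t := 2.6 * ‖v‖ / d / x with ht
    have ht0 : 0 ≤ t := by positivity
    have htx : x * t = 2.6 * ‖v‖ / d := by rw [ht]; field_simp
    have hgam : t ^ 2 = (6.76 / 4.83) / d * ‖v‖ ^ 2 := by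
      rw [ht, div_pow, hx]; field_simp; norm_num; ring
    have hone : ∀ n, n < d → (∀ e ∈ S, (e * x) • E n ∈ A1 ∪ A2 ∪ A3) → |w n| ≤ t := by
      intro n hn hm
      obtain ⟨e, he, h1, h2⟩ := hSm (w n)
      have := hfail ((e * x) • E n) (by
        rw [norm_smul, hEn n hn, mul_one, Real.norm_eq_abs, sq_abs, mul_pow, h2, one_mul])
        (Finset.mem_union_right _ (hm e he))
      rw [inner_smul_right, ← htx] at this
      have h5 : x * |w n| ≤ x * t := by rw [← h1]; linarith
      exact le_of_mul_le_mul_left h5 hx0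
    have htwo : ∀ i, i < d / 2 → w (2 * i) ^ 2 + w (2 * i + 1) ^ 2 ≤ 4 / 3 * t ^ 2 := by
      intro i hi
      apply hexagon _ _ _ q hq ht0 _ _ hq0
      · apply hone _ (by omega)
        intro e he
        exact Finset.mem_union_left _ (Finset.mem_union_left _
          (Finset.mem_image.2 ⟨(e, i), by simp [he, hi], rfl⟩))
      · obtain ⟨e, he, h1, h2⟩ := hSm (w (2 * i))
        obtain ⟨f, hf, h3, h4⟩ := hSm (w (2 * i + 1))
        have := hfail ((e * x / 2) • E (2 * i) + (f * x * q / 2) • E (2 * i + 1)) (by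
          rw [norm_add_sq_real, norm_smul, norm_smul, hEn _ (by omega), hEn _ (by omega),
            inner_smul_left, inner_smul_right, hEo _ _ (by omega)]
          simp only [mul_zero, mul_one, Real.norm_eq_abs, sq_abs, add_zero]
          have : (e * x / 2) ^ 2 + (f * x * q / 2) ^ 2 =
            e ^ 2 * x ^ 2 / 4 + f ^ 2 * x ^ 2 * q ^ 2 / 4 := by ring
          rw [this, h2, h4, hq]; ring)
          (Finset.mem_union_right _ (Finset.mem_union_left _ (Finset.mem_union_right _
            (Finset.mem_image.2 ⟨((e, f), i), by simp [he, hf, hi], rfl⟩))))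
        rw [inner_add_right, inner_smul_right, inner_smul_right, ← htx] at this
        have h5 : x * (|w (2 * i)| / 2 + q / 2 * |w (2 * i + 1)|) ≤ x * t := by
          rw [← h1, ← h3]; linarith
        exact le_of_mul_le_mul_left h5 hx0
    have hlast : w (d - 1) ^ 2 ≤ t ^ 2 := by
      rw [← sq_abs]
      refine pow_le_pow_left₀ (abs_nonneg _) (hone _ (by omega) ?_) 2
      intro e he
      exact Finset.mem_union_right _ (Finset.mem_image_of_mem _ he)
    have hsum : ∑ n ∈ Finset.range (2 * (d / 2)), w n ^ 2 ≤ (d / 2 : ℕ) * (4 / 3 * t ^ 2) := by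
      rw [sum_range_two_mul]
      have := Finset.sum_le_card_nsmul (Finset.range (d / 2))
        (fun i => w (2 * i) ^ 2 + w (2 * i + 1) ^ 2) (4 / 3 * t ^ 2)
        (fun i hi => htwo i (Finset.mem_range.1 hi))
      rwa [Finset.card_range, nsmul_eq_mul] at this
    have hfin : ‖v‖ ^ 2 ≤ 0.9999 * ‖v‖ ^ 2 := by
      rcases Nat.even_or_odd' d with ⟨m, hm | hm⟩
      · have hdm : d / 2 = m := by omega
        rw [hdm, ← hm, ← hn, hgam] at hsum
        have hmd : (m : ℝ) = d / 2 := by rw [hm]; push_cast; ring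
        rw [hmd] at hsum
        have : (d : ℝ) / 2 * (4 / 3 * (6.76 / 4.83 / d * ‖v‖ ^ 2)) =
          (2 / 3 * (6.76 / 4.83)) * ‖v‖ ^ 2 := by field_simp; norm_num
        rw [this] at hsum
        refine hsum.trans (mul_le_mul_of_nonneg_right (by norm_num) (sq_nonneg _))
      · have hdm : d / 2 = m := by omega
        have hd7 : (7 : ℝ) ≤ d := by exact_mod_cast (by omega : 7 ≤ d)
        rw [hdm] at hsum
        have hn' : ‖v‖ ^ 2 = ∑ n ∈ Finset.range (2 * m), w n ^ 2 + w (d - 1) ^ 2 := by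
          rw [hn, show d - 1 = 2 * m by omega, ← Finset.sum_range_succ, ← hm]
        have hmd : (m : ℝ) = (d - 1) / 2 := by rw [hm]; push_cast; ring
        rw [hmd] at hsum
        have h1 : ‖v‖ ^ 2 ≤ (((d : ℝ) - 1) / 2 * (4 / 3) + 1) * t ^ 2 := by linarith
        rw [hgam] at h1
        have : (((d : ℝ) - 1) / 2 * (4 / 3) + 1) * (6.76 / 4.83 / d * ‖v‖ ^ 2) =
          ((2 / 3 + 1 / (3 * d)) * (6.76 / 4.83)) * ‖v‖ ^ 2 := by field_simp; ring
        rw [this] at h1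
        refine h1.trans (mul_le_mul_of_nonneg_right ?_ (sq_nonneg _))
        have h2 : 1 / (3 * (d : ℝ)) ≤ 1 / (3 * 7) := by gcongr
        calc (2 / 3 + 1 / (3 * (d : ℝ))) * (6.76 / 4.83)
            ≤ (2 / 3 + 1 / (3 * 7)) * (6.76 / 4.83) := by gcongr
          _ ≤ 0.9999 := by norm_num
    have hv : ‖v‖ = 0 := by
      norm_num at hfin
      have : ‖v‖ ^ 2 ≤ 0 := by nlinarith
      exact pow_eq_zero_iff (two_ne_zero) |>.1 (le_antisymm this (sq_nonneg _))
    rw [hv] at h0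
    simp at h0
    have : (0 : ℝ) < 483 / 100 / d := by positivity
    norm_num [neg_div] at h0
    linarith

/-- Karasev's theorem (corollary for ball societies): if every `d` members of a finite
family of closed balls in `ℝ^d` (`d ≥ 3`) have a common point, then the family can be
pierced by `4(d+1)` points when `d = 3` or `d = 4`, and by `3(d+1)` points when `d ≥ 6`. -/
theorem karasev_balls {d : ℕ} (hd : 3 ≤ d) {ι : Type*} [Fintype ι]
    (F : ι → Set (EuclideanSpace ℝ (Fin d)))
    (hball : ∀ i, ∃ (c : EuclideanSpace ℝ (Fin d)) (r : ℝ), 0 ≤ r ∧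
      F i = Metric.closedBall c r)
    (hagree : ∀ P : Finset ι, P.card = d → (⋂ i ∈ P, F i).Nonempty) :
    ((d = 3 ∨ d = 4) →
      ∃ C : Finset (EuclideanSpace ℝ (Fin d)), C.card ≤ 4 * (d + 1) ∧
        ∀ i, ∃ x ∈ C, x ∈ F i) ∧
    (6 ≤ d →
      ∃ C : Finset (EuclideanSpace ℝ (Fin d)), C.card ≤ 3 * (d + 1) ∧
        ∀ i, ∃ x ∈ C, x ∈ F i) := by
  have hgen : 4 ≤ d → d ≠ 5 → ∀ N : ℕ, 3 * (d + 1) ≤ N →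
      ∃ C : Finset (EuclideanSpace ℝ (Fin d)), C.card ≤ N ∧ ∀ i, ∃ x ∈ C, x ∈ F i := by
    intro h4 h5 N hN
    obtain ⟨A, hA0, hAc, hcov⟩ := cover_general d h4 h5
    exact pierce hd (13/5) (483/100) (by norm_num) (by norm_num) (by norm_num)
      (fun R μ ρ => hnum_ge_four (d : ℝ) (by exact_mod_cast h4) R μ ρ)
      A hA0 hcov N (by omega) (hAc.trans hN) F hball hagree
  refine ⟨?_, fun h6 => hgen (by omega) (by omega) _ le_rfl⟩
  rintro (rfl | rfl)
  · obtain ⟨A, hA0, hAc, hcov⟩ := cover_three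
    exact pierce hd (16/5) (21/4) (by norm_num) (by norm_num) (by norm_num)
      (fun R μ ρ => by exact_mod_cast hnum_three R μ ρ)
      A hA0 hcov _ (by omega) hAc F hball hagree
  · exact hgen (by omega) (by omega) _ (by omega)
end

section
/- Let F be a finite family of closed unit disks in ℝ² (closed balls of radius 1) satisfying the (4,3)-property: among every 4 members of F there exist 3 with a common point. Then F has a piercing set of at most 3 points. -/
def Cov {ι : Type*} (x y : ι → ℝ) : Prop :=
  ∃ u₁ v₁ u₂ v₂ u₃ v₃ : ℝ, ∀ i, (x i - u₁) ^ 2 + (y i - v₁) ^ 2 ≤ 1 ∨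
    (x i - u₂) ^ 2 + (y i - v₂) ^ 2 ≤ 1 ∨ (x i - u₃) ^ 2 + (y i - v₃) ^ 2 ≤ 1

theorem Cov.neg {ι : Type*} {x y : ι → ℝ} (h : Cov x (fun i => - y i)) : Cov x y := by
  obtain ⟨u₁, v₁, u₂, v₂, u₃, v₃, h⟩ := h
  refine ⟨u₁, -v₁, u₂, -v₂, u₃, -v₃, fun i => ?_⟩
  have e : ∀ v : ℝ, (y i - -v) ^ 2 = (- y i - v) ^ 2 := fun v => by ring
  rw [e, e, e]
  exact h i

/-- the cover used when the diameter is at most `2.4`: one point -/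
theorem ptI {x y : ℝ} (h1 : (x + 1.4) ^ 2 + y ^ 2 ≤ 2.4 ^ 2) (h2 : (x - 1) ^ 2 + y ^ 2 ≤ 4)
    (h3 : -1 ≤ y) :
    (x + 0.45) ^ 2 + (y + 0.2) ^ 2 ≤ 1 ∨ (x - 0.45) ^ 2 + (y + 0.2) ^ 2 ≤ 1 ∨
      x ^ 2 + (y - 0.85) ^ 2 ≤ 1 := by
  rcases le_total 0.6 y with hy | hy
  · right; right
    rcases le_total 0 x with hx | hx
    · nlinarith
    · nlinarith
  · rcases le_total 0 x with hx | hx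
    · right; left
      have : x ≤ 1 := by nlinarith
      nlinarith
    · left
      have : -1 ≤ x := by nlinarith
      nlinarith

theorem caseI0 {ι : Type*} (x y : ι → ℝ) (A : ι) (L : ℝ) (hL0 : 0 ≤ L) (hL : L ≤ 2.4)
    (hxA : x A = 1 - L) (hyA : y A = 0) (h1 : ∀ i, (x i + L - 1) ^ 2 + y i ^ 2 ≤ L ^ 2)
    (h2 : ∀ i, i ≠ A → (x i - 1) ^ 2 + y i ^ 2 ≤ 4) (h3 : ∀ i, i ≠ A → -1 ≤ y i) : Cov x y := by
  refine ⟨-0.45, -0.2, 0.45, -0.2, 0, 0.85, fun i => ?_⟩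
  by_cases hi : i = A
  · subst hi
    rw [hxA, hyA]
    rcases le_total L 1 with h | h
    · right; left; nlinarith
    · left; nlinarith
  · have hx : x i ≤ 1 := by
      have := h1 i
      by_contra hc
      push Not at hc
      nlinarith [sq_nonneg (y i)]
    have := ptI (x := x i) (y := y i) (by nlinarith [h1 i]) (h2 i hi) (h3 i hi)
    simpa [sub_neg_eq_add] using this

theorem caseI {ι : Type*} (x y : ι → ℝ) (A : ι) (L : ℝ) (hL0 : 0 ≤ L) (hL : L ≤ 2.4)
    (hxA : x A = 1 - L) (hyA : y A = 0) (h1 : ∀ i, (x i + L - 1) ^ 2 + y i ^ 2 ≤ L ^ 2)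
    (h2 : ∀ i, i ≠ A → (x i - 1) ^ 2 + y i ^ 2 ≤ 4)
    (h3 : ∀ i j, i ≠ A → j ≠ A → (x i - x j) ^ 2 + (y i - y j) ^ 2 ≤ 4) : Cov x y := by
  by_cases h : ∀ i, i ≠ A → -1 ≤ y i
  · exact caseI0 x y A L hL0 hL hxA hyA h1 h2 h
  · push Not at h
    obtain ⟨j, hj, hyj⟩ := h
    apply Cov.neg
    refine caseI0 x _ A L hL0 hL hxA (by simpa using hyA) (fun i => by simpa using h1 i)
      (fun i hi => by simpa using h2 i hi) (fun i hi => ?_)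
    have := h3 i j hi hj
    nlinarith [sq_nonneg (x i - x j)]

theorem lens_top {m x y : ℝ} (hm : 0.2 ≤ m) (h1 : (x + 1 + m) ^ 2 + y ^ 2 ≤ 4)
    (h2 : (x - 1 - m) ^ 2 + y ^ 2 ≤ 4) (hy : 0.5 ≤ y) : x ^ 2 + (y - 0.8) ^ 2 ≤ 1 := by
  rcases le_total 0 x with hx | hx
  · have : (x + 1.2) ^ 2 + y ^ 2 ≤ 4 := by nlinarith
    nlinarith
  · have : (x - 1.2) ^ 2 + y ^ 2 ≤ 4 := by nlinarith
    nlinarith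

theorem lens_le {m x y : ℝ} (hm : 0.2 ≤ m) (h1 : (x + 1 + m) ^ 2 + y ^ 2 ≤ 4) : x ≤ 1 - m := by
  nlinarith [sq_nonneg y]

theorem lens_mid {m x y : ℝ} (hm : 0.2 ≤ m) (hm' : (1 + m) ^ 2 ≤ 3)
    (h1 : (x + 1 + m) ^ 2 + y ^ 2 ≤ 4) (hy : -0.5 ≤ y) (hy' : y ≤ 0.5) (hx : 0 ≤ x) :
    (x - m) ^ 2 + y ^ 2 ≤ 1 := by
  have h := lens_le hm h1
  have h3 : m ≤ 0.75 := by nlinarith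
  have h4 : (x - m) ^ 2 ≤ 0.75 := by
    have : m ^ 2 ≤ 0.56 := by nlinarith
    rcases le_total x m with h5 | h5
    · nlinarith
    · nlinarith
  nlinarith

theorem lens_big {m x y : ℝ} (hm : 0.2 ≤ m) (hm' : 3 ≤ (1 + m) ^ 2)
    (h1 : (x + 1 + m) ^ 2 + y ^ 2 ≤ 4) (h2 : (x - 1 - m) ^ 2 + y ^ 2 ≤ 4) :
    x ^ 2 + y ^ 2 ≤ 1 := by
  nlinarith

theorem lens_right {m x y : ℝ} (hm : 0.2 ≤ m) (hm' : 3 ≤ (1 + 2 * m) ^ 2)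
    (h1 : (x + 1 + m) ^ 2 + y ^ 2 ≤ 4) (hx : m ≤ x) : (x - m) ^ 2 + y ^ 2 ≤ 1 := by
  nlinarith [mul_nonneg (sub_nonneg.2 hx) (by linarith : (0:ℝ) ≤ 1 + 2 * m)]

/-- `T` one sign -/
theorem caseII_oneSign {ι : Type*} (x y : ι → ℝ) (A : ι) (U : ι → Prop) (m : ℝ) (hm : 0.2 ≤ m)
    (hxA : x A = -1 - m) (hyA : y A = 0)
    (hU : ∀ i, i ≠ A → U i → (x i - m) ^ 2 + y i ^ 2 ≤ 1)
    (hV : ∀ i, i ≠ A → ¬ U i → (x i + 1 + m) ^ 2 + y i ^ 2 ≤ 4 ∧ (x i - 1 - m) ^ 2 + y i ^ 2 ≤ 4)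
    (hT : ∀ i, i ≠ A → ¬ U i → 1 < (x i - m) ^ 2 + y i ^ 2 → 1 < (x i + m) ^ 2 + y i ^ 2 →
      0 ≤ y i) : Cov x y := by
  have hA : (x A - -m) ^ 2 + (y A - 0) ^ 2 ≤ 1 := by rw [hxA, hyA]; nlinarith
  rcases le_total 3 ((1 + m) ^ 2) with hb | hb
  · refine ⟨-m, 0, m, 0, 0, 0, fun i => ?_⟩
    by_cases hi : i = A
    · subst hi; exact Or.inl hA
    by_cases hu : U i
    · right; left; simpa using hU i hi hu
    · right; right
      simpa using lens_big hm hb (hV i hi hu).1 (hV i hi hu).2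
  · refine ⟨-m, 0, m, 0, 0, 0.8, fun i => ?_⟩
    by_cases hi : i = A
    · subst hi; exact Or.inl hA
    by_cases hu : U i
    · right; left; simpa using hU i hi hu
    obtain ⟨h1, h2⟩ := hV i hi hu
    by_contra hc
    push Not at hc
    obtain ⟨c1, c2, c3⟩ := hc
    simp only [sub_neg_eq_add, sub_zero] at c1 c2 c3
    have hy := hT i hi hu c2 c1
    rcases le_total 0.5 (y i) with h5 | h5
    · exact absurd (lens_top hm h1 h2 h5) (not_le.2 c3)
    · rcases le_total 0 (x i) with hx | hx
      · exact absurd (lens_mid hm hb h1 (by linarith) h5 hx) (not_le.2 c2)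
      · have := lens_mid (x := - x i) hm hb (by linarith [h2]) (by linarith) h5 (by linarith)
        nlinarith

/-- a family inside a strip of width `s ≤ √3` with height at most `2`, plus one unit disk -/
theorem cov_box {ι : Type*} (x y : ι → ℝ) (D : ι → Prop) (u v l s : ℝ) (hs : 0 ≤ s)
    (hs3 : s ^ 2 ≤ 3) [Finite ι]
    (hD : ∀ i, D i → (x i - u) ^ 2 + (y i - v) ^ 2 ≤ 1)
    (hx : ∀ i, ¬ D i → l ≤ x i ∧ x i ≤ l + s)
    (hy : ∀ i j, ¬ D i → ¬ D j → y i - y j ≤ 2) : Cov x y := by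
  by_cases hne : ∃ i, ¬ D i
  · have hfin : ({i | ¬ D i} : Set ι).Finite := Set.toFinite _
    obtain ⟨p, hp, hpmin⟩ := Set.exists_min_image _ y hfin hne
    refine ⟨u, v, l + s / 2, y p + 1 / 2, l + s / 2, y p + 3 / 2, fun i => ?_⟩
    by_cases hd : D i
    · exact Or.inl (hD i hd)
    · right
      have h1 := hpmin i hd
      have h2 := hy i p hd hp
      obtain ⟨h3, h4⟩ := hx i hd
      have h5 : (x i - (l + s / 2)) ^ 2 ≤ 3 / 4 := by nlinarith
      rcases le_total (y i) (y p + 1) with h | h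
      · left; nlinarith
      · right; nlinarith
  · push Not at hne
    exact ⟨u, v, u, v, u, v, fun i => Or.inl (hD i (hne i))⟩

theorem tip_u {m u y : ℝ} (hm : 0.2 ≤ m) (hu : 0 ≤ u) (h0 : 1 < u ^ 2 + y ^ 2)
    (h1 : (u + (1 + 2 * m)) ^ 2 + y ^ 2 ≤ 4) : u ≤ 0.372 := by
  nlinarith

theorem sqrt_lb {u y : ℝ} (hu : 0 ≤ u) (hu' : u ≤ 0.372) (hy : 0 ≤ y) (h0 : 1 < u ^ 2 + y ^ 2) :
    1 - 0.55 * u ^ 2 ≤ y := by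
  by_contra hc
  push Not at hc
  have h1 : u ^ 2 ≤ 0.14 := by nlinarith
  have h2 : 0 ≤ 1 - 0.55 * u ^ 2 := by nlinarith
  nlinarith

/-- opposite corners are far apart -/
theorem opp {m u y v z : ℝ} (hm : 0.2 ≤ m) (hu : 0 ≤ u) (hy : 0 ≤ y) (h0 : 1 < u ^ 2 + y ^ 2)
    (h1 : (u + (1 + 2 * m)) ^ 2 + y ^ 2 ≤ 4) (hv : 0 ≤ v) (hz : 0 ≤ z) (k0 : 1 < v ^ 2 + z ^ 2)
    (k1 : (v + (1 + 2 * m)) ^ 2 + z ^ 2 ≤ 4) : 4 < (2 * m + u + v) ^ 2 + (y + z) ^ 2 := by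
  have a1 := tip_u hm hu h0 h1
  have a2 := tip_u hm hv k0 k1
  have b1 := sqrt_lb hu a1 hy h0
  have b2 := sqrt_lb hv a2 hz k0
  have c1 : u ^ 2 ≤ 0.372 * u := by nlinarith
  have c2 : v ^ 2 ≤ 0.372 * v := by nlinarith
  have d1 : 0 ≤ 1 - 0.55 * u ^ 2 := by nlinarith
  have d2 : 0 ≤ 1 - 0.55 * v ^ 2 := by nlinarith
  have e : (1 - 0.55 * u ^ 2) * (1 - 0.55 * v ^ 2) ≤ y * z := mul_le_mul b1 b2 d2 hy
  have e2 : 1 - 0.55 * u ^ 2 - 0.55 * v ^ 2 ≤ y * z := by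
    nlinarith [mul_nonneg (sq_nonneg u) (sq_nonneg v)]
  have e3 : 0.2 * u ≤ m * u := mul_le_mul_of_nonneg_right hm hu
  have e4 : 0.2 * v ≤ m * v := mul_le_mul_of_nonneg_right hm hv
  have e5 : 0.2 * 0.2 ≤ m * m := mul_le_mul hm hm (by norm_num) (by linarith)
  have e6 := mul_nonneg hu hv
  have key : (2 * m + u + v) ^ 2 + (y + z) ^ 2 = 4 * (m * m) + 4 * (m * u) + 4 * (m * v)
    + 2 * (u * v) + (u ^ 2 + y ^ 2) + (v ^ 2 + z ^ 2) + 2 * (y * z) := by ring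
  rw [key]
  norm_num at *
  linarith

theorem shift_F {w y : ℝ} (hw : w ≤ 0.7322) (hy : y ≤ -0.93)
    (h : w ^ 2 + (y - 0.923) ^ 2 ≤ 4) : (w + 1 / 13) ^ 2 + (y + 5 / 13) ^ 2 ≤ 1 := by
  norm_num at *
  linarith

theorem shift_y {x m y : ℝ} (hm : 0.2 ≤ m) (hm4 : m ≤ 0.3661) (t1 : -m ≤ x) (t2 : x ≤ m)
    (h1 : 1 < (x - m) ^ 2 + y ^ 2) (h2 : 1 < (x + m) ^ 2 + y ^ 2) (hy : y ≤ 0) : y ≤ -0.93 := by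
  have hm2 : m ^ 2 ≤ 0.3661 ^ 2 := pow_le_pow_left₀ (by linarith) hm4 2
  have h3 : (0.93 : ℝ) ^ 2 ≤ (-y) ^ 2 := by
    rcases le_total 0 x with hx0 | hx0
    · have : (m - x) ^ 2 ≤ m ^ 2 := pow_le_pow_left₀ (by linarith) (by linarith) 2
      norm_num at *
      linarith
    · have : (m + x) ^ 2 ≤ m ^ 2 := pow_le_pow_left₀ (by linarith) (by linarith) 2
      norm_num at *
      linarith
  have := (pow_le_pow_iff_left₀ (by norm_num) (by linarith) two_ne_zero).1 h3
  linarith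


theorem shift_a {w y : ℝ} (hw : w ≤ 0.3661) (hw2 : -0.6 ≤ w) (hy : y ≤ 0) (hy2 : -1 ≤ y) :
    (w + 1 / 13) ^ 2 + (y + 5 / 13) ^ 2 ≤ 1 := by
  have a : (w + 1 / 13) ^ 2 ≤ 0.6 ^ 2 := sq_le_sq' (by linarith) (by linarith)
  have b : (y + 5 / 13) ^ 2 ≤ (8 / 13) ^ 2 := sq_le_sq' (by linarith) (by linarith)
  norm_num at *
  linarith

theorem shift_b {w y s : ℝ} (hs : 1.4 ≤ s) (hw : w ≤ 0.3661) (hy : 0 ≤ y) (hy2 : y ≤ 0.5)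
    (h : (s - w) ^ 2 + y ^ 2 ≤ 4) : (w + 1 / 13) ^ 2 + (y + 5 / 13) ^ 2 ≤ 1 := by
  rcases le_total 0 (w + 1 / 13) with h0 | h0
  · have a : (w + 1 / 13) ^ 2 ≤ (0.3661 + 1 / 13) ^ 2 := sq_le_sq' (by linarith) (by linarith)
    have b : (y + 5 / 13) ^ 2 ≤ (0.5 + 5 / 13) ^ 2 := sq_le_sq' (by linarith) (by linarith)
    norm_num at *
    linarith
  · have c : y ^ 2 ≤ 0.5 ^ 2 := pow_le_pow_left₀ hy hy2 2
    have a : s - w ≤ 2 - y ^ 2 / 4 := by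
      refine (abs_le_of_sq_le_sq' (b := 2 - y ^ 2 / 4) ?_ (by norm_num at *; linarith)).2
      have := sq_nonneg (y ^ 2)
      nlinarith
    have d : (-(w + 1 / 13)) ^ 2 ≤ (0.6 - 1 / 13 - y ^ 2 / 4) ^ 2 :=
      pow_le_pow_left₀ (by linarith) (by linarith) 2
    have e : (y ^ 2) ^ 2 ≤ 0.25 * y ^ 2 := by
      rw [pow_two (y ^ 2)]
      exact mul_le_mul_of_nonneg_right (by norm_num at *; linarith) (sq_nonneg y)
    norm_num at *
    nlinarith

/-- main remaining case: both left and right corners, upper, and middle lower. -/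
theorem caseII_shift {ι : Type*} (x y : ι → ℝ) (A : ι) (U : ι → Prop) (m : ℝ) (hm : 0.2 ≤ m)
    (hs : (1 + 2 * m) ^ 2 ≤ 3)
    (hxA : x A = -1 - m) (hyA : y A = 0)
    (hU : ∀ i, i ≠ A → U i → (x i - m) ^ 2 + y i ^ 2 ≤ 1)
    (hV : ∀ i, i ≠ A → ¬ U i → (x i + 1 + m) ^ 2 + y i ^ 2 ≤ 4 ∧ (x i - 1 - m) ^ 2 + y i ^ 2 ≤ 4)
    (hd : ∀ i j, i ≠ A → j ≠ A → (x i - x j) ^ 2 + (y i - y j) ^ 2 ≤ 4)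
    (E : ι) (hE : E ≠ A) (hEU : ¬ U E) (hE1 : 1 < (x E + m) ^ 2 + y E ^ 2) (hEx : x E ≤ -m)
    (hEy : 0 ≤ y E)
    (hT : ∀ i, i ≠ A → ¬ U i → 1 < (x i - m) ^ 2 + y i ^ 2 → 1 < (x i + m) ^ 2 + y i ^ 2 →
      y i ≤ 0 → -m ≤ x i ∧ x i ≤ m) : Cov x y := by
  have hm4 : m ≤ 0.3661 := by nlinarith
  have hb : (1 + m) ^ 2 ≤ 3 := by nlinarith
  have hEy' : 0.923 ≤ y E := by
    have h2 := (hV E hE hEU).2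
    have a1 := tip_u (u := - x E - m) (y := y E) hm (by linarith) (by nlinarith) (by nlinarith)
    have b1 := sqrt_lb (u := - x E - m) (y := y E) (by linarith) a1 hEy (by nlinarith)
    nlinarith
  refine ⟨-m - 1 / 13, -5 / 13, m, 0, 0, 0.8, fun i => ?_⟩
  by_cases hi : i = A
  · subst hi; left; rw [hxA, hyA]; nlinarith
  by_cases hu : U i
  · right; left; simpa using hU i hi hu
  obtain ⟨h1, h2⟩ := hV i hi hu
  have hx1 := lens_le hm h1
  have hx2 := lens_le (x := - x i) (y := y i) hm (by linarith)
  by_contra hc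
  push Not at hc
  obtain ⟨c1, c2, c3⟩ := hc
  simp only [sub_zero] at c2 c3
  have c1' : ¬ ((x i + m + 1 / 13) ^ 2 + (y i + 5 / 13) ^ 2 ≤ 1) := by
    rw [not_le]
    calc 1 < _ := c1
      _ = _ := by ring
  clear c1
  rcases le_total (y i) 0 with hy | hy
  · by_cases hDa : 1 < (x i + m) ^ 2 + y i ^ 2
    · obtain ⟨t1, t2⟩ := hT i hi hu c2 hDa hy
      have hdE := hd i E hi hE
      have hy2 := shift_y hm hm4 t1 t2 c2 hDa hy
      have hX : (x i + m) ^ 2 ≤ (x i - x E) ^ 2 :=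
        pow_le_pow_left₀ (by linarith) (by linarith) 2
      have hY : (0.923 - y i) ^ 2 ≤ (y E - y i) ^ 2 :=
        pow_le_pow_left₀ (by linarith) (by linarith) 2
      exact c1' (shift_F (by linarith) hy2 (by linarith))
    · push Not at hDa
      clear hT hd hV hU
      have hx0 : x i ≤ 0 := by
        by_contra hx
        push Not at hx
        have := mul_pos hx (by linarith : 0 < m)
        linarith
      have hyl : -1 ≤ y i := by
        have : (y i) ^ 2 ≤ 1 ^ 2 := by linarith [sq_nonneg (x i + m)]
        exact (abs_le_of_sq_le_sq' this (by norm_num)).1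
      exact c1' (shift_a (by linarith) (by linarith) hy hyl)
  · rcases le_total 0.5 (y i) with h5 | h5
    · exact absurd (lens_top hm h1 h2 h5) (not_le.2 c3)
    · rcases le_total 0 (x i) with hx | hx
      · exact absurd (lens_mid hm hb h1 (by linarith) h5 hx) (not_le.2 c2)
      · exact c1' (shift_b (s := 1 + 2 * m) (by linarith) (by linarith) hy h5 (by linarith))

/-- corners on both sides, the left one above -/
theorem caseII_corner {ι : Type*} (x y : ι → ℝ) (A : ι) (U : ι → Prop) (m : ℝ) (hm : 0.2 ≤ m)
    (hs : (1 + 2 * m) ^ 2 ≤ 3)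
    (hxA : x A = -1 - m) (hyA : y A = 0)
    (hU : ∀ i, i ≠ A → U i → (x i - m) ^ 2 + y i ^ 2 ≤ 1)
    (hV : ∀ i, i ≠ A → ¬ U i → (x i + 1 + m) ^ 2 + y i ^ 2 ≤ 4 ∧ (x i - 1 - m) ^ 2 + y i ^ 2 ≤ 4)
    (hd : ∀ i j, i ≠ A → j ≠ A → (x i - x j) ^ 2 + (y i - y j) ^ 2 ≤ 4)
    (E : ι) (hE : E ≠ A) (hEU : ¬ U E) (hE1 : 1 < (x E + m) ^ 2 + y E ^ 2) (hEx : x E ≤ -m)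
    (hEy : 0 ≤ y E)
    (R : ι) (hR : R ≠ A) (hRU : ¬ U R) (hR1 : 1 < (x R - m) ^ 2 + y R ^ 2) (hRx : m ≤ x R) :
    Cov x y := by
  have oppo : ∀ i j, i ≠ A → ¬ U i → 1 < (x i + m) ^ 2 + y i ^ 2 → x i ≤ -m →
      j ≠ A → ¬ U j → 1 < (x j - m) ^ 2 + y j ^ 2 → m ≤ x j →
      (0 ≤ y i → y j ≤ 0 → False) ∧ (y i ≤ 0 → 0 ≤ y j → False) := by
    intro i j hi hiU hi1 hix hj hjU hj1 hjx
    have h1 := (hV i hi hiU).2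
    have h2 := (hV j hj hjU).1
    have h3 := hd i j hi hj
    constructor
    · intro a b
      have := opp (u := - x i - m) (y := y i) (v := x j - m) (z := - y j) hm (by linarith) a
        (by linarith) (by linarith) (by linarith) (by linarith) (by linarith) (by linarith)
      linarith
    · intro a b
      have := opp (u := - x i - m) (y := - y i) (v := x j - m) (z := y j) hm (by linarith)
        (by linarith) (by linarith) (by linarith) (by linarith) (by linarith) (by linarith)
        (by linarith)
      linarith
  refine caseII_shift x y A U m hm hs hxA hyA hU hV hd E hE hEU hE1 hEx hEy ?_
  intro i hi hiU c1 c2 hy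
  constructor
  · by_contra hx
    push Not at hx
    have hRy : 0 < y R := by
      by_contra h
      exact (oppo E R hE hEU hE1 hEx hR hRU hR1 hRx).1 hEy (not_lt.1 h)
    exact (oppo i R hi hiU c2 hx.le hR hRU hR1 hRx).2 hy hRy.le
  · by_contra hx
    push Not at hx
    exact (oppo E i hE hEU hE1 hEx hi hiU c1 hx.le).1 hEy hy

theorem far_contra {m x y z p q w : ℝ} (hm : 0 ≤ m) (hy : 0 ≤ y) (hz : z ≤ 0)
    (hx1 : x ≤ m) (hx2 : -m ≤ x) (hw1 : w ≤ m) (hw2 : -m ≤ w)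
    (a1 : 1 < (x - m) ^ 2 + y ^ 2) (a2 : 1 < (x + m) ^ 2 + y ^ 2)
    (b1 : 1 < (w - m) ^ 2 + z ^ 2) (b2 : 1 < (w + m) ^ 2 + z ^ 2)
    (h1 : (x - p) ^ 2 + (y - q) ^ 2 ≤ 1) (h2 : (w - p) ^ 2 + (z - q) ^ 2 ≤ 1)
    (hp : m ≤ p ∨ p ≤ -m) : False := by
  have Y1 : q ≤ 0 → y ^ 2 ≤ (y - q) ^ 2 := fun h => pow_le_pow_left₀ hy (by linarith) 2
  have Y2 : 0 ≤ q → (-z) ^ 2 ≤ (q - z) ^ 2 :=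
    fun h => pow_le_pow_left₀ (by linarith) (by linarith) 2
  rcases hp with hp | hp
  · have X1 : (m - x) ^ 2 ≤ (p - x) ^ 2 := pow_le_pow_left₀ (by linarith) (by linarith) 2
    have X2 : (m - w) ^ 2 ≤ (p - w) ^ 2 := pow_le_pow_left₀ (by linarith) (by linarith) 2
    rcases le_total q 0 with h | h
    · have := Y1 h; linarith
    · have := Y2 h; linarith
  · have X1 : (x + m) ^ 2 ≤ (x - p) ^ 2 := pow_le_pow_left₀ (by linarith) (by linarith) 2
    have X2 : (w + m) ^ 2 ≤ (w - p) ^ 2 := pow_le_pow_left₀ (by linarith) (by linarith) 2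
    rcases le_total q 0 with h | h
    · have := Y1 h; linarith
    · have := Y2 h; linarith

theorem bnd_two {a b : ℝ} (h : a ^ 2 + b ^ 2 ≤ 4) : -2 ≤ b ∧ b ≤ 2 :=
  abs_le_of_sq_le_sq' (by linarith [sq_nonneg a]) (by norm_num)

theorem bnd_one {a b : ℝ} (h : a ^ 2 + b ^ 2 ≤ 1) : -1 ≤ a ∧ a ≤ 1 :=
  abs_le_of_sq_le_sq' (by linarith [sq_nonneg b]) (by norm_num)

theorem caseII {ι : Type*} [Finite ι] (x y : ι → ℝ) (A : ι) (U : ι → Prop) (m : ℝ) (hm : 0.2 ≤ m)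
    (hxA : x A = -1 - m) (hyA : y A = 0)
    (hU : ∀ i, i ≠ A → U i → (x i - m) ^ 2 + y i ^ 2 ≤ 1)
    (hUA : ∀ i, i ≠ A → U i → 4 < (x i + 1 + m) ^ 2 + y i ^ 2)
    (hV : ∀ i, i ≠ A → ¬ U i → (x i + 1 + m) ^ 2 + y i ^ 2 ≤ 4 ∧ (x i - 1 - m) ^ 2 + y i ^ 2 ≤ 4)
    (hd : ∀ i j, i ≠ A → j ≠ A → (x i - x j) ^ 2 + (y i - y j) ^ 2 ≤ 4)
    (hq : ∀ i j, i ≠ A → j ≠ A → ¬ U i → ¬ U j → ∃ p q, (x i - p) ^ 2 + (y i - q) ^ 2 ≤ 1 ∧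
      (x j - p) ^ 2 + (y j - q) ^ 2 ≤ 1 ∧ (m ≤ p ∨ p ≤ -m)) : Cov x y := by
  by_cases t0 : ∀ i, i ≠ A → ¬ U i → 1 < (x i - m) ^ 2 + y i ^ 2 → 1 < (x i + m) ^ 2 + y i ^ 2 →
      0 ≤ y i
  · exact caseII_oneSign x y A U m hm hxA hyA hU hV t0
  by_cases t1 : ∀ i, i ≠ A → ¬ U i → 1 < (x i - m) ^ 2 + y i ^ 2 → 1 < (x i + m) ^ 2 + y i ^ 2 →
      y i ≤ 0
  · refine Cov.neg (caseII_oneSign x (fun i => - y i) A U m hm hxA (by simp [hyA]) ?_ ?_ ?_)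
    · simpa using hU
    · simpa using hV
    · simpa using t1
  rcases le_total 3 ((1 + 2 * m) ^ 2) with hs | hs
  · exfalso
    push Not at t0 t1
    obtain ⟨D, hDA, hDU, hD1, hD2, hDy⟩ := t0
    obtain ⟨C, hCA, hCU, hC1, hC2, hCy⟩ := t1
    have inn : ∀ i, i ≠ A → ¬ U i → 1 < (x i - m) ^ 2 + y i ^ 2 →
        1 < (x i + m) ^ 2 + y i ^ 2 → x i ≤ m ∧ -m ≤ x i := by
      intro i hi hiU h1 h2
      constructor
      · by_contra h
        push Not at h
        linarith [lens_right hm hs (hV i hi hiU).1 h.le]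
      · by_contra h
        push Not at h
        have := lens_right (x := - x i) (y := y i) hm hs (by linarith [(hV i hi hiU).2])
          (by linarith)
        linarith
    obtain ⟨p, q, e1, e2, e3⟩ := hq C D hCA hDA hCU hDU
    obtain ⟨f1, f2⟩ := inn C hCA hCU hC1 hC2
    obtain ⟨g1, g2⟩ := inn D hDA hDU hD1 hD2
    exact far_contra (by linarith) hCy.le hDy.le f1 f2 g1 g2 hC1 hC2 hD1 hD2 e1 e2 e3
  clear t0 t1
  have m0 : 0 < m := by linarith
  by_cases tL : ∃ i, i ≠ A ∧ ¬ U i ∧ 1 < (x i - m) ^ 2 + y i ^ 2 ∧ 1 < (x i + m) ^ 2 + y i ^ 2 ∧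
      x i ≤ -m
  swap
  · refine cov_box x y (fun i => (x i + m) ^ 2 + y i ^ 2 ≤ 1) (-m) 0 (-m) (1 + 2 * m)
      (by linarith) hs ?_ ?_ ?_
    · intro i hi
      simpa using hi
    · intro i hi
      have hiA : i ≠ A := by
        rintro rfl
        apply hi
        rw [hxA, hyA]
        ring_nf
        exact le_rfl
      push Not at hi
      by_cases hiU : U i
      · have h1 := hU i hiA hiU
        have h2 := hUA i hiA hiU
        have h3 := bnd_one h1
        refine ⟨?_, by linarith⟩
        by_contra h
        push Not at h
        have := mul_pos (by linarith : 0 < -x i) (by linarith : 0 < 1 + 2 * m)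
        linarith
      · refine ⟨?_, ?_⟩
        · by_contra h
          push Not at h
          refine tL ⟨i, hiA, hiU, ?_, hi, h.le⟩
          have := mul_pos (by linarith : 0 < -x i) m0
          linarith
        · have := lens_le hm (hV i hiA hiU).1
          linarith
    · intro i j hi hj
      have nA : ∀ i, ¬ ((x i + m) ^ 2 + y i ^ 2 ≤ 1) → i ≠ A := by
        rintro i hi rfl
        apply hi
        rw [hxA, hyA]
        ring_nf
        exact le_rfl
      exact (bnd_two (hd i j (nA i hi) (nA j hj))).2
  by_cases tR : ∃ i, i ≠ A ∧ ¬ U i ∧ 1 < (x i - m) ^ 2 + y i ^ 2 ∧ 1 < (x i + m) ^ 2 + y i ^ 2 ∧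
      m ≤ x i
  swap
  · refine cov_box x y (fun i => (x i - m) ^ 2 + y i ^ 2 ≤ 1) m 0 (-1 - m) (1 + 2 * m)
      (by linarith) hs ?_ ?_ ?_
    · intro i hi
      simpa using hi
    · intro i hi
      by_cases hiA : i = A
      · subst hiA
        rw [hxA]
        constructor <;> linarith
      push Not at hi
      have hiU : ¬ U i := fun h => by linarith [hU i hiA h]
      refine ⟨?_, ?_⟩
      · have := lens_le (x := - x i) (y := y i) hm (by linarith [(hV i hiA hiU).2])
        linarith
      · by_contra h
        push Not at h
        refine tR ⟨i, hiA, hiU, hi, ?_, by linarith⟩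
        have := mul_pos (by linarith : 0 < x i) m0
        linarith
    · intro i j hi hj
      have hiU : ∀ i, i ≠ A → ¬ ((x i - m) ^ 2 + y i ^ 2 ≤ 1) → ¬ U i := fun i hi h h' =>
        h (hU i hi h')
      by_cases hiA : i = A
      · subst hiA
        by_cases hjA : j = i
        · subst hjA; linarith
        · have := bnd_two (hV j hjA (hiU j hjA hj)).1
          rw [hyA]
          linarith [this.1]
      · by_cases hjA : j = A
        · subst hjA
          have := bnd_two (hV i hiA (hiU i hiA hi)).1
          rw [hyA]
          linarith [this.2]
        · exact (bnd_two (hd i j hiA hjA)).2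
  obtain ⟨E, hE, hEU, -, hE1, hEx⟩ := tL
  obtain ⟨R, hR, hRU, hR1, -, hRx⟩ := tR
  rcases le_total 0 (y E) with hEy | hEy
  · exact caseII_corner x y A U m hm hs hxA hyA hU hV hd E hE hEU hE1 hEx hEy R hR hRU hR1 hRx
  · refine Cov.neg (caseII_corner x (fun i => - y i) A U m hm hs hxA (by simp [hyA])
      (by simpa using hU) (by simpa using hV) ?_ E hE hEU (by simpa using hE1) hEx
      (by simpa using hEy) R hR hRU (by simpa using hR1) hRx)
    intro i j hi hj
    have := hd i j hi hj
    linarith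

theorem ball_aux {σ τ : ℝ} (hσ : 0 ≤ σ) (hτ : 0 < τ) (h : 2 * σ < σ ^ 2 + τ ^ 2)
    (h4 : σ ^ 2 + τ ^ 2 ≤ 4) : ∃ u v : ℝ, u < 0 ∧ ∀ a b : ℝ, a ^ 2 + b ^ 2 ≤ 1 →
      (a - σ) ^ 2 + (b - τ) ^ 2 ≤ 1 → (a - u) ^ 2 + (b - v) ^ 2 ≤ 1 := by
  obtain ⟨D, hD⟩ : ∃ D, D = σ ^ 2 + τ ^ 2 := ⟨_, rfl⟩
  have hD0 : 0 < D := by rw [hD]; positivity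
  obtain ⟨W, hW0, hW⟩ : ∃ W : ℝ, 0 ≤ W ∧ W ^ 2 = D * (1 - D / 4) :=
    ⟨√(D * (1 - D / 4)), Real.sqrt_nonneg _, Real.sq_sqrt
      (mul_nonneg hD0.le (by linarith))⟩
  have key : 2 * σ * W < τ * D := by
    refine lt_of_pow_lt_pow_left₀ 2 (by positivity) ?_
    have e1 : (2 * σ * W) ^ 2 = σ ^ 2 * D * (4 - D) := by
      calc (2 * σ * W) ^ 2 = 4 * σ ^ 2 * W ^ 2 := by ring
        _ = _ := by rw [hW]; ring
    have e2 : (τ * D) ^ 2 - (2 * σ * W) ^ 2 = D * (D - 2 * σ) * (D + 2 * σ) := by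
      rw [e1]
      have : τ ^ 2 = D - σ ^ 2 := by linarith
      rw [mul_pow, this]; ring
    have : 0 < D * (D - 2 * σ) * (D + 2 * σ) :=
      mul_pos (mul_pos hD0 (by linarith)) (by linarith)
    linarith
  obtain ⟨c, hc0, hc1, hc2⟩ : ∃ c : ℝ, 0 ≤ c ∧ σ < c * τ ∧ 2 * c * W < D := by
    refine ⟨σ / τ + (D - 2 * (σ / τ) * W) / (2 * (2 * W + 1)), ?_, ?_, ?_⟩
    all_goals
      have k2 : 0 < D - 2 * (σ / τ) * W := by
        have : 2 * (σ / τ) * W = 2 * σ * W / τ := by ring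
        rw [this, sub_pos, div_lt_iff₀ hτ]
        linarith
      have k3 : 0 < (D - 2 * (σ / τ) * W) / (2 * (2 * W + 1)) := by positivity
    · positivity
    · rw [add_mul, div_mul_cancel₀ _ hτ.ne']
      have := mul_pos k3 hτ
      linarith
    · have k4 : (D - 2 * (σ / τ) * W) / (2 * (2 * W + 1)) * (2 * (2 * W + 1)) =
        D - 2 * (σ / τ) * W := div_mul_cancel₀ _ (by positivity)
      generalize (D - 2 * (σ / τ) * W) / (2 * (2 * W + 1)) = z at *
      have := mul_nonneg k3.le hW0
      linarith
  obtain ⟨l, hl0, hl1, hl⟩ : ∃ l : ℝ, 0 < l ∧ l ≤ 1 ∧ l * ((1 + c ^ 2) * D) = D - 2 * c * W := by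
    have hp : 0 < (1 + c ^ 2) * D := by positivity
    refine ⟨(D - 2 * c * W) / ((1 + c ^ 2) * D), div_pos (by linarith) hp, ?_,
      div_mul_cancel₀ _ hp.ne'⟩
    rw [div_le_one hp]
    have := mul_nonneg hc0 hW0
    have : 0 ≤ c ^ 2 * D := by positivity
    linarith
  refine ⟨l * (σ - c * τ), l * (τ + c * σ), mul_neg_of_pos_of_neg hl0 (by linarith), ?_⟩
  intro a b h1 h2
  have n1 : (a * τ - b * σ) ^ 2 ≤ W ^ 2 := by
    have q1 : (a - σ / 2) ^ 2 + (b - τ / 2) ^ 2 ≤ 1 - D / 4 := by rw [hD]; linarith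
    have q2 := mul_le_mul_of_nonneg_left q1 hD0.le
    rw [hW]
    refine le_trans ?_ q2
    have : D * ((a - σ / 2) ^ 2 + (b - τ / 2) ^ 2) - (a * τ - b * σ) ^ 2 =
      ((a - σ / 2) * σ + (b - τ / 2) * τ) ^ 2 := by rw [hD]; ring
    have := sq_nonneg ((a - σ / 2) * σ + (b - τ / 2) * τ)
    linarith
  have n2 := (abs_le_of_sq_le_sq' n1 hW0).2
  have r1 := mul_le_mul_of_nonneg_left h1 (by linarith : 0 ≤ 1 - l)
  have r2 := mul_le_mul_of_nonneg_left h2 hl0.le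
  have r3 := mul_le_mul_of_nonneg_left n2 (mul_nonneg hl0.le hc0)
  have e : (a - l * (σ - c * τ)) ^ 2 + (b - l * (τ + c * σ)) ^ 2 =
      (1 - l) * (a ^ 2 + b ^ 2) + l * ((a - σ) ^ 2 + (b - τ) ^ 2) + 2 * (l * c * (a * τ - b * σ))
      + l * (l * ((1 + c ^ 2) * D)) - l * D := by rw [hD]; ring
  rw [e, hl]
  linarith

theorem ball_lemma {ι : Type*} (x y : ι → ℝ) (U : ι → Prop) (m : ℝ)
    (hne : ∃ i, U i) (hk : ∀ i, U i → (x i - m) ^ 2 + y i ^ 2 ≤ 1)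
    (hK : ∀ p q, (∀ i, U i → (x i - p) ^ 2 + (y i - q) ^ 2 ≤ 1) → m ≤ p)
    (p q : ℝ) (hpq : ∀ i, U i → (x i - p) ^ 2 + (y i - q) ^ 2 ≤ 1) :
    (p - 1 - m) ^ 2 + q ^ 2 ≤ 1 := by
  by_contra hc
  push Not at hc
  have h0 := hK p q hpq
  obtain ⟨j, hj⟩ := hne
  have hD : (p - m) ^ 2 + q ^ 2 ≤ 4 := by
    have h1 := hk j hj
    have h2 := hpq j hj
    have h3 := sq_nonneg (2 * x j - m - p)
    have h4 := sq_nonneg (2 * y j - q)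
    linarith
  rcases lt_trichotomy q 0 with hq | hq | hq
  · obtain ⟨u, v, hu, huv⟩ := ball_aux (σ := p - m) (τ := -q) (by linarith) (by linarith)
      (by linarith) (by linarith)
    have := hK (m + u) (-v) (fun i hi => by
      have := huv (x i - m) (- y i) (by linarith [hk i hi]) (by linarith [hpq i hi])
      linarith)
    linarith
  · subst hq
    have := mul_pos (by nlinarith : 0 < p - m) (by nlinarith : 0 < p - m - 2)
    nlinarith
  · obtain ⟨u, v, hu, huv⟩ := ball_aux (σ := p - m) (τ := q) (by linarith) (by linarith)
      (by linarith) (by linarith)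
    have := hK (m + u) v (fun i hi => by
      have := huv (x i - m) (y i) (by linarith [hk i hi]) (by linarith [hpq i hi])
      linarith)
    linarith

/-- a point of a unit disk around a point of another unit disk -/
theorem tri_two {a b p q c d : ℝ} (h1 : (a - p) ^ 2 + (b - q) ^ 2 ≤ 1)
    (h2 : (p - c) ^ 2 + (q - d) ^ 2 ≤ 1) : (a - c) ^ 2 + (b - d) ^ 2 ≤ 4 := by
  have h3 := sq_nonneg (a - 2 * p + c)
  have h4 := sq_nonneg (b - 2 * q + d)
  linarith

/-- Rigid coordinates. -/
theorem frame (P Q : EuclideanSpace ℝ (Fin 2)) (hPQ : P ≠ Q) (α : ℝ) :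
    ∃ (X Y : EuclideanSpace ℝ (Fin 2) → ℝ) (Z : ℝ → ℝ → EuclideanSpace ℝ (Fin 2)),
      (∀ p q, dist p q ^ 2 = (X p - X q) ^ 2 + (Y p - Y q) ^ 2) ∧
      (∀ u v, X (Z u v) = u) ∧ (∀ u v, Y (Z u v) = v) ∧
      X P = α ∧ Y P = 0 ∧ X Q = α + dist P Q ∧ Y Q = 0 := by
  have hd : 0 < dist P Q := dist_pos.2 hPQ
  have hsq : ∀ p q : EuclideanSpace ℝ (Fin 2), dist p q ^ 2 = (p 0 - q 0) ^ 2 + (p 1 - q 1) ^ 2 := by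
    intro p q
    rw [EuclideanSpace.dist_eq, Real.sq_sqrt (by positivity)]
    simp [Fin.sum_univ_two, Real.dist_eq, sq_abs]
  have hd2 := hsq P Q
  obtain ⟨d, hdd⟩ : ∃ d, d = dist P Q := ⟨_, rfl⟩
  rw [← hdd] at hd hd2 ⊢
  obtain ⟨a, ha⟩ : ∃ a, a = (Q 0 - P 0) / d := ⟨_, rfl⟩
  obtain ⟨b, hb⟩ : ∃ b, b = (Q 1 - P 1) / d := ⟨_, rfl⟩
  have ha' : Q 0 - P 0 = a * d := by rw [ha, div_mul_cancel₀ _ hd.ne']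
  have hb' : Q 1 - P 1 = b * d := by rw [hb, div_mul_cancel₀ _ hd.ne']
  have hab : a ^ 2 + b ^ 2 = 1 := by
    rw [ha, hb]; field_simp; linarith
  refine ⟨fun p => α + a * (p 0 - P 0) + b * (p 1 - P 1),
    fun p => -b * (p 0 - P 0) + a * (p 1 - P 1),
    fun u v => !₂[P 0 + (u - α) * a - v * b, P 1 + (u - α) * b + v * a],
    ?_, ?_, ?_, ?_, ?_, ?_, ?_⟩
  · intro p q
    rw [hsq]
    calc _ = (a ^ 2 + b ^ 2) * ((p 0 - q 0) ^ 2 + (p 1 - q 1) ^ 2) := by rw [hab, one_mul]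
      _ = _ := by ring
  · intro u v
    simp only [PiLp.toLp_apply, Matrix.cons_val_zero, Matrix.cons_val_one]
    linear_combination (u - α) * hab
  · intro u v
    simp only [PiLp.toLp_apply, Matrix.cons_val_zero, Matrix.cons_val_one]
    linear_combination v * hab
  · simp
  · simp
  · simp only [ha', hb']
    linear_combination d * hab
  · simp only [ha', hb']
    ring

abbrev Pl := EuclideanSpace ℝ (Fin 2)

def Good (a b d : Pl) : Prop := ∃ q, dist q a ≤ 1 ∧ dist q b ≤ 1 ∧ dist q d ≤ 1

def Pierce {ι : Type*} (c : ι → Pl) : Prop :=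
  ∃ C : Finset Pl, C.card ≤ 3 ∧ ∀ i, ∃ x ∈ C, dist x (c i) ≤ 1

theorem Good.rot {a b d : Pl} (h : Good a b d) : Good b d a := by
  obtain ⟨q, h1, h2, h3⟩ := h; exact ⟨q, h2, h3, h1⟩

theorem Good.swap {a b d : Pl} (h : Good a b d) : Good b a d := by
  obtain ⟨q, h1, h2, h3⟩ := h; exact ⟨q, h2, h1, h3⟩

theorem Good.le {a b d : Pl} (h : Good a b d) : dist a b ≤ 2 := by
  obtain ⟨q, h1, h2, -⟩ := h
  linarith [dist_triangle_left a b q]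

theorem good_pair {a b : Pl} (h : dist a b ≤ 2) : Good a a b := by
  refine ⟨midpoint ℝ a b, ?_, ?_, ?_⟩
  · rw [dist_midpoint_left]; norm_num; linarith
  · rw [dist_midpoint_left]; norm_num; linarith
  · rw [dist_midpoint_right]; norm_num; linarith

theorem pierce_of_three {ι : Type*} (c : ι → Pl) (p q r : Pl)
    (h : ∀ i, dist p (c i) ≤ 1 ∨ dist q (c i) ≤ 1 ∨ dist r (c i) ≤ 1) : Pierce c := by
  classical
  refine ⟨{p, q, r}, Finset.card_le_three, fun i => ?_⟩
  rcases h i with h | h | h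
  · exact ⟨p, by simp, h⟩
  · exact ⟨q, by simp, h⟩
  · exact ⟨r, by simp, h⟩

theorem pierce_of_cov {ι : Type*} (c : ι → Pl) (X Y : Pl → ℝ) (Z : ℝ → ℝ → Pl)
    (hd : ∀ p q, dist p q ^ 2 = (X p - X q) ^ 2 + (Y p - Y q) ^ 2)
    (hX : ∀ u v, X (Z u v) = u) (hY : ∀ u v, Y (Z u v) = v)
    (h : Cov (fun i => X (c i)) (fun i => Y (c i))) : Pierce c := by
  obtain ⟨u₁, v₁, u₂, v₂, u₃, v₃, h⟩ := h
  have key : ∀ i u v, (X (c i) - u) ^ 2 + (Y (c i) - v) ^ 2 ≤ 1 → dist (Z u v) (c i) ≤ 1 := by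
    intro i u v h
    rw [dist_comm]
    refine (abs_le_of_sq_le_sq' (b := 1) ?_ (by norm_num)).2
    rw [hd, hX, hY]
    linarith
  refine pierce_of_three c (Z u₁ v₁) (Z u₂ v₂) (Z u₃ v₃) fun i => ?_
  rcases h i with h | h | h
  · exact Or.inl (key _ _ _ h)
  · exact Or.inr (Or.inl (key _ _ _ h))
  · exact Or.inr (Or.inr (key _ _ _ h))

theorem helly3 {ι : Type*} (c : ι → Pl) (s : Finset ι)
    (h : ∀ i ∈ s, ∀ j ∈ s, ∀ k ∈ s, Good (c i) (c j) (c k)) :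
    ∃ q, ∀ i ∈ s, dist q (c i) ≤ 1 := by
  classical
  have := Convex.helly_theorem' (𝕜 := ℝ) (F := fun i => Metric.closedBall (c i) 1) (s := s)
    (fun i _ => convex_closedBall _ _) (by
      intro I hI hc
      have hc : I.card ≤ 3 := by simpa using hc
      have hc' : I.card = 0 ∨ I.card = 1 ∨ I.card = 2 ∨ I.card = 3 := by omega
      rcases hc' with e | e | e | e
      · rw [Finset.card_eq_zero] at e
        subst e
        exact ⟨0, by simp⟩
      · obtain ⟨i, rfl⟩ := Finset.card_eq_one.1 e
        exact ⟨c i, by simp⟩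
      · obtain ⟨i, j, -, rfl⟩ := Finset.card_eq_two.1 e
        obtain ⟨q, h1, h2, h3⟩ := h i (hI (by simp)) j (hI (by simp)) j (hI (by simp))
        exact ⟨q, by simp [h1, h2]⟩
      · obtain ⟨i, j, k, -, -, -, rfl⟩ := Finset.card_eq_three.1 e
        obtain ⟨q, h1, h2, h3⟩ := h i (hI (by simp)) j (hI (by simp)) k (hI (by simp))
        exact ⟨q, by simp [h1, h2, h3]⟩)
  obtain ⟨q, hq⟩ := this
  refine ⟨q, fun i hi => ?_⟩
  simpa using Set.mem_iInter₂.1 hq i hi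

theorem nearest (K : Set Pl) (hne : K.Nonempty) (hcl : IsClosed K) (hcv : Convex ℝ K) (a : Pl) :
    ∃ k ∈ K, ∀ q ∈ K, dist a k ^ 2 + dist q k ^ 2 ≤ dist a q ^ 2 := by
  obtain ⟨k, hk, hk2⟩ := exists_norm_eq_iInf_of_complete_convex hne hcl.isComplete hcv a
  refine ⟨k, hk, fun q hq => ?_⟩
  have h := (norm_eq_iInf_iff_real_inner_le_zero hcv hk).1 hk2 q hq
  have e := norm_sub_sq_real (a - k) (q - k)
  rw [sub_sub_sub_cancel_right] at e
  rw [dist_eq_norm, dist_eq_norm, dist_eq_norm, e]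
  linarith

theorem sq_le_four {a : ℝ} (h0 : 0 ≤ a) (h : a ≤ 2) : a ^ 2 ≤ 4 := by nlinarith
theorem sq_le_onesq {a : ℝ} (h0 : 0 ≤ a) (h : a ≤ 1) : a ^ 2 ≤ 1 := by nlinarith

theorem main_A {ι : Type*} [Fintype ι] (c : ι → Pl) (A B : ι) (hAB : c A ≠ c B)
    (hG : ∀ i j k l, i ≠ j → i ≠ k → i ≠ l → j ≠ k → j ≠ l → k ≠ l →
      Good (c i) (c j) (c k) ∨ Good (c i) (c j) (c l) ∨ Good (c i) (c k) (c l) ∨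
      Good (c j) (c k) (c l))
    (hmax : ∀ i, dist (c i) (c A) ≤ dist (c A) (c B))
    (hd : ∀ i j, i ≠ A → j ≠ A → dist (c i) (c j) ≤ 2) : Pierce c := by
  classical
  have hBA : B ≠ A := fun h => hAB (by rw [h])
  rcases le_or_gt (dist (c A) (c B)) 2.4 with hL | hL
  · obtain ⟨X, Y, Z, hD, hX, hY, hXP, hYP, hXQ, hYQ⟩ := frame (c A) (c B) hAB (1 - dist (c A) (c B))
    refine pierce_of_cov c X Y Z hD hX hY ?_
    refine caseI (fun i => X (c i)) (fun i => Y (c i)) A (dist (c A) (c B)) dist_nonneg hL hXP hYP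
      ?_ ?_ ?_
    · intro i
      have h1 := hD (c i) (c A)
      have h2 := pow_le_pow_left₀ dist_nonneg (hmax i) 2
      rw [h1, hXP, hYP] at h2
      linarith
    · intro i hi
      have h1 := hD (c i) (c B)
      have h2 := sq_le_four dist_nonneg (hd i B hi hBA)
      rw [h1, hXQ, hYQ] at h2
      linarith
    · intro i j hi hj
      have h1 := hD (c i) (c j)
      have h2 := sq_le_four dist_nonneg (hd i j hi hj)
      rw [h1] at h2
      exact h2
  obtain ⟨U, hU⟩ : ∃ U : Finset ι, ∀ i, i ∈ U ↔ i ≠ A ∧ 2 < dist (c i) (c A) :=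
    ⟨Finset.univ.filter (fun i => i ≠ A ∧ 2 < dist (c i) (c A)), by simp⟩
  have hBU : B ∈ U := (hU B).2 ⟨hBA, by rw [dist_comm]; linarith⟩
  have hUU : ∀ i j k, i ≠ A → j ≠ A → k ≠ A → i ∈ U → j ∈ U → Good (c i) (c j) (c k) := by
    intro i j k hi hj hk hiU hjU
    by_cases e1 : i = j
    · subst e1; exact good_pair (hd i k hi hk)
    by_cases e2 : i = k
    · subst e2; exact (good_pair (hd i j hi hj)).rot
    by_cases e3 : j = k
    · subst e3; exact (good_pair (hd j i hj hi)).rot.rot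
    have f1 := ((hU i).1 hiU).2
    have f2 := ((hU j).1 hjU).2
    rcases hG A i j k hi.symm hj.symm hk.symm e1 e2 e3 with h | h | h | h
    · linarith [h.swap.le]
    · linarith [h.swap.le]
    · linarith [h.swap.le]
    · exact h
  have hT : ∀ i j k, i ≠ A → j ≠ A → k ≠ A →
      (i = j ∨ i = k ∨ j = k ∨ (i ∈ U ∧ j ∈ U) ∨ (i ∈ U ∧ k ∈ U) ∨ (j ∈ U ∧ k ∈ U)) →
      Good (c i) (c j) (c k) := by
    intro i j k hi hj hk h
    rcases h with h | h | h | ⟨h, h'⟩ | ⟨h, h'⟩ | ⟨h, h'⟩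
    · subst h; exact good_pair (hd i k hi hk)
    · subst h; exact (good_pair (hd i j hi hj)).rot
    · subst h; exact (good_pair (hd j i hj hi)).rot.rot
    · exact hUU i j k hi hj hk h h'
    · exact (hUU i k j hi hk hj h h').rot.rot.swap
    · exact (hUU j k i hj hk hi h h').rot.rot
  have hUA : ∀ i ∈ U, i ≠ A := fun i hi => ((hU i).1 hi).1
  -- the intersection of the disks in `U`
  have hcl : IsClosed {q : Pl | ∀ i ∈ U, dist q (c i) ≤ 1} := by
    have : {q : Pl | ∀ i ∈ U, dist q (c i) ≤ 1} = ⋂ i ∈ U, Metric.closedBall (c i) 1 := by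
      ext q; simp
    rw [this]
    exact isClosed_biInter fun i _ => Metric.isClosed_closedBall
  have hcv : Convex ℝ {q : Pl | ∀ i ∈ U, dist q (c i) ≤ 1} := by
    have : {q : Pl | ∀ i ∈ U, dist q (c i) ≤ 1} = ⋂ i ∈ U, Metric.closedBall (c i) 1 := by
      ext q; simp
    rw [this]
    exact convex_iInter₂ fun i _ => convex_closedBall _ _
  have hne : {q : Pl | ∀ i ∈ U, dist q (c i) ≤ 1}.Nonempty :=
    helly3 c U fun i hi j hj k hk => hT i j k (hUA i hi) (hUA j hj) (hUA k hk) (by tauto)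
  obtain ⟨k, hk, hkn⟩ := nearest _ hne hcl hcv (c A)
  simp only [Set.mem_ofPred_eq] at hk hkn
  -- disks in `V`
  have hVC : ∀ C, C ≠ A → ∃ q, dist q (c C) ≤ 1 ∧ ∀ i ∈ U, dist q (c i) ≤ 1 := by
    intro C hC
    obtain ⟨q, hq⟩ := helly3 c (insert C U) (by
      intro i hi j hj l hl
      rw [Finset.mem_insert] at hi hj hl
      refine hT i j l ?_ ?_ ?_ ?_
      · rcases hi with rfl | hi; exacts [hC, hUA i hi]
      · rcases hj with rfl | hj; exacts [hC, hUA j hj]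
      · rcases hl with rfl | hl; exacts [hC, hUA l hl]
      · rcases hi with hi | hi <;> rcases hj with hj | hj <;> rcases hl with hl | hl <;>
          simp [hi, hj, hl])
    exact ⟨q, hq C (by simp), fun i hi => hq i (by simp [hi])⟩
  have hVV : ∀ C D, C ≠ A → D ≠ A → C ∉ U → D ∉ U → ∃ q, dist q (c C) ≤ 1 ∧ dist q (c D) ≤ 1 ∧
      (dist q (c A) ≤ 1 ∨ ∀ i ∈ U, dist q (c i) ≤ 1) := by
    intro C D hC hD hCU hDU
    by_cases hg : Good (c A) (c C) (c D)
    · obtain ⟨q, h1, h2, h3⟩ := hg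
      exact ⟨q, h2, h3, Or.inl h1⟩
    have hCD : C ≠ D := by
      rintro rfl
      apply hg
      have : dist (c C) (c A) ≤ 2 := by
        by_contra h
        exact hCU ((hU C).2 ⟨hC, not_le.1 h⟩)
      exact (good_pair this).rot.rot
    have hi3 : ∀ i ∈ U, Good (c i) (c C) (c D) := by
      intro i hi
      have f1 := ((hU i).1 hi).2
      rcases hG A i C D (hUA i hi).symm hC.symm hD.symm (fun h => hCU (h ▸ hi))
        (fun h => hDU (h ▸ hi)) hCD with h | h | h | h
      · linarith [h.swap.le]
      · linarith [h.swap.le]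
      · exact absurd h hg
      · exact h
    obtain ⟨q, hq⟩ := helly3 c (insert C (insert D U)) (by
      intro i hi j hj l hl
      simp only [Finset.mem_insert] at hi hj hl
      have hiA : i ≠ A := by rcases hi with rfl | rfl | hi; exacts [hC, hD, hUA i hi]
      have hjA : j ≠ A := by rcases hj with rfl | rfl | hj; exacts [hC, hD, hUA j hj]
      have hlA : l ≠ A := by rcases hl with rfl | rfl | hl; exacts [hC, hD, hUA l hl]
      by_cases hh : i = j ∨ i = l ∨ j = l ∨ (i ∈ U ∧ j ∈ U) ∨ (i ∈ U ∧ l ∈ U) ∨ (j ∈ U ∧ l ∈ U)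
      · exact hT i j l hiA hjA hlA hh
      · have c1 : ∀ t ∈ U, Good (c t) (c D) (c C) := fun t ht => (hi3 t ht).rot.swap.rot.rot
        rcases hi with rfl | rfl | hi <;> rcases hj with rfl | rfl | hj <;>
          rcases hl with rfl | rfl | hl <;> first
          | exact (hi3 _ (by assumption))
          | exact (hi3 _ (by assumption)).rot
          | exact (hi3 _ (by assumption)).rot.rot
          | exact (c1 _ (by assumption))
          | exact (c1 _ (by assumption)).rot
          | exact (c1 _ (by assumption)).rot.rot
          | (exfalso; clear hU hG hd hT hUU hVC hkn; tauto))
    exact ⟨q, hq C (by simp), hq D (by simp), Or.inr fun i hi => hq i (by simp [hi])⟩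
  -- coordinates
  have hs : 1.4 < dist (c A) k := by
    have := hk B hBU
    have := dist_triangle (c A) k (c B)
    norm_num at *
    linarith
  obtain ⟨m, hm⟩ : ∃ m, m = (dist (c A) k - 1) / 2 := ⟨_, rfl⟩
  have hm2 : 0.2 ≤ m := by norm_num at *; linarith
  have hs2 : dist (c A) k = 1 + 2 * m := by linarith
  have hAk : c A ≠ k := by
    intro h
    rw [h, dist_self] at hs
    norm_num at hs
  obtain ⟨X, Y, Z, hD, hX, hY, hXP, hYP, hXQ, hYQ⟩ := frame (c A) k hAk (-1 - m)
  have hXk : X k = m := by rw [hXQ, hs2]; ring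
  have hKx : ∀ q : Pl, (∀ i ∈ U, dist q (c i) ≤ 1) → m ≤ X q := by
    intro q hq
    have := hkn q hq
    rw [hD, hD, hD, hXP, hYP, hXk, hYQ] at this
    have h3 : 0 ≤ (1 + 2 * m) * (X q - m) := by linarith
    have := nonneg_of_mul_nonneg_right h3 (by linarith)
    linarith
  have hone : ∀ p q, dist p q ≤ 1 → (X q - X p) ^ 2 + (Y q - Y p) ^ 2 ≤ 1 := by
    intro p q h
    have := sq_le_onesq dist_nonneg h
    rw [dist_comm, hD] at this
    exact this
  have hkU : ∀ i, i ∈ U → (X (c i) - m) ^ 2 + Y (c i) ^ 2 ≤ 1 := by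
    intro i hi
    have := hone _ _ (hk i hi)
    rw [hXk, hYQ] at this
    simpa using this
  have hball : ∀ q : Pl, (∀ i ∈ U, dist q (c i) ≤ 1) → (X q - 1 - m) ^ 2 + Y q ^ 2 ≤ 1 := by
    intro q hq
    refine ball_lemma (fun i => X (c i)) (fun i => Y (c i)) (fun i => i ∈ U) m ⟨B, hBU⟩ hkU ?_
      (X q) (Y q) (fun i hi => hone _ _ (hq i hi))
    intro p r h
    have := hKx (Z p r) (fun i hi => by
      refine (abs_le_of_sq_le_sq' (b := 1) ?_ (by norm_num)).2
      rw [dist_comm, hD, hX, hY]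
      linarith [h i hi])
    rwa [hX] at this
  refine pierce_of_cov c X Y Z hD hX hY ?_
  refine caseII (fun i => X (c i)) (fun i => Y (c i)) A (fun i => i ∈ U) m hm2 hXP hYP
    (fun i _ hi => hkU i hi) ?_ ?_ ?_ ?_
  · intro i _ hi
    have h2 : (2 : ℝ) ^ 2 < dist (c i) (c A) ^ 2 :=
      pow_lt_pow_left₀ ((hU i).1 hi).2 (by norm_num) two_ne_zero
    rw [hD, hXP, hYP] at h2
    linarith
  · intro i hi hiU
    have h1 : dist (c i) (c A) ≤ 2 := by
      by_contra h
      exact hiU ((hU i).2 ⟨hi, not_le.1 h⟩)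
    have h2 := sq_le_four dist_nonneg h1
    rw [hD, hXP, hYP] at h2
    obtain ⟨q, hq1, hq2⟩ := hVC i hi
    have h3 := tri_two (hone _ _ hq1) (c := 1 + m) (d := 0) (by linarith [hball q hq2])
    constructor
    · linarith
    · linarith
  · intro i j hi hj
    have h2 := sq_le_four dist_nonneg (hd i j hi hj)
    rwa [hD] at h2
  · intro i j hi hj hiU hjU
    obtain ⟨q, h1, h2, h3⟩ := hVV i j hi hj hiU hjU
    refine ⟨X q, Y q, hone _ _ h1, hone _ _ h2, ?_⟩
    rcases h3 with h3 | h3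
    · right
      have := bnd_one (hone _ _ h3)
      rw [hXP] at this
      linarith
    · left
      exact hKx q h3

theorem main_pl {ι : Type*} [Fintype ι] (c : ι → Pl)
    (hG : ∀ i j k l, i ≠ j → i ≠ k → i ≠ l → j ≠ k → j ≠ l → k ≠ l →
      Good (c i) (c j) (c k) ∨ Good (c i) (c j) (c l) ∨ Good (c i) (c k) (c l) ∨
      Good (c j) (c k) (c l)) : Pierce c := by
  classical
  rcases isEmpty_or_nonempty ι with hι | hι
  · exact ⟨∅, by simp, fun i => hι.elim i⟩
  obtain ⟨⟨A, B⟩, hmax⟩ := Finite.exists_max (fun p : ι × ι => dist (c p.1) (c p.2))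
  have hmax : ∀ i j, dist (c i) (c j) ≤ dist (c A) (c B) := fun i j => hmax (i, j)
  by_cases hAB : c A = c B
  · refine pierce_of_three c (c A) (c A) (c A) fun i => Or.inl ?_
    have := hmax A i
    rw [hAB, dist_self] at this
    rw [hAB]
    linarith
  rcases le_or_gt (dist (c A) (c B)) 2 with hL | hL
  · exact main_A c A B hAB hG (fun i => hmax i A) (fun i j _ _ => (hmax i j).trans hL)
  have hABne : A ≠ B := fun h => hAB (by rw [h])
  have hCD : ∀ C D, C ≠ A → C ≠ B → D ≠ A → D ≠ B → dist (c C) (c D) ≤ 2 := by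
    intro C D h1 h2 h3 h4
    by_cases e : C = D
    · subst e; simp
    rcases hG A B C D hABne h1.symm h3.symm h2.symm h4.symm e with h | h | h | h
    · linarith [h.le]
    · linarith [h.le]
    · exact h.rot.le
    · exact h.rot.le
  by_cases hB : ∀ D, D ≠ A → D ≠ B → dist (c B) (c D) ≤ 2
  · refine main_A c A B hAB hG (fun i => hmax i A) fun i j hi hj => ?_
    by_cases hiB : i = B
    · subst hiB
      by_cases hjB : j = i
      · subst hjB; simp
      · exact hB j hj hjB
    · by_cases hjB : j = B
      · subst hjB
        rw [dist_comm]; exact hB i hi hiB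
      · exact hCD i j hi hiB hj hjB
  by_cases hA : ∀ C, C ≠ A → C ≠ B → dist (c A) (c C) ≤ 2
  · refine main_A c B A (fun h => hAB h.symm) hG (fun i => by rw [dist_comm (c B)]; exact hmax i B)
      fun i j hi hj => ?_
    by_cases hiA : i = A
    · subst hiA
      by_cases hjA : j = i
      · subst hjA; simp
      · exact hA j hjA hj
    · by_cases hjA : j = A
      · subst hjA
        rw [dist_comm]; exact hA i hiA hi
      · exact hCD i j hiA hi hjA hj
  push Not at hA hB
  obtain ⟨D, hDA, hDB, hD⟩ := hB
  obtain ⟨C, hCA, hCB, hC⟩ := hA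
  have e : C = D := by
    by_contra e
    rcases hG A B C D hABne hCA.symm hDA.symm hCB.symm hDB.symm e with h | h | h | h
    · linarith [h.le]
    · linarith [h.le]
    · linarith [h.le]
    · linarith [h.rot.rot.le, dist_comm (c D) (c B)]
  subst e
  refine pierce_of_three c (c A) (c B) (c C) fun i => ?_
  by_cases h1 : i = A
  · subst h1; simp
  by_cases h2 : i = B
  · subst h2; simp
  by_cases h3 : i = C
  · subst h3; simp
  exfalso
  rcases hG A B C i hABne hCA.symm (Ne.symm h1) hCB.symm (Ne.symm h2) (Ne.symm h3) with h | h | h | h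
  · linarith [h.le]
  · linarith [h.le]
  · linarith [h.le]
  · linarith [h.le]

/-- Kynčl–Tancer: a finite family of closed unit disks in the plane with the
`(4,3)`-property can be pierced by at most `3` points. -/
theorem kyncl_tancer_unit_disks {ι : Type*} [Fintype ι]
    (F : ι → Set (EuclideanSpace ℝ (Fin 2)))
    (hdisk : ∀ i, ∃ c : EuclideanSpace ℝ (Fin 2), F i = Metric.closedBall c 1)
    (h43 : ∀ P : Finset ι, P.card = 4 →
      ∃ Q ⊆ P, Q.card = 3 ∧ (⋂ i ∈ Q, F i).Nonempty) :
    ∃ C : Finset (EuclideanSpace ℝ (Fin 2)), C.card ≤ 3 ∧ ∀ i, ∃ x ∈ C, x ∈ F i := by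
  classical
  choose c hc using hdisk
  have : Pierce c := by
    refine main_pl c fun i j k l hij hik hil hjk hjl hkl => ?_
    obtain ⟨Q, hQ, hQ3, q, hq⟩ := h43 {i, j, k, l} (Finset.card_eq_four.2
      ⟨i, j, k, l, hij, hik, hil, hjk, hjl, hkl, rfl⟩)
    have hq' : ∀ t ∈ Q, dist q (c t) ≤ 1 := by
      intro t ht
      have := Set.mem_iInter₂.1 hq t ht
      rwa [hc, Metric.mem_closedBall] at this
    have hmiss : ∀ s t, s ∈ ({i, j, k, l} : Finset ι) → t ∈ ({i, j, k, l} : Finset ι) → s ≠ t →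
        s ∉ Q → t ∈ Q := by
      intro s t hs ht hst hsQ
      by_contra htQ
      have h1 : Q ⊆ (({i, j, k, l} : Finset ι).erase s).erase t := fun z hz => by
        rw [Finset.mem_erase, Finset.mem_erase]
        exact ⟨fun h => htQ (h ▸ hz), fun h => hsQ (h ▸ hz), hQ hz⟩
      have h2 := Finset.card_le_card h1
      have h4 : ({i, j, k, l} : Finset ι).card = 4 := Finset.card_eq_four.2
        ⟨i, j, k, l, hij, hik, hil, hjk, hjl, hkl, rfl⟩
      rw [Finset.card_erase_of_mem (Finset.mem_erase.2 ⟨hst.symm, ht⟩),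
        Finset.card_erase_of_mem hs, h4, hQ3] at h2
      omega
    have mi : i ∈ ({i, j, k, l} : Finset ι) := by simp
    have mj : j ∈ ({i, j, k, l} : Finset ι) := by simp
    have mk : k ∈ ({i, j, k, l} : Finset ι) := by simp
    have ml : l ∈ ({i, j, k, l} : Finset ι) := by simp
    by_cases h1 : i ∈ Q
    · by_cases h2 : j ∈ Q
      · by_cases h3 : k ∈ Q
        · exact Or.inl ⟨q, hq' i h1, hq' j h2, hq' k h3⟩
        · exact Or.inr (Or.inl ⟨q, hq' i h1, hq' j h2, hq' l (hmiss k l mk ml hkl h3)⟩)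
      · exact Or.inr (Or.inr (Or.inl ⟨q, hq' i h1, hq' k (hmiss j k mj mk hjk h2),
          hq' l (hmiss j l mj ml hjl h2)⟩))
    · exact Or.inr (Or.inr (Or.inr ⟨q, hq' j (hmiss i j mi mj hij h1),
        hq' k (hmiss i k mi mk hik h1), hq' l (hmiss i l mi ml hil h1)⟩))
  obtain ⟨C, h3, h⟩ := this
  refine ⟨C, h3, fun i => ?_⟩
  obtain ⟨x, hx, hxi⟩ := h i
  exact ⟨x, hx, by rw [hc]; exact hxi⟩
end

section
/- Let d ≥ 1 and p ≥ 2 be integers, and let F be a finite family of d-intervals in ℝ satisfying the (p,2)-property: among every p members of F there exist 2 with a common point. Then F has a piercing set of at most (d² - d + 1)(p - 1) points. -/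
/-- `S` is a `d`-interval: a nonempty union of at most `d` pairwise disjoint nonempty
closed bounded intervals in `ℝ`. -/
def IsDInterval (d : ℕ) (S : Set ℝ) : Prop :=
  S.Nonempty ∧ ∃ (k : ℕ) (a b : Fin k → ℝ), k ≤ d ∧ (∀ i, a i ≤ b i) ∧
    (Pairwise fun i j => Disjoint (Set.Icc (a i) (b i)) (Set.Icc (a j) (b j))) ∧
    S = ⋃ i, Set.Icc (a i) (b i)

def TKDom {V I : Type*} (r : I → V → ℤ) (S : Finset V) : Prop :=
  ∀ y, ∃ i, ∀ x ∈ S, r i y ≤ r i x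

def TKMax {V I : Type*} (r : I → V → ℤ) (m : I → V) (a : I) (x : V) : Prop :=
  (∀ i, i ≠ a → r i (m i) < r i x) ∧ ∀ y, (∀ i, i ≠ a → r i (m i) < r i y) → r a y ≤ r a x

theorem tk_door_structure {V I : Type*} [DecidableEq V] [Fintype I] [DecidableEq I]
    (r : I → V → ℤ) (hr : ∀ i, Function.Injective (r i)) (S : Finset V) (hne : S.Nonempty)
    (hS : S.card + 1 = Fintype.card I) (hD : TKDom r S) :
    ∃ (m : I → V) (a b : I), a ≠ b ∧ (∀ i, m i ∈ S) ∧ (∀ i, ∀ x ∈ S, r i (m i) ≤ r i x) ∧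
      m a = m b ∧ (∀ y ∈ S, ∃ i, m i = y) ∧
      (∀ i j, m i = m j → i ≠ j → (i = a ∧ j = b) ∨ (i = b ∧ j = a)) := by
  have h0 : ∀ i, ∃ x ∈ S, ∀ y ∈ S, r i x ≤ r i y := fun i => S.exists_min_image (r i) hne
  choose m hm hmin using h0
  have hsurj : ∀ y ∈ S, ∃ i, m i = y := by
    intro y hy
    obtain ⟨i, hi⟩ := hD y
    exact ⟨i, hr i (le_antisymm (hmin i y hy) (hi _ (hm i)))⟩
  have himg : Finset.univ.image m = S := by
    ext y; simp only [Finset.mem_image, Finset.mem_univ, true_and]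
    exact ⟨fun ⟨i, hi⟩ => hi ▸ hm i, hsurj y⟩
  obtain ⟨a, -, b, -, hab, hmab⟩ := Finset.exists_ne_map_eq_of_card_lt_of_maps_to
    (s := (Finset.univ : Finset I)) (t := S) (f := m) (by rw [Finset.card_univ]; omega)
    (fun i _ => hm i)
  refine ⟨m, a, b, hab, hm, hmin, hmab, hsurj, ?_⟩
  -- restricted to the complement of b, m is surjective hence injective
  have key : ∀ c : I, (∃ c', c' ≠ c ∧ m c' = m c) → ∀ i j, i ≠ c → j ≠ c → m i = m j → i = j := by
    rintro c ⟨c', hc', hmc⟩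
    have him : ((Finset.univ.erase c).image m) = S := by
      ext y; simp only [Finset.mem_image, Finset.mem_erase, Finset.mem_univ, and_true]
      constructor
      · rintro ⟨i, _, hi⟩; exact hi ▸ hm i
      · intro hy
        obtain ⟨i, hi⟩ := hsurj y hy
        by_cases hic : i = c
        · exact ⟨c', hc', by rw [hmc, ← hic, hi]⟩
        · exact ⟨i, hic, hi⟩
    have hinj : Set.InjOn m (Finset.univ.erase c : Finset I) := by
      apply Finset.card_image_iff.mp
      rw [him, Finset.card_erase_of_mem (Finset.mem_univ _), Finset.card_univ]; omega
    intro i j hi hj hij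
    exact hinj (by simpa using hi) (by simpa using hj) hij
  have ka := key a ⟨b, hab.symm, hmab.symm⟩
  have kb := key b ⟨a, hab, hmab⟩
  intro i j hij hne'
  by_cases h1 : i = a
  · by_cases h2 : j = b
    · exact Or.inl ⟨h1, h2⟩
    · exact absurd (kb i j (by rw [h1]; exact hab) h2 hij) hne'
  · by_cases h2 : j = a
    · by_cases h3 : i = b
      · exact Or.inr ⟨h3, h2⟩
      · exact absurd (kb i j h3 (by rw [h2]; exact hab) hij) hne'
    · exact absurd (ka i j h1 h2 hij) hne'

theorem tk_room_iff {V I : Type*} [DecidableEq V] [DecidableEq I]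
    (r : I → V → ℤ) (hr : ∀ i, Function.Injective (r i)) (S : Finset V)
    (hD : TKDom r S) (m : I → V) (a b : I) (hab : a ≠ b) (hm : ∀ i, m i ∈ S)
    (hmin : ∀ i, ∀ x ∈ S, r i (m i) ≤ r i x) (hmab : m a = m b)
    (hpair : ∀ i j, m i = m j → i ≠ j → (i = a ∧ j = b) ∨ (i = b ∧ j = a)) (x : V) :
    (x ∉ S ∧ TKDom r (insert x S)) ↔ (TKMax r m a x ∨ TKMax r m b x) := by
  constructor
  · rintro ⟨hx, hdom⟩
    obtain ⟨i, hi⟩ := hdom x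
    have hs : ∀ y ∈ S, ∃ j, m j = y ∧ j ≠ i ∧ r j (m j) < r j x := by
      intro y hy
      obtain ⟨j, hj⟩ := hdom y
      have e : m j = y := hr j (le_antisymm (hmin j y hy) (hj _ (Finset.mem_insert_of_mem (hm j))))
      have hxy : r j y < r j x := lt_of_le_of_ne (hj x (Finset.mem_insert_self _ _))
        (fun h => hx (hr j h ▸ hy))
      refine ⟨j, e, ?_, by rw [e]; exact hxy⟩
      rintro rfl
      exact absurd (hi y (Finset.mem_insert_of_mem hy)) (not_le.mpr hxy)
    have hiab : i = a ∨ i = b := by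
      obtain ⟨j, hj, hji, _⟩ := hs (m i) (hm i)
      rcases hpair j i hj hji with h | h
      · exact Or.inr h.2
      · exact Or.inl h.2
    have hY : ∀ j, j ≠ i → r j (m j) < r j x := by
      intro j hji
      obtain ⟨k, hk, hki, hlt⟩ := hs (m j) (hm j)
      by_cases hkj : k = j
      · rw [← hkj]; exact hlt
      · exfalso
        rcases hpair k j hk hkj with h | h <;> rcases hiab with h' | h' <;> grind
    have hmax : TKMax r m i x := by
      refine ⟨hY, fun y hy => ?_⟩
      obtain ⟨j, hj⟩ := hdom y
      by_cases hji : j = i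
      · subst hji; exact hj x (Finset.mem_insert_self _ _)
      · exact absurd (hj _ (Finset.mem_insert_of_mem (hm j))) (not_le.mpr (hy j hji))
    rcases hiab with h | h
    · left; rw [← h]; exact hmax
    · right; rw [← h]; exact hmax
  · have main : ∀ a b : I, a ≠ b → m a = m b → TKMax r m a x → (x ∉ S ∧ TKDom r (insert x S)) := by
      intro a b hab hmab ⟨hY, hmax⟩
      have hxa : r a x ≤ r a (m a) := by
        obtain ⟨i, hi⟩ := hD x
        by_cases h : i = a
        · subst h; exact hi _ (hm i)
        · exact absurd (hi _ (hm i)) (not_le.mpr (hY i h))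
      refine ⟨fun hx => ?_, fun y => ?_⟩
      · have : x = m a := hr a (le_antisymm hxa (hmin a x hx))
        have h2 := hY b hab.symm
        rw [this, hmab] at h2
        exact lt_irrefl _ h2
      · by_cases hy : ∀ i, i ≠ a → r i (m i) < r i y
        · refine ⟨a, fun z hz => ?_⟩
          rcases Finset.mem_insert.mp hz with rfl | hz
          · exact hmax y hy
          · exact (hmax y hy).trans (hxa.trans (hmin a z hz))
        · push Not at hy
          obtain ⟨i, hia, hi⟩ := hy
          refine ⟨i, fun z hz => ?_⟩
          rcases Finset.mem_insert.mp hz with rfl | hz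
          · exact hi.trans (hY i hia).le
          · exact hi.trans (hmin i z hz)
    rintro (h | h)
    · exact main a b hab hmab h
    · exact main b a hab.symm hmab.symm h

theorem tk_max_unique {V I : Type*} (r : I → V → ℤ) (hr : ∀ i, Function.Injective (r i))
    (m : I → V) (a : I) (x y : V) (hx : TKMax r m a x) (hy : TKMax r m a y) : x = y :=
  hr a (le_antisymm (hy.2 x hx.1) (hx.2 y hy.1))

theorem tk_max_exists {V I : Type*} [Fintype V] (r : I → V → ℤ)
    (m : I → V) (a : I) (h : ∃ y, ∀ i, i ≠ a → r i (m i) < r i y) : ∃ x, TKMax r m a x := by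
  classical
  obtain ⟨y, hy⟩ := h
  obtain ⟨x, hx, hmax⟩ := (Finset.univ.filter fun y => ∀ i, i ≠ a → r i (m i) < r i y).exists_max_image
    (r a) ⟨y, by simpa using hy⟩
  exact ⟨x, by simpa using hx, fun z hz => hmax z (by simpa using hz)⟩

theorem tk_insert_of_card {V : Type*} [DecidableEq V] (S R : Finset V) (h : S ⊆ R)
    (hc : R.card = S.card + 1) : ∃ x, x ∉ S ∧ R = insert x S := by
  have h1 : (R \ S).card = 1 := by rw [Finset.card_sdiff_of_subset h]; omega
  obtain ⟨x, hx⟩ := Finset.card_eq_one.mp h1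
  have hx' : x ∈ R \ S := by rw [hx]; simp
  refine ⟨x, (Finset.mem_sdiff.mp hx').2, ?_⟩
  rw [Finset.insert_eq, ← hx, Finset.sdiff_union_of_subset h]

section
variable {V I : Type*} [Fintype V] [DecidableEq V] [Fintype I] [DecidableEq I]

open Classical in
theorem tk_inner_door (r : I → V → ℤ) (hr : ∀ i, Function.Injective (r i)) (s : I → V)
    (h2 : ∀ i j y, i ≠ j → (∀ k, s k ≠ y) → r i y < r i (s j))
    (S : Finset V) (hS : S.card + 1 = Fintype.card I) (hD : TKDom r S)
    (ht : ∃ t ∈ S, ∀ k, s k ≠ t) :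
    (Finset.univ.filter fun R : Finset V => (R.card = Fintype.card I ∧ TKDom r R) ∧ S ⊆ R).card = 2 := by
  obtain ⟨t, htS, htk⟩ := ht
  obtain ⟨m, a, b, hab, hm, hmin, hmab, hsurj, hpair⟩ := tk_door_structure r hr S ⟨t, htS⟩ hS hD
  have ex : ∀ a b : I, a ≠ b → m a = m b → ∃ x, TKMax r m a x := by
    intro a b hab hmab
    apply tk_max_exists
    refine ⟨s a, fun i hi => ?_⟩
    have := hmin i t htS
    exact this.trans_lt (h2 i a t hi htk)
  obtain ⟨x, hx⟩ := ex a b hab hmab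
  obtain ⟨y, hy⟩ := ex b a hab.symm hmab.symm
  have hiff := tk_room_iff r hr S hD m a b hab hm hmin hmab hpair
  have hxy : x ≠ y := by
    rintro rfl
    obtain ⟨i, hi⟩ := hD x
    have := hi _ (hm i)
    by_cases hia : i = a
    · have := hy.1 i (by rw [hia]; exact hab); omega
    · have := hx.1 i hia; omega
  have hxS := (hiff x).2 (Or.inl hx)
  have hyS := (hiff y).2 (Or.inr hy)
  have : (Finset.univ.filter fun R : Finset V => (R.card = Fintype.card I ∧ TKDom r R) ∧ S ⊆ R)
      = {insert x S, insert y S} := by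
    ext R
    simp only [Finset.mem_filter, Finset.mem_univ, true_and, Finset.mem_insert, Finset.mem_singleton]
    constructor
    · rintro ⟨⟨hc, hd⟩, hsub⟩
      obtain ⟨z, hz, rfl⟩ := tk_insert_of_card S R hsub (by omega)
      rcases (hiff z).1 ⟨hz, hd⟩ with h | h
      · left; rw [tk_max_unique r hr m a z x h hx]
      · right; rw [tk_max_unique r hr m b z y h hy]
    · rintro (rfl | rfl)
      · exact ⟨⟨by rw [Finset.card_insert_of_notMem hxS.1]; exact hS, hxS.2⟩, Finset.subset_insert _ _⟩
      · exact ⟨⟨by rw [Finset.card_insert_of_notMem hyS.1]; exact hS, hyS.2⟩, Finset.subset_insert _ _⟩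
  rw [this, Finset.card_pair]
  intro h
  have : x ∈ insert y S := h ▸ Finset.mem_insert_self x S
  rcases Finset.mem_insert.mp this with h | h
  · exact hxy h
  · exact hxS.1 h

open Classical in
theorem tk_outer_door (r : I → V → ℤ) (hr : ∀ i, Function.Injective (r i)) (s : I → V)
    (hs : Function.Injective s)
    (h1 : ∀ i y, r i (s i) ≤ r i y) (i0 : I)
    (S : Finset V) (hS : S = (Finset.univ.erase i0).image s) (hn : 2 ≤ Fintype.card I)
    (h2 : ∀ i j y, i ≠ j → (∀ k, s k ≠ y) → r i y < r i (s j)) :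
    (Finset.univ.filter fun R : Finset V => (R.card = Fintype.card I ∧ TKDom r R) ∧ S ⊆ R).card = 1 := by
  have hcard : S.card + 1 = Fintype.card I := by
    rw [hS, Finset.card_image_of_injective _ hs, Finset.card_erase_of_mem (Finset.mem_univ _),
      Finset.card_univ]; omega
  have hmemS : ∀ j, j ≠ i0 → s j ∈ S := fun j hj => by
    rw [hS]; exact Finset.mem_image_of_mem _ (by simpa using hj)
  have hmem' : ∀ y ∈ S, ∃ j, j ≠ i0 ∧ s j = y := by
    intro y hy; rw [hS] at hy; simpa using hy
  have hne : S.Nonempty := Finset.card_pos.mp (by omega)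
  have hD : TKDom r S := by
    intro y
    by_cases hy : ∃ j, s j = y
    · obtain ⟨j, rfl⟩ := hy
      exact ⟨j, fun x _ => h1 j x⟩
    · push Not at hy
      refine ⟨i0, fun x hx => ?_⟩
      obtain ⟨j, hj, rfl⟩ := hmem' x hx
      exact (h2 i0 j y hj.symm hy).le
  obtain ⟨m, a', b', hab', hm, hmin, hmab', hsurj, hpair'⟩ := tk_door_structure r hr S hne hcard hD
  have hmj : ∀ j, j ≠ i0 → m j = s j := fun j hj =>
    hr j (le_antisymm (hmin j _ (hmemS j hj)) (h1 j _))
  have : ∃ b, i0 ≠ b ∧ m i0 = m b ∧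
      (∀ i j, m i = m j → i ≠ j → (i = i0 ∧ j = b) ∨ (i = b ∧ j = i0)) := by
    by_cases ha : a' = i0
    · subst ha; exact ⟨b', hab', hmab', hpair'⟩
    by_cases hb : b' = i0
    · subst hb; exact ⟨a', hab'.symm, hmab'.symm, fun i j h h' => (hpair' i j h h').symm⟩
    · exfalso
      rw [hmj _ ha, hmj _ hb] at hmab'
      exact hab' (hs hmab')
  obtain ⟨b, hab, hmab, hpair⟩ := this
  have hiff := tk_room_iff r hr S hD m i0 b hab hm hmin hmab hpair
  obtain ⟨x, hx⟩ : ∃ x, TKMax r m i0 x := by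
    apply tk_max_exists
    refine ⟨s i0, fun i hi => ?_⟩
    rw [hmj i hi]
    exact lt_of_le_of_ne (h1 i _) (fun h => hi (hs (hr i h)))
  have hno : ∀ y, ¬ TKMax r m b y := by
    intro y hy
    have hyi := hy.1
    -- y beats m i0 = s b in order i0
    have e0 : m i0 = s b := by rw [hmab, hmj b hab.symm]
    have hy0 := hyi i0 hab
    rw [e0] at hy0
    by_cases hk : ∃ k, s k = y
    · obtain ⟨k, rfl⟩ := hk
      by_cases hkb : k = b
      · subst hkb; exact lt_irrefl _ hy0
      by_cases hk0 : k = i0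
      · subst hk0; exact absurd (h1 k (s b)) (not_le.mpr hy0)
      · have := hyi k hkb
        rw [hmj k hk0] at this
        exact lt_irrefl _ this
    · push Not at hk
      exact lt_asymm hy0 (h2 i0 b y hab hk)
  have hxS := (hiff x).2 (Or.inl hx)
  have : (Finset.univ.filter fun R : Finset V => (R.card = Fintype.card I ∧ TKDom r R) ∧ S ⊆ R)
      = {insert x S} := by
    ext R
    simp only [Finset.mem_filter, Finset.mem_univ, true_and, Finset.mem_singleton]
    constructor
    · rintro ⟨⟨hc, hd⟩, hsub⟩
      obtain ⟨z, hz, rfl⟩ := tk_insert_of_card S R hsub (by omega)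
      rcases (hiff z).1 ⟨hz, hd⟩ with h | h
      · rw [tk_max_unique r hr m i0 z x h hx]
      · exact absurd h (hno z)
    · rintro rfl
      exact ⟨⟨by rw [Finset.card_insert_of_notMem hxS.1]; exact hcard, hxS.2⟩, Finset.subset_insert _ _⟩
  rw [this, Finset.card_singleton]

/-- number of `i0`-facets of a non-colourful set is even -/
theorem tk_facets_even (c : V → I) (i0 : I) (R : Finset V) (hR : R.card = Fintype.card I)
    (hc : R.image c ≠ Finset.univ) :
    Even (Finset.univ.filter fun S : Finset V =>
      (S.card + 1 = Fintype.card I ∧ S.image c = Finset.univ.erase i0) ∧ S ⊆ R).card := by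
  by_cases hex : ∃ S : Finset V, (S.card + 1 = Fintype.card I ∧ S.image c = Finset.univ.erase i0) ∧ S ⊆ R
  swap
  · rw [Finset.filter_false_of_mem]
    · simp
    · intro S _ h; exact hex ⟨S, h⟩
  obtain ⟨S, ⟨hS, himg⟩, hsub⟩ := hex
  obtain ⟨x, hx, rfl⟩ := tk_insert_of_card S R hsub (by omega)
  have hinj : Set.InjOn c (S : Set V) := by
    apply Finset.card_image_iff.mp
    rw [himg, Finset.card_erase_of_mem (Finset.mem_univ _), Finset.card_univ]; omega
  have hcx : c x ≠ i0 := by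
    intro h
    apply hc
    rw [Finset.image_insert, himg, h, Finset.insert_erase (Finset.mem_univ _)]
  have : c x ∈ S.image c := by rw [himg]; simpa using hcx
  obtain ⟨y, hyS, hyx⟩ := Finset.mem_image.mp this
  have hyx' : y ≠ x := fun h => hx (h ▸ hyS)
  have himg2 : ((insert x S).erase y).image c = Finset.univ.erase i0 := by
    rw [← himg]
    ext k
    simp only [Finset.mem_image, Finset.mem_erase, Finset.mem_insert]
    constructor
    · rintro ⟨z, ⟨hzy, rfl | hz⟩, rfl⟩
      · exact ⟨y, hyS, hyx⟩
      · exact ⟨z, hz, rfl⟩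
    · rintro ⟨z, hz, rfl⟩
      by_cases hzy : z = y
      · subst hzy; exact ⟨x, ⟨hyx'.symm, Or.inl rfl⟩, hyx.symm⟩
      · exact ⟨z, ⟨hzy, Or.inr hz⟩, rfl⟩
  have hcard2 : ((insert x S).erase y).card + 1 = Fintype.card I := by
    rw [Finset.card_erase_of_mem (Finset.mem_insert_of_mem hyS), hR]; omega
  have : (Finset.univ.filter fun S' : Finset V =>
      (S'.card + 1 = Fintype.card I ∧ S'.image c = Finset.univ.erase i0) ∧ S' ⊆ insert x S)
      = {S, (insert x S).erase y} := by
    ext S'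
    simp only [Finset.mem_filter, Finset.mem_univ, true_and, Finset.mem_insert, Finset.mem_singleton]
    constructor
    · rintro ⟨⟨hc', hi'⟩, hsub'⟩
      obtain ⟨z, hz, hins⟩ := tk_insert_of_card S' _ hsub' (by omega)
      have hS' : S' = (insert x S).erase z := by rw [hins, Finset.erase_insert hz]
      have hzm : z ∈ insert x S := by rw [hins]; exact Finset.mem_insert_self _ _
      rcases Finset.mem_insert.mp hzm with rfl | hzS
      · left; rw [hS', Finset.erase_insert hx]
      · right
        have hcz : c z ∈ S'.image c := by
          rw [hi', ← himg]; exact Finset.mem_image_of_mem _ hzS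
        obtain ⟨w, hw, hwz⟩ := Finset.mem_image.mp hcz
        rw [hS'] at hw
        obtain ⟨hwz', hw⟩ := Finset.mem_erase.mp hw
        rcases Finset.mem_insert.mp hw with rfl | hwS
        · have : y = z := hinj hyS hzS (hyx.trans hwz)
          rw [hS', this]
        · exact absurd (hinj hwS hzS hwz) hwz'
    · rintro (rfl | rfl)
      · exact ⟨⟨hS, himg⟩, hsub⟩
      · exact ⟨⟨hcard2, himg2⟩, Finset.erase_subset _ _⟩
  rw [this, Finset.card_pair]
  · exact even_two
  · intro h
    have : y ∈ (insert x S).erase y := h ▸ hyS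
    simp at this

open Classical in
theorem tk_scarf (r : I → V → ℤ) (hr : ∀ i, Function.Injective (r i)) (s : I → V)
    (hs : Function.Injective s) (h1 : ∀ i y, r i (s i) ≤ r i y)
    (h2 : ∀ i j y, i ≠ j → (∀ k, s k ≠ y) → r i y < r i (s j))
    (hn : 2 ≤ Fintype.card I) (c : V → I) (hcs : ∀ i, c (s i) = i) :
    ∃ R : Finset V, R.card = Fintype.card I ∧ TKDom r R ∧ R.image c = Finset.univ := by
  by_contra hcon
  push Not at hcon
  have : Nonempty I := Fintype.card_pos_iff.mp (by omega)
  obtain ⟨i0⟩ := this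
  let rooms := Finset.univ.filter fun R : Finset V => R.card = Fintype.card I ∧ TKDom r R
  let doors := Finset.univ.filter fun S : Finset V =>
    (S.card + 1 = Fintype.card I ∧ S.image c = Finset.univ.erase i0) ∧ TKDom r S
  have hdc := Finset.sum_card_bipartiteAbove_eq_sum_card_bipartiteBelow (s := doors) (t := rooms)
    (fun S R => S ⊆ R)
  have heven : Even (∑ R ∈ rooms, (Finset.bipartiteBelow (fun S R : Finset V => S ⊆ R) doors R).card) := by
    apply Finset.even_sum
    intro R hR
    obtain ⟨hRc, hRd⟩ := (Finset.mem_filter.mp hR).2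
    have := tk_facets_even c i0 R hRc (hcon R hRc hRd)
    refine (congrArg (fun F : Finset (Finset V) => Even F.card) ?_).mpr this
    ext S
    simp only [Finset.bipartiteBelow, doors, Finset.mem_filter, Finset.mem_univ, true_and]
    constructor
    · rintro ⟨⟨h, _⟩, h'⟩; exact ⟨h, h'⟩
    · rintro ⟨h, h'⟩
      exact ⟨⟨h, fun y => (hRd y).imp fun i hi x hx => hi x (h' hx)⟩, h'⟩
  rw [← hdc] at heven
  let D0 := (Finset.univ.erase i0).image s
  have hab : ∀ S, (Finset.bipartiteAbove (fun S R : Finset V => S ⊆ R) rooms S) =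
      (Finset.univ.filter fun R : Finset V => (R.card = Fintype.card I ∧ TKDom r R) ∧ S ⊆ R) := by
    intro S; ext R; simp [Finset.bipartiteAbove, rooms]
  have hD0 : D0 ∈ doors := by
    simp only [doors, Finset.mem_filter, Finset.mem_univ, true_and]
    refine ⟨⟨?_, ?_⟩, ?_⟩
    · rw [Finset.card_image_of_injective _ hs, Finset.card_erase_of_mem (Finset.mem_univ _),
        Finset.card_univ]; omega
    · rw [Finset.image_image]
      have : c ∘ s = id := funext hcs
      rw [this, Finset.image_id]
    · have h := tk_outer_door r hr s hs h1 i0 D0 rfl hn h2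
      obtain ⟨R, hR⟩ := Finset.card_pos.mp (by rw [h]; exact one_pos)
      obtain ⟨⟨_, hd⟩, hsub⟩ := (Finset.mem_filter.mp hR).2
      exact fun y => (hd y).imp fun i hi x hx => hi x (hsub hx)
  rw [← Finset.add_sum_erase _ _ hD0, hab, tk_outer_door r hr s hs h1 i0 D0 rfl hn h2] at heven
  have heven2 : Even (∑ S ∈ doors.erase D0,
      (Finset.bipartiteAbove (fun S R : Finset V => S ⊆ R) rooms S).card) := by
    apply Finset.even_sum
    intro S hS
    obtain ⟨hne, hS⟩ := Finset.mem_erase.mp hS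
    obtain ⟨⟨hSc, hSi⟩, hSd⟩ := (Finset.mem_filter.mp hS).2
    rw [hab, tk_inner_door r hr s h2 S hSc hSd]
    · exact even_two
    · by_contra hno
      push Not at hno
      apply hne
      apply Finset.eq_of_subset_of_card_le
      · intro t ht
        obtain ⟨k, rfl⟩ := hno t ht
        have : c (s k) ∈ S.image c := Finset.mem_image_of_mem _ ht
        rw [hSi, hcs] at this
        exact Finset.mem_image_of_mem _ this
      · simp only [D0]
        rw [Finset.card_image_of_injective _ hs, Finset.card_erase_of_mem (Finset.mem_univ _),
          Finset.card_univ]; omega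
  grind
end

theorem tk_grid (n N : ℕ) (hn : 2 ≤ n) (c : (Fin n → ℕ) → Fin n) :
    ∃ x0 : Fin n → ℕ, ∑ i, x0 i = N ∧ ∀ i, x0 i ≤ n ∨
      ∃ x : Fin n → ℕ, ∑ i, x i = N ∧ c x = i ∧ ∀ j, x j ≤ x0 j + n ∧ x0 j ≤ x j + n := by
  classical
  let T := {x : Fin n → ℕ // x ∈ Finset.piAntidiag (Finset.univ : Finset (Fin n)) N}
  have hT : ∀ t : T, ∑ i, t.1 i = N := fun t => (Finset.mem_piAntidiag.mp t.2).1
  have mkT : ∀ x : Fin n → ℕ, ∑ i, x i = N → x ∈ Finset.piAntidiag (Finset.univ : Finset (Fin n)) N :=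
    fun x hx => Finset.mem_piAntidiag.mpr ⟨hx, fun i _ => Finset.mem_univ i⟩
  have hle : ∀ (t : T) i, t.1 i ≤ N := fun t i => by
    refine le_of_le_of_eq ?_ (hT t)
    exact Finset.single_le_sum (f := t.1) (fun _ _ => Nat.zero_le _) (Finset.mem_univ i)
  let M := Fintype.card T
  let e : T ≃ Fin M := Fintype.equivFin T
  have heM : ∀ t, ((e t : ℕ) : ℤ) < M := fun t => by exact_mod_cast (e t).2
  have he0 : ∀ t, (0 : ℤ) ≤ ((e t : ℕ) : ℤ) := fun t => by positivity
  let r : Fin n → T ⊕ Fin n → ℤ := fun i v => match v with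
    | Sum.inl t => (t.1 i : ℤ) * M + (e t : ℕ)
    | Sum.inr j => if j = i then -1 else ((N : ℤ) + 1) * M + (j : ℕ)
  have rl : ∀ i t, r i (Sum.inl t) = (t.1 i : ℤ) * M + (e t : ℕ) := fun _ _ => rfl
  have rr : ∀ i j, r i (Sum.inr j) = if j = i then -1 else ((N : ℤ) + 1) * M + (j : ℕ) := fun _ _ => rfl
  have rcmp : ∀ i (t t' : T), r i (Sum.inl t) ≤ r i (Sum.inl t') → t.1 i ≤ t'.1 i := by
    intro i t t' h
    rw [rl, rl] at h
    by_contra hlt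
    push Not at hlt
    have h3 : ((t'.1 i : ℤ) + 1) * M ≤ (t.1 i : ℤ) * M := by
      apply mul_le_mul_of_nonneg_right _ (by positivity)
      exact_mod_cast hlt
    have := heM t'
    have := he0 t
    linarith
  have rub : ∀ i (t : T), r i (Sum.inl t) < ((N : ℤ) + 1) * M := by
    intro i t
    rw [rl]
    have h3 : (t.1 i : ℤ) * M ≤ (N : ℤ) * M := by
      apply mul_le_mul_of_nonneg_right _ (by positivity)
      exact_mod_cast hle t i
    have := heM t
    linarith
  have rlb : ∀ i (t : T), 0 ≤ r i (Sum.inl t) := by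
    intro i t; rw [rl]; positivity
  have hinj : ∀ i, Function.Injective (r i) := by
    intro i v w h
    rcases v with t | j <;> rcases w with t' | j'
    · have hi : t.1 i = t'.1 i := le_antisymm (rcmp i t t' h.le) (rcmp i t' t h.ge)
      rw [rl, rl, hi] at h
      have : (e t : ℕ) = (e t' : ℕ) := by
        have := add_left_cancel h
        exact_mod_cast this
      rw [e.injective (Fin.ext this)]
    · exfalso
      have a1 := rub i t
      have a2 := rlb i t
      rw [h, rr] at a1 a2
      split_ifs at a1 a2 <;> omega
    · exfalso
      have a1 := rub i t'
      have a2 := rlb i t'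
      rw [← h, rr] at a1 a2
      split_ifs at a1 a2 <;> omega
    · have hM : (0 : ℤ) ≤ ((N : ℤ) + 1) * M := by positivity
      rw [rr, rr] at h
      split_ifs at h with h1 h2 h2
      · rw [h1, h2]
      · omega
      · omega
      · congr 1; apply Fin.ext; omega
  let c' : T ⊕ Fin n → Fin n := fun v => match v with
    | Sum.inl t => c t.1
    | Sum.inr j => j
  obtain ⟨R, hRc, hRd, hRi⟩ := tk_scarf r hinj Sum.inr Sum.inr_injective
    (by
      intro i y
      have hM : (0 : ℤ) ≤ ((N : ℤ) + 1) * M := by positivity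
      rw [rr, if_pos rfl]
      rcases y with t | j
      · have := rlb i t; omega
      · rw [rr]; split_ifs <;> omega)
    (by
      intro i j y hij hy
      rcases y with t | k
      · rw [rr, if_neg (Ne.symm hij)]
        have := rub i t
        omega
      · exact absurd rfl (hy k))
    (by simpa using hn) c' (fun i => rfl)
  have hcol : ∀ i, Sum.inr i ∈ R ∨ ∃ t : T, Sum.inl t ∈ R ∧ c t.1 = i := by
    intro i
    have : i ∈ R.image c' := by rw [hRi]; exact Finset.mem_univ i
    obtain ⟨v, hv, hvi⟩ := Finset.mem_image.mp this
    rcases v with t | j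
    · exact Or.inr ⟨t, hv, hvi⟩
    · left; have : j = i := hvi
      rw [← this]; exact hv
  have hdomC : ∀ t : T, ∃ i, Sum.inr i ∉ R ∧ ∀ t' : T, Sum.inl t' ∈ R → t.1 i ≤ t'.1 i := by
    intro t
    obtain ⟨i, hi⟩ := hRd (Sum.inl t)
    refine ⟨i, fun h => ?_, fun t' ht' => rcmp i t t' (hi _ ht')⟩
    have a1 := hi _ h
    have a2 := rlb i t
    rw [rr, if_pos rfl] at a1
    omega
  let C : Finset (Fin n) := Finset.univ.filter fun i => Sum.inr i ∉ R
  have memC : ∀ i, i ∈ C ↔ Sum.inr i ∉ R := fun i => by simp [C]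
  obtain ⟨k, hkC⟩ : ∃ k, Sum.inr k ∉ R := by
    have t0 : T := ⟨Pi.single ⟨0, by omega⟩ N, mkT _ (by simp)⟩
    obtain ⟨i, hi, _⟩ := hdomC t0
    exact ⟨i, hi⟩
  obtain ⟨x0, hx0, _⟩ := (hcol k).resolve_left hkC
  have hmin : ∀ i, ∃ t : T, Sum.inl t ∈ R ∧ ∀ t' : T, Sum.inl t' ∈ R → t.1 i ≤ t'.1 i := by
    intro i
    obtain ⟨t, ht, hm⟩ := (Finset.univ.filter fun t : T => Sum.inl t ∈ R).exists_min_image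
      (fun t => t.1 i) ⟨x0, by simpa using hx0⟩
    exact ⟨t, by simpa using ht, fun t' ht' => hm t' (by simpa using ht')⟩
  choose m hmR hmm using hmin
  have hsum : N < ∑ i ∈ C, ((m i).1 i + 1) := by
    by_contra hcon
    push Not at hcon
    let y : Fin n → ℕ := fun i => (if i ∈ C then (m i).1 i + 1 else 0) +
      (if i = k then N - ∑ i ∈ C, ((m i).1 i + 1) else 0)
    have hy : ∑ i, y i = N := by
      simp only [y, Finset.sum_add_distrib, Finset.sum_ite_eq', Finset.mem_univ, if_true]
      rw [Finset.sum_ite_mem, Finset.univ_inter, ← Finset.sum_add_distrib]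
      omega
    obtain ⟨i, hi, hle'⟩ := hdomC ⟨y, mkT y hy⟩
    have h3 := hle' _ (hmR i)
    have h4 : y i ≥ (m i).1 i + 1 := by
      simp only [y, if_pos ((memC i).2 hi)]; omega
    have h5 : y i ≤ (m i).1 i := h3
    omega
  have hCn : C.card ≤ n := by simpa using Finset.card_le_univ C
  rw [Finset.sum_add_distrib, Finset.sum_const, smul_eq_mul, mul_one] at hsum
  have hCge : ∀ t : T, Sum.inl t ∈ R → ∀ i, (m i).1 i ≤ t.1 i := fun t ht i => hmm i t ht
  have hCsum : ∀ t : T, ∑ i ∈ C, t.1 i + ∑ i ∈ Cᶜ, t.1 i = N := fun t => by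
    rw [Finset.sum_add_sum_compl, hT]
  have hout : ∀ t : T, Sum.inl t ∈ R → ∀ i, i ∉ C → t.1 i ≤ n := by
    intro t ht i hi
    have a1 : t.1 i ≤ ∑ i ∈ Cᶜ, t.1 i :=
      Finset.single_le_sum (f := t.1) (fun _ _ => Nat.zero_le _) (by simpa using hi)
    have a2 : ∑ i ∈ C, (m i).1 i ≤ ∑ i ∈ C, t.1 i := Finset.sum_le_sum fun i _ => hCge t ht i
    have := hCsum t
    omega
  have hin : ∀ t : T, Sum.inl t ∈ R → ∀ i ∈ C, t.1 i ≤ (m i).1 i + n := by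
    intro t ht i hi
    have a2 : ∑ i ∈ C.erase i, (m i).1 i ≤ ∑ i ∈ C.erase i, t.1 i :=
      Finset.sum_le_sum fun i _ => hCge t ht i
    have b1 := Finset.add_sum_erase C (fun i => (m i).1 i) hi
    have b2 := Finset.add_sum_erase C t.1 hi
    have := hCsum t
    omega
  have hclose : ∀ t t' : T, Sum.inl t ∈ R → Sum.inl t' ∈ R → ∀ j, t.1 j ≤ t'.1 j + n := by
    intro t t' ht ht' j
    by_cases hj : j ∈ C
    · have := hin t ht j hj
      have := hCge t' ht' j
      omega
    · have := hout t ht j hj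
      omega
  refine ⟨x0.1, hT x0, fun i => ?_⟩
  by_cases hi : i ∈ C
  · right
    obtain ⟨t, ht, hct⟩ := (hcol i).resolve_left ((memC i).1 hi)
    exact ⟨t.1, hT t, hct, fun j => ⟨hclose t x0 ht hx0 j, hclose x0 t hx0 ht j⟩⟩
  · left; exact hout x0 hx0 i hi

theorem tk_balanced (n : ℕ) (hn : 2 ≤ n) (y : (Fin n → ℝ) → Fin n → ℝ)
    (hc : ∀ i, Continuous (fun x => y x i))
    (h0 : ∀ x ∈ stdSimplex ℝ (Fin n), ∀ i, 0 ≤ y x i)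
    (hz : ∀ x ∈ stdSimplex ℝ (Fin n), ∀ i, x i = 0 → y x i = 0) :
    ∃ x ∈ stdSimplex ℝ (Fin n), ∀ i j, y x i = y x j := by
  have hnR : (0 : ℝ) < n := by positivity
  have hne : (Finset.univ : Finset (Fin n)).Nonempty := ⟨⟨0, by omega⟩, Finset.mem_univ _⟩
  let mn : (Fin n → ℝ) → ℝ := fun x => Finset.univ.inf' hne (fun i => y x i)
  have hmnc : Continuous mn := Continuous.finset_inf'_apply hne (fun i _ => hc i)
  have hmn : ∀ x i, mn x ≤ y x i := fun x i => Finset.inf'_le _ (Finset.mem_univ i)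
  let g : Fin n → (Fin n → ℝ) → ℝ := fun i x => y x i - mn x
  have hg : ∀ i, Continuous (g i) := fun i => (hc i).sub hmnc
  have hg0 : ∀ i x, 0 ≤ g i x := fun i x => sub_nonneg.mpr (hmn x i)
  let h : (Fin n → ℝ) → ℝ := fun x => ∑ i, min (x i) (g i x)
  have hh : Continuous h := by
    apply continuous_finsetSum
    intro i _
    exact (continuous_apply i).min (hg i)
  have hcpt : IsCompact (stdSimplex ℝ (Fin n)) := isCompact_stdSimplex ℝ (Fin n)
  have hnes : (stdSimplex ℝ (Fin n)).Nonempty := ⟨_, single_mem_stdSimplex ℝ (⟨0, by omega⟩ : Fin n)⟩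
  obtain ⟨x, hx, hxmin⟩ := hcpt.exists_isMinOn hnes hh.continuousOn
  by_cases hpos : h x ≤ 0
  · refine ⟨x, hx, ?_⟩
    have hterm : ∀ i, min (x i) (g i x) = 0 := by
      have hnn : ∀ i ∈ Finset.univ, 0 ≤ min (x i) (g i x) := fun i _ => le_min (hx.1 i) (hg0 i x)
      have := (Finset.sum_eq_zero_iff_of_nonneg hnn).mp
        (le_antisymm hpos (Finset.sum_nonneg hnn))
      exact fun i => this i (Finset.mem_univ i)
    have hmn0 : 0 ≤ mn x := Finset.le_inf' _ _ fun i _ => h0 x hx i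
    have hall : ∀ i, y x i = mn x := by
      intro i
      rcases min_choice (x i) (g i x) with h1 | h1
      · have : x i = 0 := by rw [← h1]; exact hterm i
        have := hz x hx i this
        have := hmn x i
        linarith
      · have : g i x = 0 := by rw [← h1]; exact hterm i
        simp only [g] at this
        linarith
    intro i j; rw [hall, hall]
  · exfalso
    push Not at hpos
    set δ := h x / n with hδ
    have hδ0 : 0 < δ := by positivity
    have huc : ∀ i, ∃ η > 0, ∀ a ∈ stdSimplex ℝ (Fin n), ∀ b ∈ stdSimplex ℝ (Fin n),
        dist a b < η → dist (g i a) (g i b) < δ := fun i =>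
      Metric.uniformContinuousOn_iff.mp
        (hcpt.uniformContinuousOn_of_continuous (hg i).continuousOn) δ hδ0
    choose η hη huc using huc
    obtain ⟨i1, -, hi1⟩ := Finset.exists_min_image Finset.univ η hne
    set ε := min (η i1) δ with hε
    have hε0 : 0 < ε := lt_min (hη i1) hδ0
    obtain ⟨N, hN⟩ := exists_nat_gt ((n : ℝ) / ε)
    have hN0 : (0 : ℝ) < N := lt_trans (by positivity) hN
    have hnN : (n : ℝ) / N < ε := by
      rw [div_lt_iff₀ hN0]; rw [div_lt_iff₀ hε0] at hN; linarith
    have hmem : ∀ x : Fin n → ℕ, ∑ i, x i = N → (fun i => (x i : ℝ) / N) ∈ stdSimplex ℝ (Fin n) := by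
      intro x hx
      refine ⟨fun i => by positivity, ?_⟩
      rw [← Finset.sum_div, ← Nat.cast_sum, hx, div_self hN0.ne']
    have hlab : ∀ x : Fin n → ℝ, ∃ i, g i x = 0 := by
      intro x
      obtain ⟨i, -, hi⟩ := Finset.exists_mem_eq_inf' hne (fun i => y x i)
      exact ⟨i, by simp only [g, mn]; rw [hi]; ring⟩
    choose lab hlab using hlab
    obtain ⟨x0, hx0, hx0'⟩ := tk_grid n N hn (fun x => lab (fun i => (x i : ℝ) / N))
    have hlt : h (fun i => (x0 i : ℝ) / N) < h x := by
      have : ∑ _i : Fin n, δ = h x := by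
        simp [hδ]; field_simp
      rw [← this]
      apply Finset.sum_lt_sum_of_nonempty hne
      intro i _
      rcases hx0' i with h1 | ⟨z, hz1, hz2, hz3⟩
      · refine min_lt_iff.mpr (Or.inl ?_)
        calc (x0 i : ℝ) / N ≤ (n : ℝ) / N := by gcongr
          _ < ε := hnN
          _ ≤ δ := min_le_right _ _
      · refine min_lt_iff.mpr (Or.inr ?_)
        have hd : dist (fun i => (x0 i : ℝ) / N) (fun i => (z i : ℝ) / N) < η i := by
          refine lt_of_le_of_lt ?_ (hnN.trans_le ((min_le_left _ _).trans (hi1 i (Finset.mem_univ i))))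
          rw [dist_pi_le_iff (by positivity)]
          intro j
          rw [Real.dist_eq, ← sub_div, abs_div, abs_of_pos hN0]
          gcongr
          obtain ⟨h4, h5⟩ := hz3 j
          have h4' : (z j : ℝ) ≤ x0 j + n := by exact_mod_cast h4
          have h5' : (x0 j : ℝ) ≤ z j + n := by exact_mod_cast h5
          rw [abs_le]; constructor <;> linarith
        have h6 := huc i _ (hmem x0 hx0) _ (hmem z hz1) hd
        have h7 := hlab (fun i => (z i : ℝ) / N)
        rw [show lab (fun i => (z i : ℝ) / N) = i from hz2] at h7
        rw [h7, Real.dist_eq, sub_zero] at h6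
        exact lt_of_abs_lt h6
    exact absurd (hxmin (hmem x0 hx0)) (not_le.mpr hlt)

theorem tk_exists_kernel {E W : Type*} [Fintype E] [DecidableEq E] [DecidableEq W] (e : E → Finset W) (H : Finset E)
    (T : Finset W) (hlt : T.card < H.card) :
    ∃ u : E → ℝ, u ≠ 0 ∧ (∀ x, x ∉ H → u x = 0) ∧
      ∀ v ∈ T, ∑ x, (if v ∈ e x then u x else 0) = 0 := by
  classical
  let ext : (H → ℝ) →ₗ[ℝ] (E → ℝ) :=
    { toFun := fun u x => if h : x ∈ H then u ⟨x, h⟩ else 0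
      map_add' := by intro a b; ext x; by_cases h : x ∈ H <;> simp [h]
      map_smul' := by intro a b; ext x; by_cases h : x ∈ H <;> simp [h] }
  let f : (E → ℝ) →ₗ[ℝ] (T → ℝ) :=
    { toFun := fun u v => ∑ x, (if v.1 ∈ e x then u x else 0)
      map_add' := by
        intro a b; ext v
        simp only [Pi.add_apply]
        rw [← Finset.sum_add_distrib]
        apply Finset.sum_congr rfl; intro x _; split_ifs <;> simp
      map_smul' := by
        intro a b; ext v
        simp only [Pi.smul_apply, smul_eq_mul, RingHom.id_apply]
        rw [Finset.mul_sum]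
        apply Finset.sum_congr rfl; intro x _; split_ifs <;> simp }
  have hker : LinearMap.ker (f ∘ₗ ext) ≠ ⊥ := by
    apply LinearMap.ker_ne_bot_of_finrank_lt
    simpa using hlt
  obtain ⟨u, hu, hu0⟩ := (Submodule.ne_bot_iff _).mp hker
  refine ⟨ext u, ?_, ?_, ?_⟩
  · intro h
    apply hu0
    ext x
    have := congrFun h x.1
    simpa [ext] using this
  · intro x hx
    simp [ext, hx]
  · intro v hv
    have := congrFun (LinearMap.mem_ker.mp hu) ⟨v, hv⟩
    simpa [f] using this

def TKFrac {E W : Type*} [Fintype E] [DecidableEq W] (e : E → Finset W) (H : Finset E) :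
    Set (E → ℝ) :=
  {w | (∀ x, 0 ≤ w x) ∧ (∀ x, x ∉ H → w x = 0) ∧ ∀ v, ∑ x, (if v ∈ e x then w x else 0) ≤ 1}

theorem tk_frac_compact {E W : Type*} [Fintype E] [DecidableEq W] (e : E → Finset W)
    (hne : ∀ x, (e x).Nonempty) (H : Finset E) : IsCompact (TKFrac e H) := by
  classical
  have hsub : TKFrac e H ⊆ Set.Icc 0 1 := by
    rintro w ⟨h0, -, h1⟩
    refine ⟨h0, fun x => ?_⟩
    obtain ⟨v, hv⟩ := hne x
    refine le_trans ?_ (h1 v)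
    have := Finset.single_le_sum (f := fun x => if v ∈ e x then w x else 0) (s := Finset.univ)
      (fun y _ => by split_ifs <;> simp [h0]) (Finset.mem_univ x)
    simpa [hv] using this
  refine isCompact_Icc.of_isClosed_subset ?_ hsub
  have e1 : TKFrac e H = (⋂ x, {w | 0 ≤ w x}) ∩ (⋂ x, ⋂ (_ : x ∉ H), {w | w x = 0}) ∩
      ⋂ v, {w | ∑ x, (if v ∈ e x then w x else 0) ≤ 1} := by
    ext w; simp [TKFrac, and_assoc]
  rw [e1]
  refine ((isClosed_iInter fun x => ?_).inter (isClosed_iInter fun x => isClosed_iInter fun _ => ?_)).inter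
    (isClosed_iInter fun v => ?_)
  · exact isClosed_le continuous_const (continuous_apply x)
  · exact isClosed_eq (continuous_apply x) continuous_const
  · refine isClosed_le (continuous_finsetSum _ fun x _ => ?_) continuous_const
    split_ifs
    · exact continuous_apply x
    · exact continuous_const

/-- an extreme optimal fractional matching with full support has an edge of weight at least `1/d`. -/
theorem tk_heavy_edge {E W : Type*} [Fintype E] [Fintype W] [DecidableEq W] (d : ℕ) (hd : 1 ≤ d)
    (e : E → Finset W) (hcard : ∀ x, (e x).card ≤ d) (H : Finset E) (hH : H.Nonempty)
    (w : E → ℝ) (hw : w ∈ TKFrac e H)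
    (hext : ∀ u : E → ℝ, u ≠ 0 → ¬ (w + u ∈ TKFrac e H ∧ w - u ∈ TKFrac e H))
    (hpos : ∀ x ∈ H, 0 < w x) : ∃ x ∈ H, 1 ≤ d * w x := by
  classical
  by_contra hcon
  push Not at hcon
  obtain ⟨h0, hs, h1⟩ := hw
  let T : Finset W := Finset.univ.filter fun v => ∑ x, (if v ∈ e x then w x else 0) = 1
  have hdeg : ∀ v ∈ T, d + 1 ≤ (H.filter fun x => v ∈ e x).card := by
    intro v hv
    have hv1 : ∑ x, (if v ∈ e x then w x else 0) = 1 := by simpa [T] using hv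
    have e2 : ∑ x, (if v ∈ e x then w x else 0) = ∑ x ∈ H.filter (fun x => v ∈ e x), w x := by
      rw [← Finset.sum_filter]
      symm
      apply Finset.sum_subset
      · intro x hx; simp at hx ⊢; exact hx.2
      · intro x hx hx'
        apply hs
        simp at hx hx'
        tauto
    rw [e2] at hv1
    by_contra hlt
    push Not at hlt
    have hne : (H.filter fun x => v ∈ e x).Nonempty := by
      by_contra hemp
      rw [Finset.not_nonempty_iff_eq_empty] at hemp
      rw [hemp] at hv1; simp at hv1
    have : ∑ x ∈ H.filter (fun x => v ∈ e x), (d : ℝ) * w x < ∑ x ∈ H.filter (fun x => v ∈ e x), 1 :=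
      Finset.sum_lt_sum_of_nonempty hne fun x hx => hcon x (Finset.mem_filter.mp hx).1
    rw [← Finset.mul_sum, hv1] at this
    simp only [Finset.sum_const, nsmul_eq_mul, mul_one] at this
    have : d < (H.filter fun x => v ∈ e x).card := by exact_mod_cast this
    omega
  have hTH : T.card < H.card := by
    have hdc := Finset.sum_card_bipartiteAbove_eq_sum_card_bipartiteBelow (s := T) (t := H)
      (fun v x => v ∈ e x)
    have a1 : T.card * (d + 1) ≤ ∑ v ∈ T, (Finset.bipartiteAbove (fun v x => v ∈ e x) H v).card := by
      rw [← smul_eq_mul]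
      exact Finset.card_nsmul_le_sum _ _ _ hdeg
    have a2 : ∑ x ∈ H, (Finset.bipartiteBelow (fun v x => v ∈ e x) T x).card ≤ H.card * d := by
      rw [← smul_eq_mul]
      apply Finset.sum_le_card_nsmul
      intro x _
      refine le_trans (Finset.card_le_card ?_) (hcard x)
      intro v hv
      simp [Finset.bipartiteBelow] at hv; exact hv.2
    have hHp : 0 < H.card := Finset.card_pos.mpr hH
    by_contra hle
    push Not at hle
    have : H.card * (d + 1) ≤ T.card * (d + 1) := Nat.mul_le_mul_right _ hle
    rw [hdc] at a1
    nlinarith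
  obtain ⟨u, hu0, hus, huT⟩ := tk_exists_kernel e H T hTH
  let φ : ℝ → E → ℝ := fun t x => w x + t * u x
  have hev : ∀ᶠ t in nhds (0 : ℝ), φ t ∈ TKFrac e H := by
    have b1 : ∀ᶠ t in nhds (0 : ℝ), ∀ x, 0 ≤ φ t x := by
      rw [Filter.eventually_all]
      intro x
      by_cases hx : x ∈ H
      · have hc : Continuous fun t : ℝ => φ t x := by fun_prop
        have : ∀ᶠ t in nhds (0 : ℝ), 0 < φ t x :=
          hc.continuousAt.eventually_const_lt (by simpa [φ] using hpos x hx)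
        exact this.mono fun t ht => ht.le
      · refine Filter.Eventually.of_forall fun t => ?_
        simp [φ, hs x hx, hus x hx]
    have b2 : ∀ᶠ t in nhds (0 : ℝ), ∀ v, ∑ x, (if v ∈ e x then φ t x else 0) ≤ 1 := by
      rw [Filter.eventually_all]
      intro v
      have hsplit : ∀ t, ∑ x, (if v ∈ e x then φ t x else 0) =
          ∑ x, (if v ∈ e x then w x else 0) + t * ∑ x, (if v ∈ e x then u x else 0) := by
        intro t
        rw [Finset.mul_sum, ← Finset.sum_add_distrib]
        apply Finset.sum_congr rfl
        intro x _
        split_ifs <;> simp [φ]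
      by_cases hv : v ∈ T
      · refine Filter.Eventually.of_forall fun t => ?_
        rw [hsplit, huT v hv, mul_zero, add_zero]; exact h1 v
      · have hlt : ∑ x, (if v ∈ e x then w x else 0) < 1 :=
          lt_of_le_of_ne (h1 v) (by simpa [T] using hv)
        have hc : Continuous fun t : ℝ => ∑ x, (if v ∈ e x then φ t x else 0) := by
          simp only [hsplit]; fun_prop
        have : ∀ᶠ t in nhds (0 : ℝ), ∑ x, (if v ∈ e x then φ t x else 0) < 1 :=
          hc.continuousAt.eventually_lt_const (by simpa [φ] using hlt)
        exact this.mono fun t ht => ht.le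
    filter_upwards [b1, b2] with t ht1 ht2
    exact ⟨ht1, fun x hx => by simp [φ, hs x hx, hus x hx], ht2⟩
  obtain ⟨ε, hε, hball⟩ := Metric.eventually_nhds_iff.mp hev
  refine hext ((ε / 2) • u) (smul_ne_zero (by positivity) hu0) ⟨?_, ?_⟩
  · have := @hball (ε / 2) (by rw [Real.dist_eq, sub_zero, abs_of_pos] <;> linarith)
    convert this using 1
    ext x; simp [φ]
  · have := @hball (-(ε / 2)) (by rw [Real.dist_eq, sub_zero, abs_neg, abs_of_pos] <;> linarith)
    convert this using 1
    ext x; simp [φ]; ring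

theorem tk_frac_restrict {E W : Type*} [Fintype E] [DecidableEq E] [DecidableEq W] (e : E → Finset W)
    (H H' : Finset E) (w : E → ℝ) (hw : w ∈ TKFrac e H) :
    (fun x => if x ∈ H' then w x else 0) ∈ TKFrac e H' := by
  obtain ⟨h0, hs, h1⟩ := hw
  refine ⟨fun x => by simp only; split_ifs <;> simp [h0], fun x hx => by simp [hx], fun v => ?_⟩
  refine le_trans (Finset.sum_le_sum fun x _ => ?_) (h1 v)
  simp only
  split_ifs <;> simp [h0]

theorem tk_furedi {E W : Type*} [Fintype E] [DecidableEq E] [Fintype W] [DecidableEq W] (d : ℕ) (hd : 1 ≤ d)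
    (e : E → Finset W) (hne : ∀ x, (e x).Nonempty) (hcard : ∀ x, (e x).card ≤ d) (H : Finset E) :
    ∀ w ∈ TKFrac e H, ∃ M ⊆ H, (∀ x ∈ M, ∀ y ∈ M, x ≠ y → Disjoint (e x) (e y)) ∧
      (d : ℝ) * ∑ x, w x ≤ ((d : ℝ) ^ 2 - d + 1) * M.card := by
  induction H using Finset.strongInduction with
  | H H ih =>
  intro w0 hw0
  rcases H.eq_empty_or_nonempty with rfl | hH
  · refine ⟨∅, by simp, by simp, ?_⟩
    have : ∀ x, w0 x = 0 := fun x => hw0.2.1 x (by simp)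
    simp [this]
  have hcpt := tk_frac_compact e hne H
  let σ : (E → ℝ) → ℝ := fun w => ∑ x, w x
  have hσ : Continuous σ := continuous_finsetSum _ fun x _ => continuous_apply x
  obtain ⟨w1, hw1, hw1max⟩ := hcpt.exists_isMaxOn ⟨w0, hw0⟩ hσ.continuousOn
  have hcptA : IsCompact (TKFrac e H ∩ {w | σ w1 ≤ σ w}) :=
    hcpt.inter_right (isClosed_le continuous_const hσ)
  obtain ⟨w, hwext⟩ := hcptA.extremePoints_nonempty ⟨w1, hw1, le_refl (σ w1)⟩
  obtain ⟨⟨hw, hwσ⟩, hextr⟩ := mem_extremePoints.mp hwext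
  have hmax : ∀ w' ∈ TKFrac e H, σ w' ≤ σ w := fun w' hw' => (hw1max hw').trans hwσ
  suffices hsuff : ∃ M ⊆ H, (∀ x ∈ M, ∀ y ∈ M, x ≠ y → Disjoint (e x) (e y)) ∧
      (d : ℝ) * ∑ x, w x ≤ ((d : ℝ) ^ 2 - d + 1) * M.card by
    obtain ⟨M, h1, h2, h3⟩ := hsuff
    refine ⟨M, h1, h2, le_trans ?_ h3⟩
    exact mul_le_mul_of_nonneg_left (hmax w0 hw0) (by positivity)
  have hrestr := fun H' => tk_frac_restrict e H H' w hw
  by_cases hz : ∃ x ∈ H, w x = 0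
  · obtain ⟨x, hx, hwx⟩ := hz
    obtain ⟨M, h1, h2, h3⟩ := ih (H.erase x) (Finset.erase_ssubset hx) _ (hrestr _)
    refine ⟨M, h1.trans (Finset.erase_subset _ _), h2, le_trans (le_of_eq ?_) h3⟩
    congr 1
    apply Finset.sum_congr rfl
    intro y _
    split_ifs with hy
    · rfl
    · by_cases hyx : y = x
      · rw [hyx, hwx]
      · exact hw.2.1 y (by simpa [hyx] using hy)
  push Not at hz
  obtain ⟨x0, hx0, hx0w⟩ := tk_heavy_edge d hd e hcard H hH w hw (by
    rintro u hu ⟨hp, hm⟩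
    have s1 : σ (w + u) = σ w + σ u := by simp [σ, Finset.sum_add_distrib]
    have s2 : σ (w - u) = σ w - σ u := by simp [σ, Finset.sum_sub_distrib]
    have m1 := hmax _ hp
    have m2 := hmax _ hm
    have := hextr (w + u) ⟨hp, by simp only [Set.mem_ofPred_eq] at hwσ ⊢; linarith⟩
      (w - u) ⟨hm, by simp only [Set.mem_ofPred_eq] at hwσ ⊢; linarith⟩
      ⟨1 / 2, 1 / 2, by norm_num, by norm_num, by norm_num, by ext x; simp; ring⟩
    apply hu
    simpa using this.1) (fun x hx => lt_of_le_of_ne (hw.1 x) (Ne.symm (hz x hx)))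
  let H' := H.filter fun x => Disjoint (e x0) (e x)
  have hx0H' : x0 ∉ H' := by
    simp only [H', Finset.mem_filter, disjoint_self, Finset.bot_eq_empty, not_and]
    intro _; exact (hne x0).ne_empty
  have hss : H' ⊂ H := by
    refine Finset.ssubset_iff_subset_ne.mpr ⟨Finset.filter_subset _ _, fun h => ?_⟩
    rw [h] at hx0H'; exact hx0H' hx0
  obtain ⟨M, h1, h2, h3⟩ := ih H' hss _ (hrestr _)
  have hx0M : x0 ∉ M := fun h => hx0H' (h1 h)
  have hdisj : ∀ y ∈ M, Disjoint (e x0) (e y) := fun y hy => (Finset.mem_filter.mp (h1 hy)).2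
  refine ⟨insert x0 M, ?_, ?_, ?_⟩
  · intro y hy
    rcases Finset.mem_insert.mp hy with rfl | hy
    · exact hx0
    · exact hss.1 (h1 hy)
  · intro x hx y hy hxy
    rcases Finset.mem_insert.mp hx with rfl | hx' <;> rcases Finset.mem_insert.mp hy with rfl | hy'
    · exact absurd rfl hxy
    · exact hdisj y hy'
    · exact (hdisj x hx').symm
    · exact h2 x hx' y hy' hxy
  · rw [Finset.card_insert_of_notMem hx0M]
    push_cast
    -- weight of the edges meeting x0
    have hsplit : ∑ x, w x = ∑ x, (if x ∈ H' then w x else 0) + ∑ x, (if x ∈ H' then 0 else w x) := by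
      rw [← Finset.sum_add_distrib]
      apply Finset.sum_congr rfl; intro x _; split_ifs <;> simp
    have hdc : ∑ v ∈ e x0, ∑ x, (if v ∈ e x then w x else 0) ≤ (e x0).card := by
      have := Finset.sum_le_card_nsmul (e x0) (fun v => ∑ x, (if v ∈ e x then w x else 0)) 1
        (fun v _ => hw.2.2 v)
      simpa using this
    rw [Finset.sum_comm] at hdc
    have hk1 : (1 : ℝ) ≤ (e x0).card := by exact_mod_cast Finset.card_pos.mpr (hne x0)
    have hkd : ((e x0).card : ℝ) ≤ d := by exact_mod_cast hcard x0
    have hcmp : ∑ x, ((if x ∈ H' then 0 else w x) + (if x = x0 then (((e x0).card : ℝ) - 1) * w x0 else 0))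
        ≤ ∑ x, ∑ v ∈ e x0, (if v ∈ e x then w x else 0) := by
      apply Finset.sum_le_sum
      intro x _
      by_cases hxx : x = x0
      · subst hxx
        rw [if_neg hx0H', if_pos rfl, Finset.sum_congr rfl (g := fun _ => w x)]
        · simp; linarith
        · intro v hv; simp [hv]
      · rw [if_neg hxx, add_zero]
        have hnn : ∀ v ∈ e x0, 0 ≤ (if v ∈ e x then w x else 0) := by
          intro v _; split_ifs <;> simp [hw.1 x]
        split_ifs with hxH'
        · exact Finset.sum_nonneg hnn
        · by_cases hxH : x ∈ H
          · have : ¬ Disjoint (e x0) (e x) := fun h => hxH' (Finset.mem_filter.mpr ⟨hxH, h⟩)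
            obtain ⟨v, hv0, hv⟩ := Finset.not_disjoint_iff.mp this
            have := Finset.single_le_sum hnn hv0
            simpa [hv] using this
          · rw [hw.2.1 x hxH]; simp
    rw [Finset.sum_add_distrib, Finset.sum_ite_eq' ] at hcmp
    simp only [Finset.mem_univ, if_true] at hcmp
    have hd1 : (1 : ℝ) ≤ d := by exact_mod_cast hd
    set k : ℝ := ((e x0).card : ℝ)
    have hA : ∑ x, (if x ∈ H' then 0 else w x) ≤ k - (k - 1) * w x0 := by linarith
    have hB : (d : ℝ) * ∑ x, (if x ∈ H' then 0 else w x) ≤ d ^ 2 - d + 1 := by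
      have c1 : (d : ℝ) * ∑ x, (if x ∈ H' then 0 else w x) ≤ d * (k - (k - 1) * w x0) :=
        mul_le_mul_of_nonneg_left hA (by positivity)
      have c2 : (k - 1) * 1 ≤ (k - 1) * (d * w x0) := mul_le_mul_of_nonneg_left hx0w (by linarith)
      have c3 : (d - 1) * k ≤ (d - 1) * (d : ℝ) := mul_le_mul_of_nonneg_left hkd (by linarith)
      nlinarith
    rw [hsplit, mul_add]
    linarith

/-- The cut points in `[-B, B]` determined by a point `x` of the simplex. -/
noncomputable def tkP {n : ℕ} (B : ℝ) (x : Fin n → ℝ) (j : ℕ) : ℝ :=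
  -B + 2 * B * ∑ i : Fin n, if i.val < j then x i else 0

theorem tkP_continuous {n : ℕ} (B : ℝ) (j : ℕ) : Continuous fun x : Fin n → ℝ => tkP B x j := by
  unfold tkP
  refine continuous_const.add (continuous_const.mul (continuous_finsetSum _ fun i _ => ?_))
  split_ifs
  · exact continuous_apply i
  · exact continuous_const

theorem tkP_mono {n : ℕ} (B : ℝ) (hB : 0 ≤ B) (x : Fin n → ℝ) (hx : ∀ i, 0 ≤ x i) :
    Monotone (tkP B x) := by
  intro j k hjk
  unfold tkP
  have : ∑ i : Fin n, (if i.val < j then x i else 0) ≤ ∑ i : Fin n, (if i.val < k then x i else 0) := by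
    apply Finset.sum_le_sum
    intro i _
    split_ifs with h1 h2 h2
    · exact le_refl _
    · omega
    · exact hx i
    · exact le_refl _
  nlinarith

theorem tkP_zero {n : ℕ} (B : ℝ) (x : Fin n → ℝ) : tkP B x 0 = -B := by simp [tkP]

theorem tkP_last {n : ℕ} (B : ℝ) (x : Fin n → ℝ) (hx : x ∈ stdSimplex ℝ (Fin n)) :
    tkP B x n = B := by
  have : ∑ i : Fin n, (if i.val < n then x i else 0) = 1 := by
    rw [← hx.2]; apply Finset.sum_congr rfl; intro i _; simp
  rw [tkP, this]; ring

theorem tkP_succ {n : ℕ} (B : ℝ) (x : Fin n → ℝ) (i : Fin n) (hx : x i = 0) :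
    tkP B x (i.val + 1) = tkP B x i.val := by
  unfold tkP
  congr 2
  apply Finset.sum_congr rfl
  intro k _
  by_cases h : k = i
  · subst h; simp [hx]
  · have : k.val ≠ i.val := fun h' => h (Fin.ext h')
    by_cases h2 : k.val < i.val
    · rw [if_pos h2, if_pos (by omega)]
    · rw [if_neg h2, if_neg (by omega)]

/-- gap number `i` -/
def tkG {n : ℕ} (B : ℝ) (x : Fin n → ℝ) (i : Fin n) : Set ℝ :=
  Set.Ioo (tkP B x i.val) (tkP B x (i.val + 1))

theorem tkG_disj {n : ℕ} (B : ℝ) (hB : 0 ≤ B) (x : Fin n → ℝ) (hx : ∀ i, 0 ≤ x i) (i j : Fin n)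
    (t : ℝ) (hi : t ∈ tkG B x i) (hj : t ∈ tkG B x j) : i = j := by
  have hm := tkP_mono B hB x hx
  by_contra hne
  have : i.val ≠ j.val := fun h => hne (Fin.ext h)
  rcases lt_or_gt_of_ne this with h | h
  · have := hm (show i.val + 1 ≤ j.val by omega)
    have := hi.2; have := hj.1; linarith
  · have := hm (show j.val + 1 ≤ i.val by omega)
    have := hj.2; have := hi.1; linarith

/-- the region of those `x` for which the set `K` lies in the gaps of `T` and meets each of them -/
def tkB {n : ℕ} (B : ℝ) (K : Set ℝ) (T : Finset (Fin n)) : Set (Fin n → ℝ) :=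
  {x | (∀ t ∈ K, ∃ i ∈ T, t ∈ tkG B x i) ∧ ∀ i ∈ T, ∃ t ∈ K, t ∈ tkG B x i}

theorem tkB_open {n : ℕ} (B : ℝ) (K : Set ℝ) (hK : IsCompact K) (T : Finset (Fin n)) :
    IsOpen (tkB B K T) := by
  have hGo : ∀ i : Fin n, IsOpen {q : (Fin n → ℝ) × ℝ | q.2 ∈ tkG B q.1 i} := by
    intro i
    have : {q : (Fin n → ℝ) × ℝ | q.2 ∈ tkG B q.1 i} =
      {q | tkP B q.1 i.val < q.2} ∩ {q | q.2 < tkP B q.1 (i.val + 1)} := by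
      ext q; simp [tkG]
    rw [this]
    exact (isOpen_lt ((tkP_continuous B _).comp continuous_fst) continuous_snd).inter
      (isOpen_lt continuous_snd ((tkP_continuous B _).comp continuous_fst))
  have hA : IsOpen {x : Fin n → ℝ | ∀ t ∈ K, ∃ i ∈ T, t ∈ tkG B x i} := by
    rw [isOpen_iff_mem_nhds]
    intro x hx
    have hU : IsOpen {q : (Fin n → ℝ) × ℝ | ∃ i ∈ T, q.2 ∈ tkG B q.1 i} := by
      have : {q : (Fin n → ℝ) × ℝ | ∃ i ∈ T, q.2 ∈ tkG B q.1 i} =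
        ⋃ i ∈ T, {q : (Fin n → ℝ) × ℝ | q.2 ∈ tkG B q.1 i} := by ext q; simp
      rw [this]
      exact isOpen_biUnion fun i _ => hGo i
    exact hK.eventually_forall_of_forall_eventually fun t ht => hU.mem_nhds (hx t ht)
  have hC : IsOpen {x : Fin n → ℝ | ∀ i ∈ T, ∃ t ∈ K, t ∈ tkG B x i} := by
    have : {x : Fin n → ℝ | ∀ i ∈ T, ∃ t ∈ K, t ∈ tkG B x i} =
        ⋂ i ∈ T, ⋃ t ∈ K, {x | t ∈ tkG B x i} := by ext x; simp
    rw [this]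
    refine isOpen_biInter_finset fun i _ => isOpen_biUnion fun t _ => ?_
    exact (hGo i).preimage (continuous_id.prodMk continuous_const)
  exact hA.inter hC

theorem tkB_card {n d : ℕ} (B : ℝ) (hB : 0 ≤ B) (K : Set ℝ) (hK : IsDInterval d K)
    (T : Finset (Fin n)) (x : Fin n → ℝ) (hx : ∀ i, 0 ≤ x i) (hxB : x ∈ tkB B K T) :
    T.card ≤ d := by
  obtain ⟨hKne, k, a, b, hkd, -, -, rfl⟩ := hK
  obtain ⟨h1, h2⟩ := hxB
  have hm := tkP_mono B hB x hx
  have : ∀ i : Fin n, ∃ l : Fin k, i ∈ T → ∃ t ∈ Set.Icc (a l) (b l), t ∈ tkG B x i := by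
    intro i
    by_cases hi : i ∈ T
    · obtain ⟨t, ht, htG⟩ := h2 i hi
      obtain ⟨l, hl⟩ := Set.mem_iUnion.mp ht
      exact ⟨l, fun _ => ⟨t, hl, htG⟩⟩
    · obtain ⟨t0, ht0⟩ := hKne
      obtain ⟨l, _⟩ := Set.mem_iUnion.mp ht0
      exact ⟨l, fun h => absurd h hi⟩
  choose l hl using this
  have key : ∀ i ∈ T, ∀ j ∈ T, l i = l j → ¬ i.val < j.val := by
    intro i hi j hj hij hlt
    obtain ⟨t, ht, htG⟩ := hl i hi
    obtain ⟨t', ht', htG'⟩ := hl j hj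
    rw [← hij] at ht'
    have hle := hm (show i.val + 1 ≤ j.val by omega)
    have hin : tkP B x (i.val + 1) ∈ Set.Icc (a (l i)) (b (l i)) :=
      ⟨ht.1.trans htG.2.le, (hle.trans htG'.1.le).trans ht'.2⟩
    obtain ⟨q, _, hq⟩ := h1 _ (Set.mem_iUnion.mpr ⟨_, hin⟩)
    by_cases hqi : q.val ≤ i.val
    · have := hm (show q.val + 1 ≤ i.val + 1 by omega)
      have := hq.2
      linarith
    · have := hm (show i.val + 1 ≤ q.val by omega)
      have := hq.1
      linarith
  have hc : T.card ≤ (Finset.univ : Finset (Fin k)).card := by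
    apply Finset.card_le_card_of_injOn l (fun _ _ => Finset.mem_coe.mpr (Finset.mem_univ _))
    intro i hi j hj hij
    apply Fin.ext
    have := key i hi j hj hij
    have := key j hj i hi hij.symm
    omega
  simp at hc
  omega

/-- Tardos–Kaiser: a finite family of `d`-intervals with the `(p,2)`-property can be
pierced by at most `(d² - d + 1)(p - 1)` points. -/
theorem tardos_kaiser {d p : ℕ} (hd : 1 ≤ d) (hp : 2 ≤ p) {ι : Type*} [Fintype ι]
    (F : ι → Set ℝ) (hF : ∀ i, IsDInterval d (F i))
    (hp2 : ∀ P : Finset ι, P.card = p →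
      ∃ Q ⊆ P, Q.card = 2 ∧ (⋂ i ∈ Q, F i).Nonempty) :
    ∃ C : Finset ℝ, C.card ≤ (d ^ 2 - d + 1) * (p - 1) ∧ ∀ i, ∃ x ∈ C, x ∈ F i := by
  classical
  by_contra hcon
  push Not at hcon
  set k := (d ^ 2 - d + 1) * (p - 1) with hk
  have hk1 : 1 ≤ k := Nat.mul_pos (by omega) (by omega)
  let n := k + 1
  have hcptF : ∀ f, IsCompact (F f) := by
    intro f
    obtain ⟨-, k', a, b, -, -, -, h⟩ := hF f
    rw [h]
    exact isCompact_iUnion fun i => isCompact_Icc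
  obtain ⟨B, hB0, hB⟩ : ∃ B : ℝ, 0 < B ∧ ∀ f, ∀ t ∈ F f, -B < t ∧ t < B := by
    have hc : IsCompact (⋃ f, F f) := isCompact_iUnion hcptF
    obtain ⟨r, hr0, hr⟩ := hc.isBounded.subset_ball_lt 0 (0 : ℝ)
    refine ⟨r, hr0, fun f t ht => ?_⟩
    have := hr (Set.mem_iUnion.mpr ⟨f, ht⟩)
    rw [Metric.mem_ball, Real.dist_eq, sub_zero, abs_lt] at this
    exact this
  let Q := ι × Finset (Fin n)
  let U : Q → Set (Fin n → ℝ) := fun q => tkB B (F q.1) q.2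
  have hUo : ∀ q, IsOpen (U q) := fun q => tkB_open B _ (hcptF q.1) q.2
  have hUne : ∀ q, (U q)ᶜ.Nonempty := by
    intro q
    refine ⟨0, fun h => ?_⟩
    obtain ⟨t, ht⟩ := (hF q.1).1
    obtain ⟨i, -, hi⟩ := h.1 t ht
    have := tkP_succ B (0 : Fin n → ℝ) i rfl
    have h1 := hi.1
    have h2 := hi.2
    linarith
  let g : Q → (Fin n → ℝ) → ℝ := fun q x => Metric.infDist x (U q)ᶜ
  have hgc : ∀ q, Continuous (g q) := fun q => Metric.continuous_infDist_pt _
  have hg0 : ∀ q x, 0 ≤ g q x := fun q x => Metric.infDist_nonneg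
  have hgpos : ∀ q x, x ∈ U q → 0 < g q x := by
    intro q x hx
    exact ((hUo q).isClosed_compl.notMem_iff_infDist_pos (hUne q)).mp (fun h => h hx)
  have hgz : ∀ q x, x ∉ U q → g q x = 0 := fun q x hx => Metric.infDist_zero_of_mem hx
  obtain ⟨x, hx, hbal⟩ := tk_balanced n (by omega)
    (fun x i => ∑ q : Q, if i ∈ q.2 then g q x else 0)
    (fun i => by
      refine continuous_finsetSum _ fun q _ => ?_
      split_ifs
      · exact hgc q
      · exact continuous_const)
    (fun x _ i => Finset.sum_nonneg fun q _ => by split_ifs <;> simp [hg0])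
    (by
      intro x hx i hi
      apply Finset.sum_eq_zero
      intro q _
      split_ifs with hiq
      · apply hgz
        intro h
        obtain ⟨t, -, ht⟩ := h.2 i hiq
        have := tkP_succ B x i hi
        have h1 := ht.1
        have h2 := ht.2
        linarith
      · rfl)
  -- the common value
  let i0 : Fin n := ⟨0, by omega⟩
  set c : ℝ := ∑ q : Q, if i0 ∈ q.2 then g q x else 0 with hc
  have hci : ∀ i, ∑ q : Q, (if i ∈ q.2 then g q x else 0) = c := fun i => hbal i i0
  have hc0 : 0 < c := by
    obtain ⟨f, hf⟩ := hcon ((Finset.Icc 1 k).image (tkP B x))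
      (Finset.card_image_le.trans (by simp))
    have hf' : ∀ j, 1 ≤ j → j ≤ k → tkP B x j ∉ F f := fun j h1 h2 =>
      hf _ (Finset.mem_image_of_mem _ (Finset.mem_Icc.mpr ⟨h1, h2⟩))
    have hcov : ∀ t ∈ F f, ∃ i : Fin n, t ∈ tkG B x i := by
      intro t ht
      have hlast := tkP_last B x hx
      have hzero := tkP_zero B x
      obtain ⟨hb1, hb2⟩ := hB f t ht
      have hex : ∃ j, t ≤ tkP B x j := ⟨n, by rw [hlast]; exact hb2.le⟩
      have hjs := Nat.find_spec hex
      have hjn : Nat.find hex ≤ n := Nat.find_min' hex (by rw [hlast]; exact hb2.le)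
      have hj0 : Nat.find hex ≠ 0 := by
        intro h0; rw [h0, hzero] at hjs; linarith
      obtain ⟨j, hj⟩ := Nat.exists_eq_succ_of_ne_zero hj0
      have hjlt : ¬ t ≤ tkP B x j := Nat.find_min hex (by omega)
      rw [hj] at hjs hjn
      refine ⟨⟨j, by omega⟩, lt_of_not_ge hjlt, lt_of_le_of_ne hjs ?_⟩
      intro heq
      by_cases hjk : j + 1 ≤ k
      · exact hf' (j + 1) (by omega) hjk (by rw [← show j.succ = j + 1 from rfl, ← heq]; exact ht)
      · have : j.succ = n := by omega
        have heq' : t = tkP B x j.succ := heq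
        rw [this, hlast] at heq'
        linarith
    let T : Finset (Fin n) := Finset.univ.filter fun i => ∃ t ∈ F f, t ∈ tkG B x i
    have hxU : x ∈ U (f, T) := by
      refine ⟨fun t ht => ?_, fun i hi => by simpa [T] using hi⟩
      obtain ⟨i, hi⟩ := hcov t ht
      exact ⟨i, by simpa [T] using ⟨t, ht, hi⟩, hi⟩
    obtain ⟨t, ht⟩ := (hF f).1
    obtain ⟨i, hiT, hi⟩ := hxU.1 t ht
    rw [← hci i]
    refine lt_of_lt_of_le (hgpos (f, T) x hxU) ?_
    have := Finset.single_le_sum (f := fun q : Q => if i ∈ q.2 then g q x else 0) (s := Finset.univ)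
      (fun q _ => by split_ifs <;> simp [hg0]) (Finset.mem_univ (f, T))
    simpa [show i ∈ T from hiT] using this
  let E := {q : Q // x ∈ U q}
  have hsumE : ∀ φ : Q → ℝ, (∀ q, x ∉ U q → φ q = 0) → ∑ q : E, φ q.1 = ∑ q : Q, φ q := by
    intro φ hφ
    rw [← Finset.sum_subtype (Finset.univ.filter fun q => x ∈ U q) (by simp) φ]
    apply Finset.sum_subset (Finset.subset_univ _)
    intro q _ hq
    exact hφ q (by simpa using hq)
  have hEne : ∀ q : E, q.1.2.Nonempty := by
    intro q
    obtain ⟨t, ht⟩ := (hF q.1.1).1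
    obtain ⟨i, hi, -⟩ := q.2.1 t ht
    exact ⟨i, hi⟩
  have hEd : ∀ q : E, q.1.2.card ≤ d := fun q =>
    tkB_card B hB0.le _ (hF q.1.1) _ x hx.1 q.2
  let w : E → ℝ := fun q => g q.1 x / c
  have hwdeg : ∀ v, ∑ q : E, (if v ∈ q.1.2 then w q else 0) = 1 := by
    intro v
    have h1 := hsumE (fun q => if v ∈ q.2 then g q x / c else 0) (by
      intro q hq; simp [hgz q x hq])
    have h2 : ∑ q : Q, (if v ∈ q.2 then g q x / c else 0) = 1 := by
      rw [← div_self hc0.ne']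
      nth_rewrite 2 [← hci v]
      rw [Finset.sum_div]
      apply Finset.sum_congr rfl
      intro q _
      split_ifs <;> simp
    exact h1.trans h2
  have hw0 : ∀ q, 0 ≤ w q := fun q => div_nonneg (hg0 _ _) hc0.le
  obtain ⟨M, -, hMd, hMc⟩ := tk_furedi d hd (fun q : E => q.1.2) hEne hEd Finset.univ w
    ⟨hw0, fun q hq => absurd (Finset.mem_univ q) hq, fun v => (hwdeg v).le⟩
  have hnM : (n : ℝ) ≤ ((d : ℝ) ^ 2 - d + 1) * M.card := by
    refine le_trans ?_ hMc
    have : (n : ℝ) = ∑ v : Fin n, ∑ q : E, (if v ∈ q.1.2 then w q else 0) := by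
      simp [hwdeg]
    rw [this, Finset.sum_comm, Finset.mul_sum]
    apply Finset.sum_le_sum
    intro q _
    rw [Finset.sum_ite_mem, Finset.univ_inter, Finset.sum_const, nsmul_eq_mul]
    exact mul_le_mul_of_nonneg_right (by exact_mod_cast hEd q) (hw0 q)
  have hdd : d ≤ d ^ 2 := by nlinarith
  have hMp : p ≤ M.card := by
    have h1 : n ≤ (d ^ 2 - d + 1) * M.card := by
      have : ((d ^ 2 - d + 1 : ℕ) : ℝ) = (d : ℝ) ^ 2 - d + 1 := by
        push_cast [Nat.cast_sub hdd]; ring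
      rw [← this] at hnM
      exact_mod_cast hnM
    by_contra hlt
    push Not at hlt
    have h2 : (d ^ 2 - d + 1) * M.card ≤ k := Nat.mul_le_mul_left _ (by omega)
    omega
  have hdisjF : ∀ q ∈ M, ∀ q' ∈ M, q ≠ q' → ∀ t, t ∈ F q.1.1 → t ∉ F q'.1.1 := by
    intro q hq q' hq' hne t ht ht'
    obtain ⟨i, hi, hiG⟩ := q.2.1 t ht
    obtain ⟨j, hj, hjG⟩ := q'.2.1 t ht'
    have hij := tkG_disj B hB0.le x hx.1 i j t hiG hjG
    subst hij
    exact Finset.disjoint_left.mp (hMd q hq q' hq' hne) hi hj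
  have hinj : Set.InjOn (fun q : E => q.1.1) (M : Set E) := by
    intro q hq q' hq' h
    by_contra hne
    obtain ⟨t, ht⟩ := (hF q.1.1).1
    have h' : q.1.1 = q'.1.1 := h
    exact hdisjF q hq q' hq' hne t ht (h' ▸ ht)
  obtain ⟨P, hPM, hPc⟩ := Finset.exists_subset_card_eq
    (show p ≤ (M.image fun q : E => q.1.1).card by rw [Finset.card_image_of_injOn hinj]; exact hMp)
  obtain ⟨R, hRP, hRc, t, ht⟩ := hp2 P hPc
  obtain ⟨f, f', hff', rfl⟩ := Finset.card_eq_two.mp hRc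
  have htf : t ∈ F f := by
    simp only [Set.mem_iInter] at ht; exact ht f (by simp)
  have htf' : t ∈ F f' := by
    simp only [Set.mem_iInter] at ht; exact ht f' (by simp)
  obtain ⟨q, hq, rfl⟩ := Finset.mem_image.mp (hPM (hRP (show f ∈ ({f, f'} : Finset ι) by simp)))
  obtain ⟨q', hq', rfl⟩ := Finset.mem_image.mp (hPM (hRP (show f' ∈ ({q.1.1, f'} : Finset ι) by simp)))
  exact hdisjF q hq q' hq' (fun h => hff' (by rw [h])) t htf htf'
end
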